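/- Let R = 5.573412. The Riemann zeta function ζ has no zeros s = σ + it with t ≥ 3 and σ ≥ 1 − 1/(R · log t); that is, if t ≥ 3 and σ ≥ 1 − 1/(5.573412 · log t), then ζ(σ + it) ≠ 0. -/

import Mathlib

namespace ZFR
open Complex Set Filter Topology MeasureTheory

/-- The Riemann xi function, normalised to `xi 0 = xi 1 = 1`. -/
noncomputable def xi (s : ℂ) : ℂ := s * (s - 1) * completedRiemannZeta₀ s + 1

lemma xi_differentiable : Differentiable ℂ xi := by
  unfold xi
  have := differentiable_completedZeta₀
  fun_prop

lemma xi_one_sub (s : ℂ) : xi (1 - s) = xi s := by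
  unfold xi
  rw [completedRiemannZeta₀_one_sub]
  ring

lemma xi_eq {s : ℂ} (h0 : s ≠ 0) (h1 : s ≠ 1) : xi s = s * (s - 1) * completedRiemannZeta s := by
  have h2 : (1 : ℂ) - s ≠ 0 := sub_ne_zero.mpr (Ne.symm h1)
  rw [completedRiemannZeta_eq, xi]
  field_simp
  ring

lemma mellin_strip (f : ℝ → ℂ) (hf : ∀ s, MellinConvergent f s) (a b : ℝ) :
    ∃ B : ℝ, 0 ≤ B ∧ ∀ s : ℂ, a ≤ s.re → s.re ≤ b → ‖mellin f s‖ ≤ B := by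
  have hIntg : ∀ x : ℝ, IntegrableOn (fun t : ℝ => t ^ (x - 1) * ‖f t‖) (Ioi 0) := by
    intro x
    have h := (hf x).norm
    refine IntegrableOn.congr_fun h ?_ measurableSet_Ioi
    intro t ht
    have ht' : (0 : ℝ) < t := ht
    simp only [norm_smul]
    rw [Complex.norm_cpow_eq_rpow_re_of_pos ht']
    simp
  refine ⟨(∫ t in Ioi (0:ℝ), t ^ (a - 1) * ‖f t‖) + ∫ t in Ioi (0:ℝ), t ^ (b - 1) * ‖f t‖, ?_, ?_⟩
  · apply add_nonneg <;>
    · apply setIntegral_nonneg measurableSet_Ioi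
      intro t ht
      have ht' : (0 : ℝ) < t := ht
      positivity
  · intro s ha hb
    unfold mellin
    rw [← integral_add (hIntg a) (hIntg b)]
    refine (norm_integral_le_integral_norm _).trans ?_
    refine setIntegral_mono_on (hf s).norm ((hIntg a).add (hIntg b)) measurableSet_Ioi ?_
    intro t ht
    have ht' : (0 : ℝ) < t := ht
    rw [norm_smul, Complex.norm_cpow_eq_rpow_re_of_pos ht', ← add_mul]
    apply mul_le_mul_of_nonneg_right _ (norm_nonneg _)
    simp only [sub_re, one_re]
    rcases le_total 1 t with h1 | h1
    · have : t ^ (s.re - 1) ≤ t ^ (b - 1) := Real.rpow_le_rpow_of_exponent_le h1 (by linarith)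
      have : 0 ≤ t ^ (a - 1) := by positivity
      linarith
    · have : t ^ (s.re - 1) ≤ t ^ (a - 1) :=
        Real.rpow_le_rpow_of_exponent_ge ht' h1 (by linarith)
      have : 0 ≤ t ^ (b - 1) := by positivity
      linarith

lemma Lambda0_strip : ∃ B : ℝ, 0 ≤ B ∧ ∀ s : ℂ, 1/2 ≤ s.re → s.re ≤ 2 →
    ‖completedRiemannZeta₀ s‖ ≤ B := by
  have hconv : ∀ s, MellinConvergent (HurwitzZeta.hurwitzEvenFEPair 0).f_modif s := by
    intro s
    have hP := (HurwitzZeta.hurwitzEvenFEPair 0).isStrongFEPair_toStrongFEPair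
    obtain ⟨_, ht⟩ := exists_gt s.re
    obtain ⟨_, hu⟩ := exists_lt s.re
    exact mellinConvergent_of_isBigO_rpow (WeakFEPair.toStrongFEPair _).hf_int (hP.hf_top _) ht
      (hP.hf_zero _) hu
  obtain ⟨B, hB0, hB⟩ := mellin_strip _ hconv (1/4) 1
  refine ⟨B / 2, by positivity, ?_⟩
  intro s h1 h2
  have : completedRiemannZeta₀ s = mellin (HurwitzZeta.hurwitzEvenFEPair 0).f_modif (s/2) / 2 := rfl
  rw [this, norm_div]
  have h3 : (s/2).re = s.re / 2 := by simp
  have := hB (s/2) (by rw [h3]; linarith) (by rw [h3]; linarith)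
  simp only [Complex.norm_ofNat]
  linarith

lemma norm_Gamma_le {s : ℂ} (hs : 0 < s.re) : ‖Complex.Gamma s‖ ≤ Real.Gamma s.re := by
  rw [Complex.Gamma_eq_integral hs, Real.Gamma_eq_integral hs, GammaIntegral]
  refine (norm_integral_le_integral_norm _).trans (le_of_eq ?_)
  refine setIntegral_congr_fun measurableSet_Ioi ?_
  intro t ht
  have ht' : (0 : ℝ) < t := ht
  simp only [norm_mul]
  rw [Complex.norm_cpow_eq_rpow_re_of_pos ht', Complex.norm_of_nonneg (Real.exp_pos _).le]
  simp

lemma Gamma_le_exp {x : ℝ} (hx : 1 ≤ x) : Real.Gamma x ≤ Real.exp (2 * x ^ (3/2 : ℝ)) := by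
  have hx0 : 0 < x := by linarith
  set n := ⌊x⌋₊ with hn
  have hn1 : 1 ≤ n := Nat.one_le_iff_ne_zero.mpr (by
    have : 0 < n := Nat.floor_pos.mpr hx
    omega)
  have hnx : (n : ℝ) ≤ x := Nat.floor_le hx0.le
  have hxn : x ≤ n + 1 := (Nat.lt_floor_add_one x).le
  have hn0 : (0:ℝ) < n := by exact_mod_cast hn1
  have hfac : (n.factorial : ℝ) ≤ x ^ x := by
    have h1 : (n.factorial : ℝ) ≤ (n : ℝ) ^ n := by exact_mod_cast Nat.factorial_le_pow n
    have h2 : (n : ℝ) ^ n ≤ x ^ n := by gcongr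
    have h3 : x ^ n ≤ x ^ x := by
      rw [← Real.rpow_natCast]
      exact Real.rpow_le_rpow_of_exponent_le hx hnx
    linarith
  have hG : Real.Gamma x ≤ n.factorial := by
    have hc := Real.convexOn_Gamma
    have hmem : x ∈ segment ℝ (n:ℝ) (n+1) := by
      rw [segment_eq_Icc (by linarith)]
      exact ⟨hnx, hxn⟩
    have := hc.le_max_of_mem_segment (x := (n:ℝ)) (y := n+1) (by exact hn0)
      (by show (0:ℝ) < n + 1; linarith) hmem
    refine this.trans (max_le ?_ ?_)
    · obtain ⟨m, hm⟩ : ∃ m, n = m + 1 := ⟨n - 1, by omega⟩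
      rw [hm]
      push_cast
      rw [Real.Gamma_nat_eq_factorial]
      exact_mod_cast Nat.factorial_le (Nat.le_succ m)
    · rw [Real.Gamma_nat_eq_factorial]
  refine hG.trans (hfac.trans ?_)
  rw [Real.rpow_def_of_pos hx0]
  apply Real.exp_le_exp.mpr
  have hl : Real.log x ≤ x ^ (1/2:ℝ) / (1/2) := Real.log_le_rpow_div hx0.le (by norm_num)
  have : x ^ (3/2:ℝ) = x ^ (1/2:ℝ) * x := by
    rw [← Real.rpow_add_one hx0.ne']
    norm_num
  rw [this]
  nlinarith

lemma zeta_bdd : ∃ B : ℝ, 0 ≤ B ∧ ∀ s : ℂ, 2 ≤ s.re → ‖riemannZeta s‖ ≤ B := by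
  have hsum : Summable (fun n : ℕ => 1 / (n : ℝ) ^ 2) := by
    simp [Real.summable_one_div_nat_pow]
  refine ⟨∑' n : ℕ, 1 / (n : ℝ) ^ 2, tsum_nonneg (fun n => by positivity), ?_⟩
  intro s hs
  rw [zeta_eq_tsum_one_div_nat_cpow (by linarith)]
  refine tsum_of_norm_bounded hsum.hasSum ?_
  intro n
  rcases Nat.eq_zero_or_pos n with rfl | hn
  · have : s ≠ 0 := by
      intro h; rw [h, Complex.zero_re] at hs; linarith
    simp [this]
  · rw [norm_div, Complex.norm_natCast_cpow_of_pos hn, norm_one]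
    have h1 : (1:ℝ) ≤ n := by exact_mod_cast hn
    have : (n:ℝ) ^ (2:ℕ) ≤ (n:ℝ) ^ s.re := by
      rw [← Real.rpow_natCast]
      exact Real.rpow_le_rpow_of_exponent_le h1 (by simpa using hs)
    gcongr

lemma xi_growth : ∃ C : ℝ, 0 ≤ C ∧ ∀ r : ℝ, 1 ≤ r → ∀ s : ℂ, ‖s - 1/2‖ ≤ r →
    ‖xi s‖ ≤ Real.exp (C * r ^ (3/2:ℝ)) := by
  obtain ⟨B, hB0, hB⟩ := Lambda0_strip
  obtain ⟨D, hD0, hD⟩ := zeta_bdd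
  refine ⟨10 + B + D, by positivity, ?_⟩
  intro r hr
  have hr32 : r ≤ r ^ (3/2:ℝ) := by
    conv_lhs => rw [← Real.rpow_one r]
    exact Real.rpow_le_rpow_of_exponent_le hr (by norm_num)
  suffices H : ∀ s : ℂ, ‖s - 1/2‖ ≤ r → 1/2 ≤ s.re → ‖xi s‖ ≤ Real.exp ((10 + B + D) * r ^ (3/2:ℝ)) by
    intro s hs
    rcases le_total (1/2) s.re with h | h
    · exact H s hs h
    · rw [← xi_one_sub]
      apply H
      · have h5 : (1 - s) - 1/2 = -(s - 1/2) := by ring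
        rw [h5, norm_neg]; exact hs
      · simp; linarith
  intro s hs hre
  have n1 : ‖s‖ ≤ r + 1 := by
    calc ‖s‖ = ‖(s - 1/2) + 1/2‖ := by rw [sub_add_cancel]
      _ ≤ ‖s - 1/2‖ + ‖(1/2:ℂ)‖ := norm_add_le _ _
      _ ≤ r + 1 := by norm_num; linarith
  have n2 : ‖s - 1‖ ≤ r + 1 := by
    calc ‖s - 1‖ = ‖(s - 1/2) - 1/2‖ := by ring_nf
      _ ≤ ‖s - 1/2‖ + ‖(1/2:ℂ)‖ := norm_sub_le _ _
      _ ≤ r + 1 := by norm_num; linarith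
  have hq : (r + 1) ≤ Real.exp r := Real.add_one_le_exp r
  have hq2 : (r + 1) * (r + 1) ≤ Real.exp (2 * r) := by
    have : Real.exp (2 * r) = Real.exp r * Real.exp r := by rw [← Real.exp_add]; ring_nf
    rw [this]
    gcongr
  rcases le_total s.re 2 with h2 | h2
  · have h3 := hB s hre h2
    unfold xi
    calc ‖s * (s - 1) * completedRiemannZeta₀ s + 1‖
        ≤ ‖s‖ * ‖s - 1‖ * ‖completedRiemannZeta₀ s‖ + 1 := by
          refine (norm_add_le _ _).trans ?_
          simp [norm_mul]
      _ ≤ (r + 1) * (r + 1) * B + 1 := by gcongr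
      _ ≤ Real.exp (2 * r) * B + Real.exp (2 * r) * 1 := by
          have : 1 ≤ Real.exp (2 * r) := Real.one_le_exp (by linarith)
          have := mul_le_mul_of_nonneg_right hq2 hB0
          linarith
      _ = Real.exp (2 * r) * (B + 1) := by ring
      _ ≤ Real.exp (2 * r) * Real.exp B := by gcongr; exact Real.add_one_le_exp B
      _ = Real.exp (2 * r + B) := by rw [Real.exp_add]
      _ ≤ _ := by
          apply Real.exp_le_exp.mpr
          nlinarith [mul_nonneg hB0 (by linarith : 0 ≤ r ^ (3/2:ℝ) - 1), mul_nonneg hD0 (by linarith : 0 ≤ r ^ (3/2:ℝ))]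
  · have hs0 : s ≠ 0 := by
      intro h; rw [h, Complex.zero_re] at h2; linarith
    have hs1 : s ≠ 1 := by
      intro h; rw [h, Complex.one_re] at h2; linarith
    have hG : 0 < (s/2).re := by simp; linarith
    have hGne : Gammaℝ s ≠ 0 := Gammaℝ_ne_zero_of_re_pos (by linarith)
    have hL : completedRiemannZeta s = Gammaℝ s * riemannZeta s := by
      rw [riemannZeta_def_of_ne_zero hs0]
      field_simp
    rw [xi_eq hs0 hs1, hL]
    have hre2 : (s/2).re = s.re / 2 := by simp
    have hsr : s.re ≤ r + 1 := (Complex.re_le_norm s).trans n1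
    have hGam : ‖Gammaℝ s‖ ≤ Real.exp (2 * r ^ (3/2:ℝ)) := by
      rw [Gammaℝ_def, norm_mul]
      have p1 : ‖(Real.pi : ℂ) ^ (-s / 2)‖ ≤ 1 := by
        rw [Complex.norm_cpow_eq_rpow_re_of_pos Real.pi_pos]
        apply Real.rpow_le_one_of_one_le_of_nonpos
        · linarith [Real.pi_gt_three]
        · simp; linarith
      have p2 : ‖Complex.Gamma (s/2)‖ ≤ Real.exp (2 * r ^ (3/2:ℝ)) := by
        refine (norm_Gamma_le hG).trans ?_
        rw [hre2]
        refine (Gamma_le_exp (by linarith)).trans ?_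
        apply Real.exp_le_exp.mpr
        have : (s.re / 2) ^ (3/2:ℝ) ≤ r ^ (3/2:ℝ) :=
          Real.rpow_le_rpow (by linarith) (by linarith) (by norm_num)
        linarith
      calc _ ≤ 1 * Real.exp (2 * r ^ (3/2:ℝ)) := by gcongr
        _ = _ := by ring
    calc ‖s * (s - 1) * (Gammaℝ s * riemannZeta s)‖
        = ‖s‖ * ‖s - 1‖ * (‖Gammaℝ s‖ * ‖riemannZeta s‖) := by simp [norm_mul]
      _ ≤ (r + 1) * (r + 1) * (Real.exp (2 * r ^ (3/2:ℝ)) * D) := by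
          gcongr
          exact hD s h2
      _ ≤ Real.exp (2 * r) * (Real.exp (2 * r ^ (3/2:ℝ)) * Real.exp D) := by
          gcongr
          linarith [Real.add_one_le_exp D]
      _ = Real.exp (2 * r + (2 * r ^ (3/2:ℝ) + D)) := by rw [Real.exp_add, Real.exp_add]
      _ ≤ _ := by
          apply Real.exp_le_exp.mpr
          nlinarith [mul_nonneg hD0 (by linarith : 0 ≤ r ^ (3/2:ℝ) - 1), mul_nonneg hB0 (by linarith : 0 ≤ r ^ (3/2:ℝ))]

end ZFR

namespace ZFR
open Complex Set Filter Topology MeasureTheory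

lemma order_ne_top {f : ℂ → ℂ} (hf : Differentiable ℂ f) {x : ℂ} (hx : f x ≠ 0) (ρ : ℂ) :
    analyticOrderAt f ρ ≠ ⊤ := by
  intro h
  rw [analyticOrderAt_eq_top] at h
  have hA : AnalyticOnNhd ℂ f univ := fun z _ => hf.analyticAt z
  have := hA.eqOn_zero_of_preconnected_of_eventuallyEq_zero isPreconnected_univ (mem_univ ρ) h
  exact hx (this (mem_univ x))

lemma fac1 {f : ℂ → ℂ} (hf : Differentiable ℂ f) (ρ : ℂ) (h : analyticOrderAt f ρ ≠ ⊤) :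
    ∃ g : ℂ → ℂ, Differentiable ℂ g ∧ g ρ ≠ 0 ∧
      ∀ s, f s = (s - ρ) ^ (analyticOrderNatAt f ρ) * g s := by
  have hn : analyticOrderAt f ρ = (analyticOrderNatAt f ρ : ℕ) := (Nat.cast_analyticOrderNatAt h).symm
  set n := analyticOrderNatAt f ρ
  obtain ⟨g0, hg0, hg0ne, hev⟩ := (hf.analyticAt ρ).analyticOrderAt_eq_natCast.mp hn
  classical
  refine ⟨fun s => if s = ρ then g0 ρ else f s / (s - ρ) ^ n, ?_, by simpa using hg0ne, ?_⟩
  · intro s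
    by_cases hs : s = ρ
    · subst hs
      refine hg0.differentiableAt.congr_of_eventuallyEq ?_
      filter_upwards [hev] with z hz
      by_cases hzs : z = s
      · simp [hzs]
      · have : z - s ≠ 0 := sub_ne_zero.mpr hzs
        simp only [hzs, if_false]
        rw [hz, smul_eq_mul]
        field_simp
    · have h1 : DifferentiableAt ℂ (fun s => f s / (s - ρ) ^ n) s := by
        refine (hf s).div (by fun_prop) ?_
        exact pow_ne_zero _ (sub_ne_zero.mpr hs)
      refine h1.congr_of_eventuallyEq ?_
      filter_upwards [isOpen_ne.mem_nhds hs] with z hz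
      simp [show z ≠ ρ from hz]
  · intro s
    by_cases hs : s = ρ
    · subst hs
      simpa using hev.self_of_nhds
    · have : s - ρ ≠ 0 := sub_ne_zero.mpr hs
      simp only [hs, if_false]
      field_simp

lemma fac {f : ℂ → ℂ} (hf : Differentiable ℂ f) {x : ℂ} (hx : f x ≠ 0) (Z : Finset ℂ) :
    ∃ g : ℂ → ℂ, Differentiable ℂ g ∧ (∀ ρ ∈ Z, g ρ ≠ 0) ∧
      ∀ s, f s = (∏ ρ ∈ Z, (s - ρ) ^ (analyticOrderNatAt f ρ)) * g s := by
  classical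
  induction Z using Finset.induction_on with
  | empty => exact ⟨f, hf, by simp, by simp⟩
  | insert a Z ha ih =>
    obtain ⟨g, hg, hgZ, hfg⟩ := ih
    have hgx : g x ≠ 0 := by
      intro h; apply hx; rw [hfg, h, mul_zero]
    have hP : Differentiable ℂ (fun s : ℂ => ∏ ρ ∈ Z, (s - ρ) ^ (analyticOrderNatAt f ρ)) := by
      fun_prop
    have hPa : (∏ ρ ∈ Z, (a - ρ) ^ (analyticOrderNatAt f ρ)) ≠ 0 := by
      rw [Finset.prod_ne_zero_iff]
      intro ρ hρ
      refine pow_ne_zero _ (sub_ne_zero.mpr ?_)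
      rintro rfl; exact ha hρ
    have hord : analyticOrderAt f a = analyticOrderAt g a := by
      have : f = (fun s : ℂ => ∏ ρ ∈ Z, (s - ρ) ^ (analyticOrderNatAt f ρ)) * g := by
        funext s; exact hfg s
      conv_lhs => rw [this]
      rw [analyticOrderAt_mul (hP.analyticAt a) (hg.analyticAt a)]
      have h0 : analyticOrderAt (fun s : ℂ => ∏ ρ ∈ Z, (s - ρ) ^ (analyticOrderNatAt f ρ)) a = 0 :=
        (hP.analyticAt a).analyticOrderAt_eq_zero.mpr hPa
      rw [h0, zero_add]
    have hordn : analyticOrderNatAt f a = analyticOrderNatAt g a := by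
      unfold analyticOrderNatAt; rw [hord]
    obtain ⟨g1, hg1, hg1a, hgg⟩ := fac1 hg a (order_ne_top hg hgx a)
    refine ⟨g1, hg1, ?_, ?_⟩
    · intro ρ hρ
      rcases Finset.mem_insert.mp hρ with rfl | hρ
      · exact hg1a
      · intro h0
        apply hgZ ρ hρ
        rw [hgg, h0, mul_zero]
    · intro s
      rw [Finset.prod_insert ha, hfg s, hgg s, hordn]
      ring

lemma zeros_finite {f : ℂ → ℂ} (hf : Differentiable ℂ f) {x : ℂ} (hx : f x ≠ 0) (c : ℂ) (r : ℝ) :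
    {z | z ∈ Metric.closedBall c r ∧ f z = 0}.Finite := by
  have hA : AnalyticOnNhd ℂ f univ := fun z _ => hf.analyticAt z
  have h1 := hA.preimage_zero_mem_codiscrete (x := x) hx
  have h2 : f ⁻¹' {0}ᶜ ∈ codiscreteWithin (Metric.closedBall c r) :=
    codiscreteWithin_mono (subset_univ _) h1
  have h3 := (isCompact_closedBall c r).finite_sdiff_of_mem_codiscreteWithin h2
  refine h3.subset ?_
  rintro z ⟨hz, hz0⟩
  exact ⟨hz, by simp [hz0]⟩

/-- If `g` is entire, zero-free on the open ball of radius `R` and `‖g‖ ≤ exp M * ‖g 0‖` there, then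
its logarithmic derivative varies slowly. -/
lemma logDeriv_var {g : ℂ → ℂ} (hg : Differentiable ℂ g) {R M : ℝ} (hR : 0 < R) (hM : 0 < M)
    (h0 : ∀ s ∈ Metric.ball (0:ℂ) R, g s ≠ 0)
    (hb : ∀ s ∈ Metric.ball (0:ℂ) R, ‖g s‖ ≤ Real.exp M * ‖g 0‖) {s : ℂ} (hs : ‖s‖ < R / 8) :
    ‖logDeriv g s - logDeriv g 0‖ ≤ 64 * M / R ^ 2 * ‖s‖ := by
  have hdl : DifferentiableOn ℂ (logDeriv g) (Metric.ball 0 R) := by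
    intro z hz
    refine DifferentiableAt.differentiableWithinAt ?_
    have : DifferentiableAt ℂ (deriv g) z := (hg.analyticAt z).deriv.differentiableAt
    exact this.div (hg z) (h0 z hz)
  obtain ⟨l, hl0, hl⟩ := hdl.isExactOn_ball.with_val_at 0 0
  have hmem0 : (0:ℂ) ∈ Metric.ball (0:ℂ) R := by simpa using hR
  have hg0 := h0 0 hmem0
  have hexp : ∀ z ∈ Metric.ball (0:ℂ) R, g z * exp (- l z) = g 0 := by
    have hd : ∀ z ∈ Metric.ball (0:ℂ) R, HasDerivAt (fun z => g z * exp (- l z)) 0 z := by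
      intro z hz
      have h1 := (hg z).hasDerivAt.mul ((hl z hz).neg.cexp)
      refine h1.congr_deriv ?_
      have := h0 z hz
      rw [logDeriv_apply]
      field_simp
      simp
    intro z hz
    have := Metric.isOpen_ball.is_const_of_deriv_eq_zero (convex_ball (0:ℂ) R).isPreconnected
      (fun z hz => (hd z hz).differentiableAt.differentiableWithinAt)
      (fun z hz => (hd z hz).deriv) hz hmem0
    simpa [hl0] using this
  have hre : ∀ z ∈ Metric.ball (0:ℂ) R, (l z).re ≤ M := by
    intro z hz
    have h1 : g z = g 0 * exp (l z) := by
      rw [← hexp z hz, mul_assoc, ← exp_add]; simp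
    have h2 := hb z hz
    rw [h1, norm_mul, norm_exp, mul_comm] at h2
    exact Real.exp_le_exp.mp (le_of_mul_le_mul_right h2 (norm_pos_iff.mpr hg0))
  have hld : DifferentiableOn ℂ l (Metric.ball 0 R) :=
    fun z hz => (hl z hz).differentiableAt.differentiableWithinAt
  have hB : ∀ z : ℂ, ‖z‖ ≤ R / 2 → ‖l z‖ ≤ 2 * M := by
    intro z hz
    have hzR : z ∈ Metric.ball (0:ℂ) R := by rw [mem_ball_zero_iff]; linarith
    have := borelCaratheodory_zero hM hld (fun w hw => hre w hw) hR hzR hl0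
    refine this.trans ?_
    rw [div_le_iff₀ (by linarith)]
    nlinarith
  have hder : ∀ z ∈ Metric.ball (0:ℂ) R, deriv l z = logDeriv g z := fun z hz => (hl z hz).deriv
  have hC1 : ∀ z : ℂ, ‖z‖ ≤ R / 4 → ‖logDeriv g z‖ ≤ 8 * M / R := by
    intro z hz
    rw [← hder z (by rw [mem_ball_zero_iff]; linarith)]
    have hsub : Metric.closedBall z (R/4) ⊆ Metric.ball (0:ℂ) R := by
      intro w hw
      rw [mem_closedBall_iff_norm] at hw
      rw [mem_ball_zero_iff]
      have := norm_add_le (w - z) z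
      rw [sub_add_cancel] at this
      linarith
    have := norm_deriv_le_of_forall_mem_sphere_norm_le (c := z) (R := R/4) (C := 2 * M) (f := l)
      (by linarith) ((hld.mono hsub).diffContOnCl_ball subset_rfl) (by
        intro w hw
        apply hB
        rw [mem_sphere_iff_norm] at hw
        have := norm_add_le (w - z) z
        rw [sub_add_cancel] at this
        linarith)
    refine this.trans (le_of_eq ?_)
    field_simp; ring
  have hC2 : ∀ z : ℂ, ‖z‖ ≤ R / 8 → ‖deriv (logDeriv g) z‖ ≤ 64 * M / R ^ 2 := by
    intro z hz
    have hsub : Metric.closedBall z (R/8) ⊆ Metric.ball (0:ℂ) R := by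
      intro w hw
      rw [mem_closedBall_iff_norm] at hw
      rw [mem_ball_zero_iff]
      have := norm_add_le (w - z) z
      rw [sub_add_cancel] at this
      linarith
    have := norm_deriv_le_of_forall_mem_sphere_norm_le (c := z) (R := R/8) (C := 8 * M / R)
      (f := logDeriv g)
      (by linarith) ((hdl.mono hsub).diffContOnCl_ball subset_rfl) (by
        intro w hw
        apply hC1
        rw [mem_sphere_iff_norm] at hw
        have := norm_add_le (w - z) z
        rw [sub_add_cancel] at this
        linarith)
    refine this.trans (le_of_eq ?_)
    field_simp; ring
  have hfin := (convex_closedBall (0:ℂ) (R/8)).norm_image_sub_le_of_norm_deriv_le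
    (f := logDeriv g) (C := 64 * M / R ^ 2) (x := 0) (y := s)
    (fun z hz => by
      rw [mem_closedBall_zero_iff] at hz
      exact (hdl z (by rw [mem_ball_zero_iff]; linarith)).differentiableAt
        (Metric.isOpen_ball.mem_nhds (by rw [mem_ball_zero_iff]; linarith)))
    (fun z hz => hC2 z (by rwa [mem_closedBall_zero_iff] at hz))
    (by simp; linarith) (by rw [mem_closedBall_zero_iff]; linarith)
  simpa using hfin

/-- the finite set of zeros in a closed ball around the origin -/
noncomputable def Zf (f : ℂ → ℂ) (r : ℝ) : Finset ℂ := by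
  classical
  exact if h : {z | z ∈ Metric.closedBall (0:ℂ) r ∧ f z = 0}.Finite then h.toFinset else ∅

lemma mem_Zf {f : ℂ → ℂ} (hf : Differentiable ℂ f) {x : ℂ} (hx : f x ≠ 0) (r : ℝ) (z : ℂ) :
    z ∈ Zf f r ↔ ‖z‖ ≤ r ∧ f z = 0 := by
  unfold Zf
  rw [dif_pos (zeros_finite hf hx 0 r)]
  simp

theorem hadamard_lite {f : ℂ → ℂ} (hf : Differentiable ℂ f) (h0 : f 0 ≠ 0) {C : ℝ} (hC : 0 ≤ C)
    (hgr : ∀ r : ℝ, 1 ≤ r → ∀ s : ℂ, ‖s‖ ≤ r → ‖f s‖ ≤ Real.exp (C * r ^ (3/2 : ℝ)))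
    {s : ℂ} (hs : f s ≠ 0) :
    Tendsto (fun r : ℝ => ∑ ρ ∈ Zf f r,
      (analyticOrderNatAt f ρ : ℂ) * (1 / (s - ρ) - 1 / (0 - ρ))) atTop
      (𝓝 (logDeriv f s - logDeriv f 0)) := by
  have key : ∀ᶠ r : ℝ in atTop, ‖(∑ ρ ∈ Zf f r,
      (analyticOrderNatAt f ρ : ℂ) * (1 / (s - ρ) - 1 / (0 - ρ)))
      - (logDeriv f s - logDeriv f 0)‖ ≤
        64 * (C * (3 * r) ^ (3/2 : ℝ) + |Real.log ‖f 0‖| + 1) / r ^ 2 * ‖s‖ := by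
    filter_upwards [eventually_gt_atTop (8 * ‖s‖), eventually_ge_atTop 1] with r hr1 hr2
    obtain ⟨g, hg, hgZ, hfg⟩ := fac hf h0 (Zf f r)
    have hrpos : 0 < r := by linarith
    set M := C * (3 * r) ^ (3/2 : ℝ) + |Real.log ‖f 0‖| + 1 with hMdef
    have hM : 0 < M := by positivity
    have hg0 : g 0 ≠ 0 := by
      intro h; apply h0; rw [hfg, h, mul_zero]
    have hgne : ∀ z ∈ Metric.ball (0:ℂ) r, g z ≠ 0 := by
      intro z hz hgz
      have hz0 : f z = 0 := by rw [hfg, hgz, mul_zero]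
      rw [mem_ball_zero_iff] at hz
      exact hgZ z ((mem_Zf hf h0 r z).mpr ⟨hz.le, hz0⟩) hgz
    have hsph : ∀ z ∈ frontier (Metric.ball (0:ℂ) (3 * r)), ‖g z‖ ≤ Real.exp M * ‖g 0‖ := by
      intro z hz
      rw [frontier_ball _ (by positivity), mem_sphere_zero_iff_norm] at hz
      have hfz := hgr (3 * r) (by linarith) z hz.le
      have hP : ‖∏ ρ ∈ Zf f r, (0 - ρ) ^ (analyticOrderNatAt f ρ)‖ ≤
          ‖∏ ρ ∈ Zf f r, (z - ρ) ^ (analyticOrderNatAt f ρ)‖ := by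
        rw [norm_prod, norm_prod]
        refine Finset.prod_le_prod (fun _ _ => norm_nonneg _) ?_
        intro ρ hρ
        rw [mem_Zf hf h0] at hρ
        rw [norm_pow, norm_pow]
        gcongr
        have := norm_sub_norm_le z ρ
        rw [zero_sub, norm_neg]
        linarith [hρ.1]
      have hP0 : 0 < ‖∏ ρ ∈ Zf f r, (0 - ρ) ^ (analyticOrderNatAt f ρ)‖ := by
        rw [norm_pos_iff]
        intro h; apply h0; rw [hfg, h, zero_mul]
      have e1 : ‖f z‖ = ‖∏ ρ ∈ Zf f r, (z - ρ) ^ (analyticOrderNatAt f ρ)‖ * ‖g z‖ := by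
        rw [← norm_mul, ← hfg]
      have e2 : ‖f 0‖ = ‖∏ ρ ∈ Zf f r, (0 - ρ) ^ (analyticOrderNatAt f ρ)‖ * ‖g 0‖ := by
        rw [← norm_mul, ← hfg]
      have hf0 : 0 < ‖f 0‖ := norm_pos_iff.mpr h0
      have hexpM : Real.exp (C * (3 * r) ^ (3/2 : ℝ)) ≤ Real.exp M * ‖f 0‖ := by
        conv_rhs => rw [← Real.exp_log hf0, ← Real.exp_add]
        apply Real.exp_le_exp.mpr
        have := neg_abs_le (Real.log ‖f 0‖)
        rw [hMdef]
        linarith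
      have h3 : ‖∏ ρ ∈ Zf f r, (0 - ρ) ^ (analyticOrderNatAt f ρ)‖ * ‖g z‖ ≤
          ‖∏ ρ ∈ Zf f r, (0 - ρ) ^ (analyticOrderNatAt f ρ)‖ * (Real.exp M * ‖g 0‖) := by
        calc _ ≤ ‖f z‖ := by rw [e1]; gcongr
          _ ≤ Real.exp M * ‖f 0‖ := hfz.trans hexpM
          _ = _ := by rw [e2]; ring
      exact le_of_mul_le_mul_left h3 hP0
    have hin : ∀ z ∈ Metric.ball (0:ℂ) r, ‖g z‖ ≤ Real.exp M * ‖g 0‖ := by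
      intro z hz
      refine norm_le_of_forall_mem_frontier_norm_le Metric.isBounded_ball
        hg.diffContOnCl hsph (subset_closure ?_)
      rw [mem_ball_zero_iff] at hz ⊢
      linarith
    have hvar := logDeriv_var hg hrpos hM hgne hin (s := s) (by linarith)
    have hlog : ∀ z : ℂ, f z ≠ 0 → logDeriv f z =
        (∑ ρ ∈ Zf f r, (analyticOrderNatAt f ρ : ℂ) * (1 / (z - ρ))) + logDeriv g z := by
      intro z hz
      have hfe : f = fun s => (∏ ρ ∈ Zf f r, (s - ρ) ^ (analyticOrderNatAt f ρ)) * g s :=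
        funext hfg
      have hne : ∀ ρ ∈ Zf f r, z - ρ ≠ 0 := by
        intro ρ hρ h
        rw [mem_Zf hf h0] at hρ
        rw [sub_eq_zero] at h
        exact hz (h ▸ hρ.2)
      have hgz : g z ≠ 0 := by
        intro h; apply hz; rw [hfg, h, mul_zero]
      have hpne : ∀ ρ ∈ Zf f r, (z - ρ) ^ (analyticOrderNatAt f ρ) ≠ 0 :=
        fun ρ hρ => pow_ne_zero _ (hne ρ hρ)
      have h1 : logDeriv f z = logDeriv
          (fun s => (∏ ρ ∈ Zf f r, (s - ρ) ^ (analyticOrderNatAt f ρ)) * g s) z := by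
        rw [← hfe]
      rw [h1, logDeriv_mul z (Finset.prod_ne_zero_iff.mpr hpne) hgz (by fun_prop) (hg z)]
      congr 1
      rw [logDeriv_prod hpne (fun ρ _ => by fun_prop)]
      refine Finset.sum_congr rfl fun ρ hρ => ?_
      rw [logDeriv_fun_pow (by fun_prop)]
      congr 1
      simp [logDeriv_apply]
    have heq : (∑ ρ ∈ Zf f r, (analyticOrderNatAt f ρ : ℂ) * (1 / (s - ρ) - 1 / (0 - ρ)))
      - (logDeriv f s - logDeriv f 0) = -(logDeriv g s - logDeriv g 0) := by
      rw [hlog s hs, hlog 0 h0]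
      simp only [mul_sub, Finset.sum_sub_distrib]
      ring
    rw [heq, norm_neg]
    exact hvar
  rw [tendsto_iff_norm_sub_tendsto_zero]
  refine squeeze_zero' (Eventually.of_forall fun _ => norm_nonneg _) key ?_
  have t1 : Tendsto (fun r : ℝ => r ^ (-(1/2:ℝ))) atTop (𝓝 0) := tendsto_rpow_neg_atTop (by norm_num)
  have t2 : Tendsto (fun r : ℝ => r ^ (-(2:ℝ))) atTop (𝓝 0) := tendsto_rpow_neg_atTop (by norm_num)
  have t3 : Tendsto (fun r : ℝ => 64 * (C * 3 ^ (3/2:ℝ) * r ^ (-(1/2:ℝ)) +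
      (|Real.log ‖f 0‖| + 1) * r ^ (-(2:ℝ))) * ‖s‖) atTop (𝓝 0) := by
    have := (((t1.const_mul (C * 3 ^ (3/2:ℝ))).add
      (t2.const_mul (|Real.log ‖f 0‖| + 1))).const_mul 64).mul_const ‖s‖
    simpa using this
  refine t3.congr' ?_
  filter_upwards [eventually_gt_atTop 0] with r hr
  have e1 : r ^ (-(1/2:ℝ)) = r ^ (3/2:ℝ) / r ^ 2 := by
    rw [← Real.rpow_natCast, ← Real.rpow_sub hr]; norm_num
  have e2 : r ^ (-(2:ℝ)) = 1 / r ^ 2 := by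
    rw [← Real.rpow_natCast, Real.rpow_neg hr.le]; norm_num
  rw [e1, e2, Real.mul_rpow (by norm_num) hr.le]
  field_simp
  ring

end ZFR

namespace ZFR
open Complex Set Filter Topology MeasureTheory

lemma xi_eq_zeta {s : ℂ} (h : 0 < s.re) (h1 : s ≠ 1) :
    xi s = s * (s - 1) * (Gammaℝ s * riemannZeta s) := by
  have h0 : s ≠ 0 := by rintro rfl; simp at h
  rw [xi_eq h0 h1, riemannZeta_def_of_ne_zero h0]
  have := Gammaℝ_ne_zero_of_re_pos h
  field_simp

lemma Gammaℝ_conj (s : ℂ) : Gammaℝ (starRingEnd ℂ s) = starRingEnd ℂ (Gammaℝ s) := by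
  rw [Gammaℝ_def, Gammaℝ_def, map_mul, ← Gamma_conj]
  have harg : arg (Real.pi : ℂ) ≠ Real.pi := by
    rw [arg_ofReal_of_nonneg Real.pi_pos.le]; exact Real.pi_pos.ne
  congr 1
  · have := cpow_conj (Real.pi : ℂ) (-s/2) harg
    rw [conj_ofReal] at this
    rw [← this]; simp [map_ofNat]
  · simp [map_ofNat]

lemma xi_conj (s : ℂ) : xi (starRingEnd ℂ s) = starRingEnd ℂ (xi s) := by
  have main : ∀ s : ℂ, 0 < s.re → xi (starRingEnd ℂ s) = starRingEnd ℂ (xi s) := by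
    intro s hs
    by_cases h1 : s = 1
    · subst h1; simp [xi]
    · have h1' : starRingEnd ℂ s ≠ 1 := by
        intro h; apply h1
        have := congrArg (starRingEnd ℂ) h
        simpa using this
      rw [xi_eq_zeta hs h1, xi_eq_zeta (by simpa using hs) h1', Gammaℝ_conj, riemannZeta_conj]
      simp
  by_cases hs : 0 < s.re
  · exact main s hs
  · have h := main (1 - s) (by simp; linarith)
    rw [map_sub, map_one, xi_one_sub, xi_one_sub] at h
    exact h

lemma xi_ne_zero {s : ℂ} (h : 1 ≤ s.re) : xi s ≠ 0 := by
  by_cases h1 : s = 1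
  · subst h1; simp [xi]
  · rw [xi_eq_zeta (by linarith) h1]
    have h0 : s ≠ 0 := by rintro rfl; simp at h; linarith
    refine mul_ne_zero (mul_ne_zero h0 (sub_ne_zero.mpr h1)) (mul_ne_zero ?_ ?_)
    · exact Gammaℝ_ne_zero_of_re_pos (by linarith)
    · exact riemannZeta_ne_zero_of_one_le_re h

lemma xi_zero_lt {ρ : ℂ} (h : xi ρ = 0) : 0 < ρ.re ∧ ρ.re < 1 := by
  constructor
  · by_contra hc
    push Not at hc
    apply xi_ne_zero (s := 1 - ρ) (by simp; linarith)
    rw [xi_one_sub, h]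
  · by_contra hc
    push Not at hc
    exact xi_ne_zero hc h

/-- reflection in the critical line -/
noncomputable def rfl' (ρ : ℂ) : ℂ := 1 - starRingEnd ℂ ρ

lemma rfl'_rfl' (ρ : ℂ) : rfl' (rfl' ρ) = ρ := by simp [rfl']

lemma xi_rfl' (s : ℂ) : xi (rfl' s) = starRingEnd ℂ (xi s) := by
  rw [rfl', xi_one_sub, xi_conj]

/-- multiplicity of a zero of xi -/
noncomputable def mult (ρ : ℂ) : ℕ := analyticOrderNatAt xi ρ

lemma xi_one : xi 1 ≠ 0 := xi_ne_zero (by simp)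

lemma mult_rfl' (ρ : ℂ) : mult (rfl' ρ) = mult ρ := by
  obtain ⟨g, hg, hgρ, hfg⟩ := fac1 xi_differentiable ρ (order_ne_top xi_differentiable xi_one ρ)
  have h1 : analyticOrderAt xi (rfl' ρ) = ((mult ρ : ℕ) : ℕ∞) := by
    rw [(xi_differentiable.analyticAt _).analyticOrderAt_eq_natCast]
    refine ⟨fun s => (-1) ^ (mult ρ) * starRingEnd ℂ (g (starRingEnd ℂ (1 - s))), ?_, ?_, ?_⟩
    · have hd : Differentiable ℂ (fun s => starRingEnd ℂ (g (starRingEnd ℂ s))) := by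
        intro z
        have h := (hg (starRingEnd ℂ z)).hasDerivAt.conj_conj
        simp only [conj_conj] at h
        exact h.differentiableAt
      have hd2 : Differentiable ℂ (fun s => (-1 : ℂ) ^ (mult ρ) *
          starRingEnd ℂ (g (starRingEnd ℂ (1 - s)))) := by
        refine (differentiable_const _).mul (hd.comp (by fun_prop : Differentiable ℂ (fun s : ℂ => 1 - s)))
      exact hd2.analyticAt _
    · simp [rfl', hgρ]
    · refine Eventually.of_forall fun s => ?_
      have h2 : xi s = starRingEnd ℂ (xi (rfl' s)) := by rw [xi_rfl']; simp
      rw [h2, hfg]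
      simp only [map_mul, map_pow, smul_eq_mul]
      rw [← mul_assoc, ← mul_pow]
      congr 2
      · unfold rfl'; simp; ring
      · unfold rfl'; simp
  unfold mult at *
  conv_lhs => rw [analyticOrderNatAt, h1]
  simp

lemma mult_pos {ρ : ℂ} (h : xi ρ = 0) : 1 ≤ mult ρ := by
  by_contra hc
  have h0 : mult ρ = 0 := by omega
  obtain ⟨g, hg, hgρ, hfg⟩ := fac1 xi_differentiable ρ (order_ne_top xi_differentiable xi_one ρ)
  have := hfg ρ
  rw [show analyticOrderNatAt xi ρ = 0 from h0] at this
  simp [h] at this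
  exact hgρ this.symm

lemma exists_line_point : ∃ s0 : ℂ, s0.re = 1/2 ∧ xi s0 ≠ 0 := by
  by_contra hc
  push Not at hc
  have hfin := zeros_finite xi_differentiable xi_one (1/2) 1
  have hinf : ((fun τ : ℝ => (1/2 : ℂ) + τ * I) '' Icc 0 1).Infinite := by
    refine Set.Infinite.image ?_ (Icc_infinite (by norm_num))
    intro a _ b _ hab
    have := congrArg Complex.im hab
    simpa using this
  refine hinf (hfin.subset ?_)
  rintro z ⟨τ, hτ, rfl⟩
  refine ⟨?_, hc _ (by simp)⟩
  rw [mem_closedBall_iff_norm]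
  simp
  rw [abs_of_nonneg hτ.1]; exact hτ.2

theorem xi_sum : ∃ Z : ℕ → Finset ℂ, (∀ n, ∀ ρ ∈ Z n, xi ρ = 0) ∧ (∀ n, ∀ ρ ∈ Z n, rfl' ρ ∈ Z n) ∧
    (∀ ρ, xi ρ = 0 → ∀ᶠ n in atTop, ρ ∈ Z n) ∧
    ∀ s, xi s ≠ 0 → Tendsto (fun n => ∑ ρ ∈ Z n, (mult ρ : ℝ) * (1 / (s - ρ)).re) atTop
      (𝓝 (logDeriv xi s).re) := by
  obtain ⟨s0, hs0, hxs0⟩ := exists_line_point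
  obtain ⟨C, hC, hgr⟩ := xi_growth
  set f : ℂ → ℂ := fun z => xi (s0 + z) with hfdef
  have hf : Differentiable ℂ f := xi_differentiable.comp (by fun_prop)
  have hf0 : f 0 ≠ 0 := by simpa [hfdef] using hxs0
  set a : ℝ := 1 + ‖s0 - 1/2‖ with ha
  have ha1 : 1 ≤ a := by rw [ha]; linarith [norm_nonneg (s0 - 1/2)]
  have hfgr : ∀ r : ℝ, 1 ≤ r → ∀ s : ℂ, ‖s‖ ≤ r →
      ‖f s‖ ≤ Real.exp ((C * a ^ (3/2:ℝ)) * r ^ (3/2 : ℝ)) := by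
    intro r hr s hs
    have h1 := hgr (a * r) (by nlinarith) (s0 + s) (by
      have : s0 + s - 1/2 = (s0 - 1/2) + s := by ring
      rw [this]
      refine (norm_add_le _ _).trans ?_
      rw [ha]
      nlinarith [norm_nonneg (s0 - 1/2)])
    refine h1.trans (le_of_eq ?_)
    rw [Real.mul_rpow (by linarith) (by linarith)]
    ring_nf
  have hord : ∀ z, analyticOrderNatAt f z = mult (s0 + z) := by
    intro z
    unfold mult analyticOrderNatAt
    congr 1
    have hg : AnalyticAt ℂ (fun z : ℂ => s0 + z) z := by fun_prop
    have := analyticOrderAt_comp_of_deriv_ne_zero (f := xi) hg (by simp)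
    exact this
  have hlog : ∀ z, logDeriv f z = logDeriv xi (s0 + z) := by
    intro z
    rw [logDeriv_apply, logDeriv_apply, hfdef, deriv_comp_const_add]
  classical
  let Z : ℕ → Finset ℂ := fun n => (Zf f n).image (fun z => s0 + z)
  have hmem : ∀ n ρ, ρ ∈ Z n ↔ ‖ρ - s0‖ ≤ n ∧ xi ρ = 0 := by
    intro n ρ
    simp only [Z, Finset.mem_image, mem_Zf hf hf0]
    constructor
    · rintro ⟨z, ⟨h1, h2⟩, rfl⟩
      exact ⟨by simpa using h1, h2⟩
    · rintro ⟨h1, h2⟩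
      exact ⟨ρ - s0, ⟨h1, by simpa [hfdef] using h2⟩, by ring⟩
  have hsym : ∀ n, ∀ ρ ∈ Z n, rfl' ρ ∈ Z n := by
    intro n ρ hρ
    rw [hmem] at hρ ⊢
    refine ⟨?_, by rw [xi_rfl', hρ.2, map_zero]⟩
    have e : rfl' ρ - s0 = - starRingEnd ℂ (ρ - s0) := by
      unfold rfl'
      apply Complex.ext <;> simp <;> linarith
    rw [e, norm_neg, norm_conj]; exact hρ.1
  have hsymsum : ∀ n (φ : ℂ → ℝ), ∑ ρ ∈ Z n, φ (rfl' ρ) = ∑ ρ ∈ Z n, φ ρ := by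
    intro n φ
    refine Finset.sum_nbij' rfl' rfl' (hsym n) (hsym n) (fun _ _ => rfl'_rfl' _)
      (fun _ _ => rfl'_rfl' _) (fun _ _ => rfl)
  have hzero : ∀ n, ∑ ρ ∈ Z n, (mult ρ : ℝ) * (1 / (s0 - ρ)).re = 0 := by
    intro n
    have h1 := hsymsum n (fun ρ => (mult ρ : ℝ) * (1 / (s0 - ρ)).re)
    have h2 : ∀ ρ, (mult (rfl' ρ) : ℝ) * (1 / (s0 - rfl' ρ)).re = - ((mult ρ : ℝ) * (1 / (s0 - ρ)).re) := by
      intro ρ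
      rw [mult_rfl']
      have e : s0 - rfl' ρ = - starRingEnd ℂ (s0 - ρ) := by
        unfold rfl'
        apply Complex.ext <;> simp <;> linarith
      rw [e]
      generalize s0 - ρ = w
      simp [inv_re, neg_div]
    simp only [h2, Finset.sum_neg_distrib] at h1
    linarith
  have hS0 : (logDeriv xi s0).re = 0 := by
    have hd : deriv xi s0 = - starRingEnd ℂ (deriv xi s0) := by
      have e : xi = fun s => starRingEnd ℂ (xi (starRingEnd ℂ (1 - s))) := by
        funext s
        rw [xi_conj, conj_conj, xi_one_sub]
      have hcc : ∀ z, HasDerivAt (fun s => starRingEnd ℂ (xi (starRingEnd ℂ s)))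
          (starRingEnd ℂ (deriv xi (starRingEnd ℂ z))) z := by
        intro z
        have h := (xi_differentiable (starRingEnd ℂ z)).hasDerivAt.conj_conj
        simp only [conj_conj] at h
        exact h
      have h1 := (hcc (1 - s0)).comp_const_sub 1 s0
      have h2 : deriv (fun s => starRingEnd ℂ (xi (starRingEnd ℂ (1 - s)))) s0 =
          - starRingEnd ℂ (deriv xi (starRingEnd ℂ (1 - s0))) := h1.deriv
      rw [← e] at h2
      have e3 : starRingEnd ℂ (1 - s0) = s0 := by
        apply Complex.ext <;> simp
        linarith
      rw [e3] at h2
      exact h2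
    have hx : xi s0 = starRingEnd ℂ (xi s0) := by
      rw [← xi_rfl']
      congr 1
      unfold rfl'
      apply Complex.ext <;> simp
      linarith
    rw [logDeriv_apply]
    have h1 : (deriv xi s0).re = 0 := by
      have := congrArg Complex.re hd
      simp at this; linarith
    have h2 : (xi s0).im = 0 := by
      have := congrArg Complex.im hx
      simp at this; linarith
    rw [Complex.div_re, h1, h2]; simp
  refine ⟨Z, fun n ρ h => ((hmem n ρ).mp h).2, hsym, ?_, ?_⟩
  · intro ρ hρ
    obtain ⟨N, hN⟩ := exists_nat_ge ‖ρ - s0‖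
    filter_upwards [eventually_ge_atTop N] with n hn
    rw [hmem]
    exact ⟨hN.trans (by exact_mod_cast hn), hρ⟩
  · intro s hs
    have hfs : f (s - s0) ≠ 0 := by simpa [hfdef] using hs
    have hT := hadamard_lite hf hf0 (by positivity) hfgr hfs
    have hT2 := (Complex.continuous_re.tendsto _).comp (hT.comp tendsto_natCast_atTop_atTop)
    have e : (logDeriv f (s - s0) - logDeriv f 0).re = (logDeriv xi s).re := by
      rw [hlog, hlog]; simp [hS0]
    rw [e] at hT2
    refine hT2.congr ?_
    intro n
    simp only [Function.comp]
    have h1 : ∑ ρ ∈ Z n, (mult ρ : ℝ) * (1 / (s - ρ)).re =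
        ∑ ρ ∈ Z n, (mult ρ : ℝ) * ((1 / (s - ρ)).re - (1 / (s0 - ρ)).re) := by
      simp only [mul_sub, Finset.sum_sub_distrib, hzero, sub_zero]
    rw [h1]
    simp only [Z]
    rw [Finset.sum_image (by intro a _ b _ h; exact add_left_cancel h), Complex.re_sum]
    refine Finset.sum_congr rfl fun z _ => ?_
    rw [hord]
    have e1 : s - s0 - z = s - (s0 + z) := by ring
    have e2 : (0:ℂ) - z = s0 - (s0 + z) := by ring
    rw [e1, e2, ← Complex.ofReal_natCast, Complex.re_ofReal_mul, Complex.sub_re]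

end ZFR

namespace ZFR
open Complex Set Filter Topology MeasureTheory

lemma psi_summand_bound {B : ℝ} (n : ℕ) {z : ℂ} (h1 : 1/2 < z.re) (h2 : ‖z‖ < B) :
    ‖1 / ((n:ℂ) + 1) - 1 / (z + n)‖ ≤ 2 * (B + 1) * (1 / ((n:ℝ) + 1) ^ 2) := by
  have hB : 0 < B := lt_of_le_of_lt (norm_nonneg z) h2
  have hre : ((n:ℝ) + 1) / 2 ≤ ‖z + n‖ := by
    have h := re_le_norm (z + n)
    simp at h
    have : (0:ℝ) ≤ n := n.cast_nonneg
    linarith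
  have hn : (0:ℝ) < n + 1 := by positivity
  have hne : z + n ≠ 0 := by
    intro h; rw [h] at hre; simp at hre; linarith
  have hn1 : (n:ℂ) + 1 ≠ 0 := by exact_mod_cast hn.ne'
  have e : 1 / ((n:ℂ) + 1) - 1 / (z + n) = (z - 1) / ((n + 1) * (z + n)) := by
    field_simp; ring
  have hnn : ‖(n:ℂ) + 1‖ = n + 1 := by
    have : (n:ℂ) + 1 = ((n + 1 : ℝ) : ℂ) := by push_cast; rfl
    rw [this, norm_real, Real.norm_of_nonneg hn.le]
  rw [e, norm_div, norm_mul, hnn, div_le_iff₀ (mul_pos hn (norm_pos_iff.mpr hne))]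
  have h3 : ‖z - 1‖ ≤ B + 1 := by
    refine (norm_sub_le _ _).trans ?_
    simp; linarith
  refine h3.trans ?_
  have : 2 * (B + 1) * (1 / ((n:ℝ) + 1) ^ 2) * ((n + 1) * ‖z + n‖) =
    (B + 1) * (‖z + n‖ / ((n + 1) / 2)) := by field_simp
  rw [this]
  have h4 : 1 ≤ ‖z + n‖ / (((n:ℝ) + 1) / 2) := by rw [one_le_div (by positivity)]; exact hre
  nlinarith

lemma summable_sq : Summable (fun n : ℕ => 1 / ((n:ℝ) + 1) ^ 2) := by
  have := (summable_nat_add_iff 1).mpr (Real.summable_one_div_nat_pow.mpr (by norm_num : 1 < 2))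
  simpa using this

lemma psi_summable {z : ℂ} (h1 : 1/2 < z.re) :
    Summable (fun n : ℕ => 1 / ((n:ℂ) + 1) - 1 / (z + n)) := by
  refine Summable.of_norm_bounded (summable_sq.mul_left (2 * ((‖z‖ + 1) + 1)))
    (fun n => psi_summand_bound n h1 (by linarith))

lemma digamma_series {s : ℂ} (hs : 1/2 < s.re) :
    digamma s = - Real.eulerMascheroniConstant + ∑' n : ℕ, (1 / ((n:ℂ) + 1) - 1 / (s + n)) := by
  set B : ℝ := ‖s‖ + 2 with hB
  set t : Set ℂ := {z | 1/2 < z.re} ∩ Metric.ball 0 B with ht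
  have hto : IsOpen t := (isOpen_lt continuous_const continuous_re).inter Metric.isOpen_ball
  have htc : IsPreconnected t :=
    ((convex_halfSpace_re_gt (1/2)).inter (convex_ball (0:ℂ) B)).isPreconnected
  have hmem : ∀ z ∈ t, 1/2 < z.re ∧ ‖z‖ < B := by
    intro z hz; exact ⟨hz.1, mem_ball_zero_iff.mp hz.2⟩
  have h1t : (1:ℂ) ∈ t := ⟨by norm_num [mem_ofPred_eq], by
    rw [mem_ball_zero_iff]; simp [hB]; linarith [norm_nonneg s]⟩
  have hst : s ∈ t := ⟨hs, by rw [mem_ball_zero_iff]; linarith⟩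
  let g : ℕ → ℂ → ℂ := fun n z => (z - 1) / ((n:ℂ) + 1) - log ((z + n) / (n + 1))
  have hn1 : ∀ n : ℕ, (n:ℂ) + 1 ≠ 0 := fun n => by exact_mod_cast n.succ_ne_zero
  have hzn : ∀ (n : ℕ) (z : ℂ), z ∈ t → z + n ≠ 0 := by
    intro n z hz h
    have := congrArg re h
    simp at this
    have h2 := (hmem z hz).1
    have : (0:ℝ) ≤ n := n.cast_nonneg
    linarith
  have hg : ∀ n z, z ∈ t → HasDerivAt (g n) (1 / ((n:ℂ) + 1) - 1 / (z + n)) z := by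
    intro n z hz
    have hslit : (z + n) / (n + 1) ∈ slitPlane := by
      left
      have : (z + n) / ((n:ℂ) + 1) = (z + n) / ((n + 1 : ℝ) : ℂ) := by push_cast; rfl
      rw [this, div_ofReal_re]
      apply div_pos _ (by positivity)
      simp
      have := (hmem z hz).1
      have : (0:ℝ) ≤ n := n.cast_nonneg
      linarith
    have d1 : HasDerivAt (fun z : ℂ => (z + n) / ((n:ℂ) + 1)) (1 / ((n:ℂ) + 1)) z :=
      ((hasDerivAt_id z).add_const _).div_const _
    have d2 : HasDerivAt (fun z : ℂ => (z - 1) / ((n:ℂ) + 1)) (1 / ((n:ℂ) + 1)) z :=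
      ((hasDerivAt_id z).sub_const _).div_const _
    refine (d2.sub (d1.clog hslit)).congr_deriv ?_
    have := hn1 n
    have := hzn n z hz
    field_simp
  have hg1 : ∀ n, g n 1 = 0 := by
    intro n
    simp only [g]
    have : (1 + (n:ℂ)) / (n + 1) = 1 := by rw [add_comm]; exact div_self (hn1 n)
    rw [this]; simp
  have hbd : ∀ (n : ℕ) (z : ℂ), z ∈ t → ‖1 / ((n:ℂ) + 1) - 1 / (z + n)‖ ≤ 2 * (B + 1) * (1 / ((n:ℝ) + 1) ^ 2) :=
    fun n z hz => psi_summand_bound n (hmem z hz).1 (hmem z hz).2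
  have hsum0 : Summable (fun n => g n 1) := by simp only [hg1]; exact summable_zero
  have hder : ∀ z ∈ t, HasDerivAt (fun z => ∑' n, g n z) (∑' n : ℕ, (1 / ((n:ℂ) + 1) - 1 / (z + n))) z :=
    fun z hz => hasDerivAt_tsum_of_isPreconnected (summable_sq.mul_left (2 * (B + 1))) hto htc hg hbd h1t hsum0 hz
  have hsumm : ∀ z ∈ t, Summable (fun n => g n z) :=
    fun z hz => summable_of_summable_hasDerivAt_of_isPreconnected (summable_sq.mul_left (2 * (B + 1))) hto htc hg hbd h1t hsum0 hz
  have hGamma : ∀ z ∈ t, Gamma z = exp ((∑' n, g n z) - Real.eulerMascheroniConstant * (z - 1)) := by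
    intro z hz
    have hz0 : z ≠ 0 := by have := hzn 0 z hz; simpa using this
    refine tendsto_nhds_unique (GammaSeq_tendsto_Gamma z) ?_
    have t1 : Tendsto (fun N : ℕ => ∑ n ∈ Finset.range (N+1), g n z) atTop (𝓝 (∑' n, g n z)) :=
      ((hsumm z hz).hasSum.tendsto_sum_nat).comp (tendsto_add_atTop_nat 1)
    have t2 : Tendsto (fun N : ℕ => ((((harmonic (N+1) : ℚ) : ℝ) - Real.log (N+1) : ℝ) : ℂ)) atTop
        (𝓝 (Real.eulerMascheroniConstant : ℂ)) := by
      have := (Real.tendsto_harmonic_sub_log).comp (tendsto_add_atTop_nat 1)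
      have h := (continuous_ofReal.tendsto _).comp this
      refine h.congr fun N => ?_
      simp
    have t3 : Tendsto (fun N : ℕ => ((N / (N+1) : ℝ) : ℂ)) atTop (𝓝 1) := by
      have h := (continuous_ofReal.tendsto _).comp (tendsto_natCast_div_add_atTop (1:ℝ))
      simpa [Function.comp_def] using h
    have t4 : Tendsto (fun N : ℕ => ((N / (N+1) : ℝ) : ℂ) ^ z) atTop (𝓝 1) := by
      have h : ContinuousAt (fun w : ℂ => w ^ z) 1 := by
        apply ContinuousAt.cpow continuousAt_id continuousAt_const
        simp
      have := h.tendsto.comp t3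
      simpa [Function.comp_def] using this
    have t5 := ((t1.sub (t2.mul_const (z - 1))).cexp).mul t4
    rw [mul_one] at t5
    refine t5.congr' ?_
    filter_upwards [eventually_gt_atTop 0] with N hN
    have hNpos : (0:ℝ) < N := by exact_mod_cast hN
    have hN1 : (0:ℝ) < (N:ℝ) + 1 := by linarith
    have hN1c : (((N:ℝ) + 1 : ℝ) : ℂ) ≠ 0 := by exact_mod_cast hN1.ne'
    have hsumg : exp (∑ n ∈ Finset.range (N+1), g n z) =
        exp ((z - 1) * ((harmonic (N+1) : ℚ) : ℝ)) * ((N+1).factorial / ∏ j ∈ Finset.range (N+1), (z + j)) := by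
      simp only [g]
      rw [Finset.sum_sub_distrib, exp_sub]
      have e1 : ∑ x ∈ Finset.range (N + 1), (z - 1) / ((x:ℂ) + 1) = (z - 1) * ((harmonic (N+1) : ℚ) : ℝ) := by
        rw [harmonic]
        push_cast
        rw [Finset.mul_sum]
        simp [div_eq_mul_inv]
      have e2 : exp (∑ x ∈ Finset.range (N + 1), log ((z + x) / (x + 1))) =
          (∏ j ∈ Finset.range (N+1), (z + j)) / (N+1).factorial := by
        rw [exp_sum]
        have : ∀ x ∈ Finset.range (N+1), exp (log ((z + x) / (x + 1))) = (z + x) / (x + 1) := by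
          intro x _
          exact exp_log (div_ne_zero (hzn x z hz) (hn1 x))
        rw [Finset.prod_congr rfl this, Finset.prod_div_distrib]
        congr 1
        rw [← Finset.prod_range_add_one_eq_factorial]
        push_cast; rfl
      rw [e1, e2]
      field_simp
    have hpow : ((N / (N+1) : ℝ) : ℂ) ^ z = (N:ℂ) ^ z * exp (- Real.log (N+1) * z) := by
      rw [div_eq_mul_inv, ofReal_mul, mul_cpow_ofReal_nonneg hNpos.le (by positivity)]
      congr 1
      rw [cpow_def_of_ne_zero (by rw [ofReal_inv]; exact inv_ne_zero hN1c)]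
      rw [← ofReal_log (by positivity), Real.log_inv]
      push_cast; rfl
    rw [exp_sub, hsumg, hpow, GammaSeq]
    have hfac : ((N+1).factorial : ℂ) = exp (Real.log (N+1)) * N.factorial := by
      rw [Nat.factorial_succ, ofReal_log hN1.le, exp_log hN1c]; push_cast; rfl
    rw [hfac]
    set P := ∏ j ∈ Finset.range (N+1), (z + j)
    have hP : P ≠ 0 := Finset.prod_ne_zero_iff.mpr fun j _ => hzn j z hz
    set h := ((harmonic (N+1) : ℚ) : ℝ)
    have e3 : exp (((h - Real.log (N+1) : ℝ) : ℂ) * (z - 1)) = exp ((z-1) * h) * exp (- Real.log (N+1) * z) * exp (Real.log (N+1)) := by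
      rw [← exp_add, ← exp_add]; congr 1; push_cast; ring
    rw [e3]
    have := exp_ne_zero ((z-1) * (h:ℂ))
    have := exp_ne_zero (- Real.log (N+1) * z)
    have := exp_ne_zero ((Real.log (N+1) : ℝ) : ℂ)
    field_simp
  have hG : HasDerivAt Gamma (exp ((∑' n, g n s) - Real.eulerMascheroniConstant * (s - 1)) *
      ((∑' n : ℕ, (1 / ((n:ℂ) + 1) - 1 / (s + n))) - Real.eulerMascheroniConstant)) s := by
    have d1 : HasDerivAt (fun z : ℂ => (Real.eulerMascheroniConstant : ℂ) * (z - 1)) (Real.eulerMascheroniConstant : ℂ) s := by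
      have := ((hasDerivAt_id s).sub_const 1).const_mul (Real.eulerMascheroniConstant : ℂ)
      simpa using this
    have := ((hder s hst).sub d1).cexp
    refine this.congr_of_eventuallyEq ?_
    filter_upwards [hto.mem_nhds hst] with z hz using hGamma z hz
  rw [digamma_def, logDeriv_apply, hG.deriv, hGamma s hst]
  rw [mul_div_cancel_left₀ _ (exp_ne_zero _)]
  ring

end ZFR

namespace ZFR
open Complex Set Filter Topology MeasureTheory

lemma artanh_le {x : ℝ} (h0 : 0 ≤ x) (h1 : x < 1) :
    1/2 * (Real.log (1 + x) - Real.log (1 - x)) ≤ x + x ^ 3 / (3 * (1 - x ^ 2)) := by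
  have hs := Real.hasSum_log_sub_log_of_abs_lt_one (x := x) (by rw [abs_of_nonneg h0]; exact h1)
  have hx2 : x ^ 2 < 1 := by nlinarith
  have hg : HasSum (fun k : ℕ => (2/3 * x) * (x ^ 2) ^ k + (if k = 0 then 4/3 * x else 0))
      ((2/3 * x) * (1 - x ^ 2)⁻¹ + 4/3 * x) := by
    refine ((hasSum_geometric_of_lt_one (by positivity) hx2).mul_left _).add ?_
    exact hasSum_ite_eq 0 (4/3 * x)
  have hle := hasSum_le (fun k => ?_) hs hg
  · have e : x + x ^ 3 / (3 * (1 - x ^ 2)) = 1/2 * ((2/3 * x) * (1 - x ^ 2)⁻¹ + 4/3 * x) := by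
      have : 1 - x ^ 2 ≠ 0 := by linarith
      field_simp; ring
    rw [e]; linarith
  · rcases Nat.eq_zero_or_pos k with rfl | hk
    · simp; linarith
    · have hk' : (1:ℝ) ≤ k := by exact_mod_cast hk
      rw [if_neg (by omega), add_zero]
      have e : x ^ (2 * k + 1) = x * (x ^ 2) ^ k := by rw [← pow_mul]; ring
      rw [e]
      have h3 : 1 / (2 * (k:ℝ) + 1) ≤ 1 / 3 := by
        apply one_div_le_one_div_of_le <;> linarith
      have h4 : 0 ≤ x * (x ^ 2) ^ k := by positivity
      nlinarith

lemma log_term {u y : ℝ} (hu : 0 < u) :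
    1/2 * (Real.log ((u + 1/2) ^ 2 + y ^ 2 + 1/4) - Real.log ((u - 1/2) ^ 2 + y ^ 2 + 1/4)) ≤
      u / (u ^ 2 + y ^ 2) := by
  set P := u ^ 2 + y ^ 2 with hP
  have hPpos : 0 < P := by positivity
  have hq : 0 < P + 1/2 := by linarith
  have hlt : u < P + 1/2 := by nlinarith [sq_nonneg (u - 1/2), sq_nonneg y]
  set x := u / (P + 1/2) with hx
  have hx0 : 0 ≤ x := by positivity
  have hx1 : x < 1 := by rw [hx, div_lt_one hq]; exact hlt
  have e1 : (u + 1/2) ^ 2 + y ^ 2 + 1/4 = (P + 1/2) * (1 + x) := by rw [hx, hP]; field_simp; ring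
  have e2 : (u - 1/2) ^ 2 + y ^ 2 + 1/4 = (P + 1/2) * (1 - x) := by rw [hx, hP]; field_simp; ring
  rw [e1, e2, Real.log_mul hq.ne' (by linarith), Real.log_mul hq.ne' (by linarith)]
  have := artanh_le hx0 hx1
  have hux : u = x * (P + 1/2) := by rw [hx]; field_simp
  have hx2 : 0 < 1 - x ^ 2 := by nlinarith
  have key : x ^ 3 / (3 * (1 - x ^ 2)) ≤ x / (2 * P) := by
    rw [div_le_div_iff₀ (by positivity) (by positivity)]
    have h1 : x ^ 2 * (P + 1/2) ^ 2 ≤ P := by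
      have : x ^ 2 * (P + 1/2) ^ 2 = u ^ 2 := by rw [hux]; ring
      rw [this, hP]; nlinarith [sq_nonneg y]
    have h2 : x ^ 2 * P ≤ 1 - x ^ 2 := by
      have h3 : x ^ 2 * (P + 1) * P ≤ P := by nlinarith [sq_nonneg x]
      nlinarith
    nlinarith [mul_nonneg hx0 (sq_nonneg x)]
  have hfin : u / P = x + x / (2 * P) := by
    rw [hux]; field_simp; 
  linarith

lemma digamma_re_le {z : ℂ} (hz : 1/2 < z.re) :
    (digamma z).re ≤ 1/2 * Real.log ((z.re - 1/2) ^ 2 + z.im ^ 2 + 1/4) := by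
  set a := z.re with ha
  set y := z.im with hy
  have hsum := (psi_summable hz).hasSum.tendsto_sum_nat
  have hre := (continuous_re.tendsto _).comp hsum
  have hA : ∀ N : ℕ, (∑ n ∈ Finset.range N, (1 / ((n:ℂ) + 1) - 1 / (z + n))).re ≤
      (harmonic N : ℝ) - 1/2 * (Real.log ((a + N - 1/2) ^ 2 + y ^ 2 + 1/4) - Real.log ((a - 1/2) ^ 2 + y ^ 2 + 1/4)) := by
    intro N
    induction N with
    | zero => simp
    | succ N ih =>
      rw [Finset.sum_range_succ, add_re, harmonic_succ]
      have hN : (0:ℝ) ≤ N := N.cast_nonneg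
      have h1 := log_term (u := a + N) (y := y) (by linarith)
      have e : (1 / ((N:ℂ) + 1) - 1 / (z + N)).re = ((N:ℝ) + 1)⁻¹ - (a + N) / ((a + N) ^ 2 + y ^ 2) := by
        have : ((N:ℂ) + 1) = ((N + 1 : ℝ) : ℂ) := by push_cast; rfl
        rw [sub_re, this, ← ofReal_one, ← ofReal_div, ofReal_re]
        simp [inv_re, normSq_apply]
        rw [← ha, ← hy]; ring
      rw [e]
      have e2 : a + (N + 1 : ℕ) - 1/2 = a + N + 1/2 := by push_cast; ring
      rw [e2]
      push_cast
      linarith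
  have hlim : Tendsto (fun N : ℕ => ((harmonic N : ℝ) - Real.log N) +
      (Real.log N - 1/2 * Real.log ((a + N - 1/2) ^ 2 + y ^ 2 + 1/4)) + 1/2 * Real.log ((a - 1/2) ^ 2 + y ^ 2 + 1/4))
      atTop (𝓝 (Real.eulerMascheroniConstant + 0 + 1/2 * Real.log ((a - 1/2) ^ 2 + y ^ 2 + 1/4))) := by
    refine (Real.tendsto_harmonic_sub_log.add ?_).add_const _
    have t1 : Tendsto (fun N : ℕ => ((N:ℝ))⁻¹) atTop (𝓝 0) := tendsto_inv_atTop_nhds_zero_nat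
    have t2 : Tendsto (fun N : ℕ => -(1/2) * Real.log (((a - 1/2) * (N:ℝ)⁻¹ + 1) ^ 2 + (y ^ 2 + 1/4) * ((N:ℝ)⁻¹) ^ 2)) atTop
        (𝓝 (-(1/2) * Real.log (((a - 1/2) * 0 + 1) ^ 2 + (y ^ 2 + 1/4) * 0 ^ 2))) := by
      refine Tendsto.const_mul _ (Tendsto.log ?_ (by norm_num))
      exact (((t1.const_mul _).add_const 1).pow 2).add ((t1.pow 2).const_mul _)
    have e0 : -(1/2) * Real.log (((a - 1/2) * 0 + 1) ^ 2 + (y ^ 2 + 1/4) * 0 ^ 2) = 0 := by norm_num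
    rw [e0] at t2
    refine t2.congr' ?_
    filter_upwards [eventually_gt_atTop 0] with N hN
    have hNp : (0:ℝ) < N := by exact_mod_cast hN
    have e : (a + N - 1/2) ^ 2 + y ^ 2 + 1/4 = (N:ℝ) ^ 2 * (((a - 1/2) * (N:ℝ)⁻¹ + 1) ^ 2 + (y ^ 2 + 1/4) * ((N:ℝ)⁻¹) ^ 2) := by
      field_simp; ring
    rw [e, Real.log_mul (by positivity) (by positivity), Real.log_pow]
    push_cast; ring
  have hle := le_of_tendsto_of_tendsto hre hlim (Eventually.of_forall fun N => by
    have := hA N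
    simp only [Function.comp]
    linarith)
  rw [digamma_series hz, add_re, neg_re, ofReal_re]
  linarith

/-- the archimedean factor -/
noncomputable def G (s : ℂ) : ℂ := 1/2 * digamma (s / 2 + 1) - 1/2 * (Real.log Real.pi : ℝ)

lemma G_hasSum {s : ℂ} (hs : -1 < s.re) :
    HasSum (fun n : ℕ => 1 / (2 * ((n:ℂ) + 1)) - 1 / (s + 2 * ((n:ℂ) + 1)))
      (G s + (Real.eulerMascheroniConstant + Real.log Real.pi : ℝ) / 2) := by
  have hre : 1/2 < (s / 2 + 1).re := by simp; linarith
  have h := (psi_summable hre).hasSum.mul_left (1/2)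
  have e : G s + (Real.eulerMascheroniConstant + Real.log Real.pi : ℝ) / 2 =
      1/2 * ∑' n : ℕ, (1 / ((n:ℂ) + 1) - 1 / (s / 2 + 1 + n)) := by
    rw [G, digamma_series hre]; push_cast; ring
  rw [e]
  refine h.congr_fun ?_ 
  intro n
  have h1 : (n:ℂ) + 1 ≠ 0 := by exact_mod_cast n.succ_ne_zero
  have h2 : s + 2 * ((n:ℂ) + 1) ≠ 0 := by
    intro h0
    have := congrArg re h0
    simp at this
    have hn : (0:ℝ) ≤ n := n.cast_nonneg
    linarith
  have h3 : s / 2 + 1 + (n:ℂ) = (s + 2 * ((n:ℂ) + 1)) / 2 := by ring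
  rw [h3]
  field_simp

lemma G_re_le {s : ℂ} (hs : -1 < s.re) :
    (G s).re ≤ 1/4 * Real.log (((s.re + 1) / 2) ^ 2 + (s.im / 2) ^ 2 + 1/4) - 1/2 * Real.log Real.pi := by
  have hre : 1/2 < (s / 2 + 1).re := by simp; linarith
  have h := digamma_re_le hre
  have e1 : (s / 2 + 1).re - 1/2 = (s.re + 1) / 2 := by simp; ring
  have e2 : (s / 2 + 1).im = s.im / 2 := by simp
  rw [e1, e2] at h
  have : (G s).re = 1/2 * (digamma (s / 2 + 1)).re - 1/2 * Real.log Real.pi := by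
    rw [G, sub_re]
    have h1 : ((1:ℂ)/2) = ((1/2 : ℝ) : ℂ) := by push_cast; rfl
    rw [h1, re_ofReal_mul, re_ofReal_mul, ofReal_re]
  rw [this]; linarith

lemma zeta_decomp {s : ℂ} (hs : 1 < s.re) :
    - deriv riemannZeta s / riemannZeta s = 1 / (s - 1) + G s - logDeriv xi s := by
  have h0 : s ≠ 0 := by rintro rfl; simp at hs; linarith
  have h1 : s ≠ 1 := by rintro rfl; simp at hs
  have hz : riemannZeta s ≠ 0 := riemannZeta_ne_zero_of_one_le_re hs.le
  have hG : Gammaℝ s ≠ 0 := Gammaℝ_ne_zero_of_re_pos (by linarith)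
  have hGam : Gamma (s / 2) ≠ 0 := Gamma_ne_zero_of_re_pos (by simp; linarith)
  have hnat : ∀ m : ℕ, s / 2 ≠ -m := by
    intro m h
    have := congrArg re h
    simp at this
    have hn : (0:ℝ) ≤ m := m.cast_nonneg
    linarith
  have hdG : DifferentiableAt ℂ (fun z : ℂ => Gamma (z / 2)) s :=
    (differentiableAt_Gamma (s/2) hnat).comp s (by fun_prop)
  have hpi : (Real.pi : ℂ) ≠ 0 := by exact_mod_cast Real.pi_ne_zero
  have hdpi : HasDerivAt (fun z : ℂ => (Real.pi : ℂ) ^ (-z / 2)) ((Real.pi:ℂ) ^ (-s/2) * log Real.pi * (-1/2)) s := by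
    have hd : HasDerivAt (fun z : ℂ => -z / 2) (-1/2) s := (hasDerivAt_id s).neg.div_const 2
    exact hd.const_cpow (Or.inl hpi)
  have hlog : logDeriv xi s = logDeriv (fun z => z * (z - 1) * (((Real.pi : ℂ) ^ (-z / 2) * Gamma (z / 2)) * riemannZeta z)) s := by
    have hev : xi =ᶠ[𝓝 s] (fun z => z * (z - 1) * (((Real.pi : ℂ) ^ (-z / 2) * Gamma (z / 2)) * riemannZeta z)) := by
      filter_upwards [(isOpen_lt continuous_const continuous_re).mem_nhds hs] with z hz
      have hz' : 1 < z.re := hz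
      rw [xi_eq_zeta (by linarith) (by rintro rfl; simp at hz'), Gammaℝ_def]
    rw [logDeriv_apply, logDeriv_apply, hev.deriv_eq, hev.self_of_nhds]
  have hpine : (Real.pi : ℂ) ^ (-s / 2) ≠ 0 := by rw [cpow_ne_zero_iff]; exact Or.inl hpi
  have hdz := differentiableAt_riemannZeta h1
  have hs1 : s - 1 ≠ 0 := sub_ne_zero.mpr h1
  have e1 := logDeriv_mul (f := fun z : ℂ => z * (z - 1))
    (g := fun z : ℂ => ((Real.pi : ℂ) ^ (-z / 2) * Gamma (z / 2)) * riemannZeta z) s (mul_ne_zero h0 hs1)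
    (mul_ne_zero (mul_ne_zero hpine hGam) hz) (by fun_prop) ((hdpi.differentiableAt.mul hdG).mul hdz)
  have e2 := logDeriv_mul (f := fun z : ℂ => z) (g := fun z : ℂ => z - 1) s h0 hs1 (by fun_prop) (by fun_prop)
  have e3 := logDeriv_mul (f := fun z : ℂ => (Real.pi : ℂ) ^ (-z / 2) * Gamma (z / 2)) (g := riemannZeta)
    s (mul_ne_zero hpine hGam) hz (hdpi.differentiableAt.mul hdG) hdz
  have e4 := logDeriv_mul (f := fun z : ℂ => (Real.pi : ℂ) ^ (-z / 2)) (g := fun z : ℂ => Gamma (z / 2))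
    s hpine hGam hdpi.differentiableAt hdG
  rw [hlog, e1, e2, e3, e4]
  have l1 : logDeriv (fun z : ℂ => (Real.pi : ℂ) ^ (-z / 2)) s = - (1/2) * (Real.log Real.pi : ℝ) := by
    rw [logDeriv_apply, hdpi.deriv, ofReal_log Real.pi_pos.le]
    field_simp
  have l2 : logDeriv (fun z : ℂ => Gamma (z / 2)) s = 1/2 * digamma (s / 2) := by
    have := logDeriv_comp (f := Gamma) (g := fun z : ℂ => z / 2) (x := s) (differentiableAt_Gamma (s/2) hnat) (by fun_prop)
    have e : (Gamma ∘ fun z : ℂ => z / 2) = fun z : ℂ => Gamma (z / 2) := rfl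
    rw [e] at this
    rw [this, digamma_def]
    have : deriv (fun z : ℂ => z / 2) s = 1/2 := by simp
    rw [this]; ring
  have l3 : logDeriv (fun z : ℂ => z) s = 1 / s := by simp [logDeriv_apply]
  have l4 : logDeriv (fun z : ℂ => z - 1) s = 1 / (s - 1) := by simp [logDeriv_apply]
  rw [l1, l2, l3, l4, G, digamma_apply_add_one _ hnat, logDeriv_apply]
  field_simp
  ring

end ZFR

namespace ZFR
open Complex Set Filter Topology MeasureTheory

/-- alternating trapezoidal functional, real valued -/
noncomputable def T (N : ℕ) (θ : ℝ) (φ : ℂ → ℝ) (s : ℂ) : ℝ :=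
  1/2 * φ s + 1/2 * ∑ m ∈ Finset.range N, (φ (s + ((2*m*θ : ℝ) : ℂ))
    - 2 * φ (s + (((2*m+1)*θ : ℝ) : ℂ)) + φ (s + (((2*m+2)*θ : ℝ) : ℂ)))

/-- complex version -/
noncomputable def TC (N : ℕ) (θ : ℝ) (f : ℂ → ℂ) (s : ℂ) : ℂ :=
  1/2 * f s + 1/2 * ∑ m ∈ Finset.range N, (f (s + ((2*m*θ : ℝ) : ℂ))
    - 2 * f (s + (((2*m+1)*θ : ℝ) : ℂ)) + f (s + (((2*m+2)*θ : ℝ) : ℂ)))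

lemma TC_re (N : ℕ) (θ : ℝ) (f : ℂ → ℂ) (s : ℂ) :
    (TC N θ f s).re = T N θ (fun z => (f z).re) s := by
  have h1 : (1/2 : ℂ) = ((1/2 : ℝ) : ℂ) := by push_cast; rfl
  have h2 : (2 : ℂ) = ((2 : ℝ) : ℂ) := by push_cast; rfl
  unfold TC T
  rw [h1, h2, add_re, re_ofReal_mul, re_ofReal_mul, re_sum]
  congr 2
  apply Finset.sum_congr rfl
  intro m _
  rw [add_re, sub_re, re_ofReal_mul]

lemma T_add (N : ℕ) (θ : ℝ) (φ : ℂ → ℝ) (s : ℂ) :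
    T N θ φ s + T N θ φ (s + θ) = φ s - 1/2 * (φ (s + ((2*N*θ : ℝ) : ℂ)) - φ (s + (((2*N+1)*θ : ℝ) : ℂ))) := by
  induction N with
  | zero => simp [T]; ring
  | succ N ih =>
    unfold T at ih ⊢
    rw [Finset.sum_range_succ, Finset.sum_range_succ]
    have e1 : s + (θ:ℂ) + ((2*N*θ : ℝ) : ℂ) = s + (((2*N+1)*θ : ℝ) : ℂ) := by push_cast; ring
    have e2 : s + (θ:ℂ) + (((2*N+1)*θ : ℝ) : ℂ) = s + (((2*N+2)*θ : ℝ) : ℂ) := by push_cast; ring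
    have e3 : s + (θ:ℂ) + (((2*N+2)*θ : ℝ) : ℂ) = s + (((2*(N+1:ℕ)+1)*θ : ℝ) : ℂ) := by push_cast; ring
    have e4 : s + ((2*(N+1:ℕ)*θ : ℝ) : ℂ) = s + (((2*N+2)*θ : ℝ) : ℂ) := by push_cast; ring
    rw [e1, e2, e3, e4]
    linarith

lemma T_sub_half (N : ℕ) (θ : ℝ) (φ : ℂ → ℝ) (s : ℂ) :
    T N θ φ s - 1/2 * φ s = 1/2 * ∑ m ∈ Finset.range N, (φ (s + ((2*m*θ : ℝ) : ℂ))
    - 2 * φ (s + (((2*m+1)*θ : ℝ) : ℂ)) + φ (s + (((2*m+2)*θ : ℝ) : ℂ))) := by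
  unfold T; ring

lemma T_lin {N : ℕ} {θ : ℝ} (φ ψ : ℂ → ℝ) (s : ℂ) (a b : ℝ) :
    T N θ (fun z => a * φ z + b * ψ z) s = a * T N θ φ s + b * T N θ ψ s := by
  have : ∀ m : ℕ, (a * φ (s + ((2*m*θ : ℝ) : ℂ)) + b * ψ (s + ((2*m*θ : ℝ) : ℂ))
    - 2 * (a * φ (s + (((2*m+1)*θ : ℝ) : ℂ)) + b * ψ (s + (((2*m+1)*θ : ℝ) : ℂ)))
    + (a * φ (s + (((2*m+2)*θ : ℝ) : ℂ)) + b * ψ (s + (((2*m+2)*θ : ℝ) : ℂ))))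
    = a * (φ (s + ((2*m*θ : ℝ) : ℂ))
    - 2 * φ (s + (((2*m+1)*θ : ℝ) : ℂ)) + φ (s + (((2*m+2)*θ : ℝ) : ℂ))) + 
    b * (ψ (s + ((2*m*θ : ℝ) : ℂ))
    - 2 * ψ (s + (((2*m+1)*θ : ℝ) : ℂ)) + ψ (s + (((2*m+2)*θ : ℝ) : ℂ))) := by
    intro m; ring
  simp only [T, this, Finset.sum_add_distrib, ← Finset.mul_sum]
  ring

lemma T_const {N : ℕ} {θ : ℝ} (s : ℂ) (a : ℝ) : T N θ (fun _ => a) s = 1/2 * a := by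
  have : a - 2 * a + a = 0 := by ring
  simp [T, this]

/-- T only looks to the right -/
lemma T_congr {N : ℕ} {θ : ℝ} (hθ : 0 ≤ θ) {φ ψ : ℂ → ℝ} {s : ℂ}
    (h : ∀ x : ℝ, 0 ≤ x → φ (s + x) = ψ (s + x)) : T N θ φ s = T N θ ψ s := by
  unfold T
  have h0 := h 0 le_rfl
  simp only [ofReal_zero, add_zero] at h0
  rw [h0]
  congr 2
  apply Finset.sum_congr rfl
  intro m _
  rw [h _ (by positivity), h _ (by positivity), h _ (by positivity)]

lemma T_hasSum {N : ℕ} {θ : ℝ} (hθ : 0 ≤ θ) {ι : Type*} {F : ι → ℂ → ℝ} {φ : ℂ → ℝ} {s : ℂ}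
    (h : ∀ x : ℝ, 0 ≤ x → HasSum (fun i => F i (s + x)) (φ (s + x))) :
    HasSum (fun i => T N θ (F i) s) (T N θ φ s) := by
  unfold T
  have h0 := h 0 le_rfl
  simp only [ofReal_zero, add_zero] at h0
  refine (h0.mul_left _).add (HasSum.mul_left _ (hasSum_sum ?_))
  intro m _
  exact ((h _ (by positivity)).sub ((h _ (by positivity)).mul_left _)).add (h _ (by positivity))

lemma T_tendsto {N : ℕ} {θ : ℝ} (hθ : 0 ≤ θ) {F : ℕ → ℂ → ℝ} {φ : ℂ → ℝ} {s : ℂ}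
    (h : ∀ x : ℝ, 0 ≤ x → Tendsto (fun i => F i (s + x)) atTop (𝓝 (φ (s + x)))) :
    Tendsto (fun i => T N θ (F i) s) atTop (𝓝 (T N θ φ s)) := by
  unfold T
  have h0 := h 0 le_rfl
  simp only [ofReal_zero, add_zero] at h0
  refine (h0.const_mul _).add (Tendsto.const_mul _ (tendsto_finsetSum _ ?_))
  intro m _
  exact ((h _ (by positivity)).sub ((h _ (by positivity)).const_mul _)).add (h _ (by positivity))

lemma norm_ge_l1 (v : ℂ) : 0.7071 * (|v.re| + |v.im|) ≤ ‖v‖ := by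
  have h : ‖v‖^2 = v.re^2 + v.im^2 := by rw [← normSq_eq_norm_sq, normSq_apply]; ring
  apply le_of_sq_le_sq _ (norm_nonneg v)
  rw [h, ← sq_abs v.re, ← sq_abs v.im]
  nlinarith [sq_nonneg (|v.re| - |v.im|), abs_nonneg v.re, abs_nonneg v.im, sq_nonneg (|v.re|), sq_nonneg (|v.im|)]

/-- second difference bound -/
lemma d2_bound {θ : ℝ} (hθ : 0 < θ) {v : ℂ} {b : ℝ} (hb : 0 < b) (hx : 0 ≤ v.re) (hbv : b ≤ v.re + |v.im|) :
    |(1/v).re - 2 * (1/(v+θ)).re + (1/(v+2*θ)).re| ≤ 2 * 0.708 * θ * (1/b^2 - 1/(b+2*θ)^2) := by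
  have l0 : 0.7071 * b ≤ ‖v‖ := by
    refine le_trans ?_ (norm_ge_l1 v)
    rw [abs_of_nonneg hx]; nlinarith
  have l1 : 0.7071 * (b+θ) ≤ ‖v+θ‖ := by
    refine le_trans ?_ (norm_ge_l1 _)
    simp only [add_re, ofReal_re, add_im, ofReal_im, add_zero]
    rw [abs_of_nonneg (by linarith)]; nlinarith
  have l2 : 0.7071 * (b+2*θ) ≤ ‖v+2*θ‖ := by
    refine le_trans ?_ (norm_ge_l1 _)
    simp only [add_re, mul_re, ofReal_re, add_im, mul_im, ofReal_im, re_ofNat, im_ofNat]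
    rw [abs_of_nonneg (by nlinarith)]; simp; nlinarith
  have p0 : 0 < ‖v‖ := lt_of_lt_of_le (by positivity) l0
  have p1 : 0 < ‖v+θ‖ := lt_of_lt_of_le (by positivity) l1
  have p2 : 0 < ‖v+2*θ‖ := lt_of_lt_of_le (by positivity) l2
  have n0 : v ≠ 0 := norm_pos_iff.mp p0
  have n1 : v+θ ≠ 0 := norm_pos_iff.mp p1
  have n2 : v+2*θ ≠ 0 := norm_pos_iff.mp p2
  have key : (1/v).re - 2 * (1/(v+θ)).re + (1/(v+2*θ)).re = (2*θ^2/(v*(v+θ)*(v+2*θ))).re := by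
    have : (2*θ^2/(v*(v+θ)*(v+2*θ)) : ℂ) = 1/v - ((2:ℝ):ℂ) * (1/(v+θ)) + 1/(v+2*θ) := by
      field_simp; push_cast; ring
    rw [this, add_re, sub_re, re_ofReal_mul]
  rw [key]
  refine (abs_re_le_norm _).trans ?_
  rw [norm_div, norm_mul, norm_mul, norm_mul, norm_pow, norm_real, Real.norm_eq_abs, sq_abs]
  simp only [norm_ofNat]
  have hp : 0.7071 ^ 3 * (b * (b+θ) * (b+2*θ)) ≤ ‖v‖ * ‖v+θ‖ * ‖v+2*θ‖ := by
    calc _ = (0.7071*b) * (0.7071*(b+θ)) * (0.7071*(b+2*θ)) := by ring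
      _ ≤ _ := by gcongr
  have hb' : 0 < b * (b+θ) * (b+2*θ) := by positivity
  calc 2*θ^2/(‖v‖ * ‖v+θ‖ * ‖v+2*θ‖) ≤ 2*θ^2/(0.7071 ^ 3 * (b * (b+θ) * (b+2*θ))) := by gcongr
    _ ≤ 4 * 0.708 * 2 * θ^2/(b * (b+θ) * (b+2*θ)) := by
      rw [div_le_div_iff₀ (by positivity) hb']
      have : 0 ≤ θ^2 * (b * (b+θ) * (b+2*θ)) := by positivity
      norm_num
      nlinarith
    _ ≤ _ := by
      have : 2 * 0.708 * θ * (1/b^2 - 1/(b+2*θ)^2) = 2 * 0.708 * 4 * θ^2 * (b+θ) / (b^2 * (b+2*θ)^2) := by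
        field_simp; ring
      rw [this, div_le_div_iff₀ (by positivity) (by positivity)]
      have : 0 ≤ θ^2 * (b * (b+2*θ)) * ((b+θ)^2 - b*(b+2*θ)) := by
        have : (b+θ)^2 - b*(b+2*θ) = θ^2 := by ring
        rw [this]; positivity
      nlinarith

/-- real part of inverse -/
noncomputable def ri (z : ℂ) : ℝ := (1/z).re

lemma ri_eq (z : ℂ) : ri z = z.re / (z.re^2 + z.im^2) := by
  rw [ri, one_div, inv_re, normSq_apply]; congr 1; ring

lemma ri_ofReal (x : ℝ) : ri x = 1 / x := by
  rw [ri, ← ofReal_one, ← ofReal_div, ofReal_re]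

lemma ri_nonneg {z : ℂ} (h : 0 ≤ z.re) : 0 ≤ ri z := by rw [ri_eq]; positivity

lemma ri_le {z : ℂ} (h : 0 ≤ z.re) (hi : z.im ≠ 0) : ri z ≤ z.re / z.im^2 := by
  rw [ri_eq]
  have : 0 < z.im^2 := by positivity
  gcongr
  nlinarith [sq_nonneg z.re]

lemma ri_conj (z : ℂ) : ri (starRingEnd ℂ z) = ri z := by simp [ri_eq]

lemma T_ri_bound (N : ℕ) {θ : ℝ} (hθ : 0 < θ) {v : ℂ} {b : ℝ} (hb : 0 < b) (hx : 0 ≤ v.re) (hbv : b ≤ v.re + |v.im|) :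
    |T N θ ri v - 1/2 * ri v| ≤ 0.708 * θ / b^2 := by
  rw [T_sub_half, abs_mul]
  have hs : |∑ m ∈ Finset.range N, (ri (v + ((2*m*θ : ℝ) : ℂ))
    - 2 * ri (v + (((2*m+1)*θ : ℝ) : ℂ)) + ri (v + (((2*m+2)*θ : ℝ) : ℂ)))| ≤
      2 * 0.708 * θ * (1/b^2 - 1/(b+2*N*θ)^2) := by
    induction N with
    | zero => simp
    | succ N ih =>
      rw [Finset.sum_range_succ]
      refine (abs_add_le _ _).trans ?_
      have := d2_bound hθ (v := v + ((2*N*θ:ℝ):ℂ)) (b := b + 2*N*θ) (by positivity)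
        (by rw [add_re, ofReal_re]; positivity)
        (by rw [add_re, add_im, ofReal_re, ofReal_im, add_zero]; linarith)
      have e1 : v + (((2*N+1)*θ : ℝ) : ℂ) = v + ((2*N*θ:ℝ):ℂ) + θ := by push_cast; ring
      have e2 : v + (((2*N+2)*θ : ℝ) : ℂ) = v + ((2*N*θ:ℝ):ℂ) + 2*θ := by push_cast; ring
      have e3 : b + 2*((N+1:ℕ):ℝ)*θ = b + 2*N*θ+2*θ := by push_cast; ring
      rw [e1, e2, e3]
      unfold ri at ih ⊢
      linarith
  have : 0 ≤ 1/(b+2*N*θ)^2 := by positivity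
  rw [abs_of_pos (by norm_num : (0:ℝ) < 1/2)]
  have h2 : 0.708 * θ / b^2 = 0.708 * θ * (1/b^2) := by ring
  rw [h2]
  nlinarith
end ZFR

namespace ZFR
open Complex Set Filter Topology MeasureTheory

lemma lap {ι : Type*} [Fintype ι] (w d : ι → ℝ) (hd : ∀ i, 0 < d i)
    (h : ∀ u : ℝ, 0 < u → 0 ≤ ∑ i, w i * Real.exp (-d i * u)) : 0 ≤ ∑ i, w i / d i := by
  have hI : ∀ i, IntegrableOn (fun u : ℝ => Real.exp (-d i * u)) (Ioi 0) := by
    intro i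
    exact integrableOn_exp_mul_Ioi (by linarith [hd i]) 0
  have e : ∑ i, w i / d i = ∫ u in Ioi (0:ℝ), ∑ i, w i * Real.exp (-d i * u) := by
    rw [integral_finsetSum _ (fun i _ => (hI i).const_mul _)]
    apply Finset.sum_congr rfl
    intro i _
    rw [integral_const_mul, integral_exp_mul_Ioi (by linarith [hd i])]
    simp [div_eq_mul_inv]
  rw [e]
  exact setIntegral_nonneg measurableSet_Ioi (fun u hu => h u hu)

lemma T_shift (N : ℕ) (θ : ℝ) (φ : ℂ → ℝ) (s d : ℂ) : T N θ φ (s + d) = T N θ (fun z => φ (z + d)) s := by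
  have hsh : ∀ (x : ℂ), s + d + x = s + x + d := by
    intro x; ring
  unfold T
  simp only [hsh]

lemma T_sum {ι : Type*} (A : Finset ι) (N : ℕ) (θ : ℝ) (c : ι → ℝ) (φ : ι → ℂ → ℝ) (s : ℂ) :
    T N θ (fun z => ∑ j ∈ A, c j * φ j z) s = ∑ j ∈ A, c j * T N θ (φ j) s := by
  classical
  induction A using Finset.induction_on with
  | empty => simpa using T_const (N := N) (θ := θ) s 0
  | insert a A ha ih =>
    simp only [Finset.sum_insert ha]
    rw [← ih]
    have := T_lin (N := N) (θ := θ) (φ a) (fun z => ∑ j ∈ A, c j * φ j z) s (c a) 1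
    simpa using this

/-- A smoothing kernel (sum of exponentials). -/
structure Ker (n : ℕ) where
  c : Fin n → ℝ
  lam : Fin n → ℝ
  ω : ℝ
  S : ℝ
  hω : 0 ≤ ω
  hlam : ∀ j, ω < lam j
  hΛ : ∀ j, lam j ≤ 19
  hS : ∑ j, |c j| ≤ S
  hc : ∑ j, c j = 1
  hh : ∀ u : ℝ, 0 ≤ u → 0 ≤ ∑ j, c j * Real.exp (-lam j * u)
  hb : ∀ y : ℝ, 0 ≤ ∑ j, c j * (lam j / (lam j ^ 2 + y^2))
  hμ : ∀ x : ℝ, 0 ≤ x → 1 / (x + 3) ≤ ∑ j, c j / (x + lam j)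

namespace Ker
variable {n : ℕ} (K : Ker n)

lemma lam_pos (j : Fin n) : 0 < K.lam j := K.hω.trans_lt (K.hlam j)

noncomputable def H (η : ℝ) (z : ℂ) : ℝ := ∑ j, K.c j * ri (z + ((K.lam j * η : ℝ) : ℂ))

lemma H_ofReal (η x : ℝ) : K.H η x = ∑ j, K.c j / (x + K.lam j * η) := by
  unfold H
  apply Finset.sum_congr rfl
  intro j _
  rw [← ofReal_add, ri_ofReal]; ring

lemma lapH {η : ℝ} (hη : 0 < η) {m : ℕ} (v e : Fin m → ℝ) {x : ℝ} (hx : - K.ω * η ≤ x) (he : ∀ i, 0 ≤ e i)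
    (hv : ∀ u : ℝ, 0 < u → 0 ≤ ∑ i, v i * Real.exp (-e i * u)) :
    0 ≤ ∑ i, v i * K.H η ((x + e i : ℝ) : ℂ) := by
  have := lap (ι := Fin n × Fin m) (fun p => K.c p.1 * v p.2) (fun p => x + e p.2 + K.lam p.1 * η) ?_ ?_
  · rw [Fintype.sum_prod_type_right] at this
    convert this using 2 with i
    rw [H_ofReal, Finset.mul_sum]
    apply Finset.sum_congr rfl
    intro j _
    ring
  · rintro ⟨j, i⟩
    have h1 := K.hlam j
    have h2 := he i
    show 0 < x + e i + K.lam j * η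
    nlinarith
  · intro u hu
    have h1 := K.hh (η * u) (by positivity)
    have h2 := hv u hu
    have : ∑ p : Fin n × Fin m, K.c p.1 * v p.2 * Real.exp (-(x + e p.2 + K.lam p.1 * η) * u)
      = Real.exp (-x * u) * ((∑ j, K.c j * Real.exp (-K.lam j * (η * u))) * ∑ i, v i * Real.exp (-e i * u)) := by
      rw [Finset.sum_mul_sum, Fintype.sum_prod_type, Finset.mul_sum]
      apply Finset.sum_congr rfl
      intro j _
      rw [Finset.mul_sum]
      apply Finset.sum_congr rfl
      intro i _
      have : -(x + e i + K.lam j * η) * u = -x * u + (-K.lam j * (η * u) + -e i * u) := by ring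
      rw [this, Real.exp_add, Real.exp_add]; ring
    rw [this]
    positivity

lemma H_nonneg {η : ℝ} (hη : 0 < η) {x : ℝ} (hx : - K.ω * η ≤ x) : 0 ≤ K.H η x := by
  have := K.lapH hη ![1] ![0] hx (by simp) (by intro u hu; simp)
  simpa using this

lemma H_anti {η : ℝ} (hη : 0 < η) {x y : ℝ} (hx : - K.ω * η ≤ x) (hxy : x ≤ y) : K.H η y ≤ K.H η x := by
  have := K.lapH hη ![1, -1] ![0, y - x] hx (by intro i; fin_cases i <;> simp [hxy]) (by
    intro u hu
    have : Real.exp ((x - y) * u) ≤ 1 := Real.exp_le_one_iff.mpr (by nlinarith)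
    simp only [Fin.sum_univ_succ, Fin.sum_univ_zero, Matrix.cons_val_zero, Matrix.cons_val_succ]
    rw [neg_sub, neg_zero, zero_mul, Real.exp_zero]
    linarith)
  simp only [Fin.sum_univ_succ, Fin.sum_univ_zero, Matrix.cons_val_zero, Matrix.cons_val_succ] at this
  have e : x + (y - x) = y := by ring
  rw [e, add_zero] at this
  linarith

lemma D2_nonneg {η θ : ℝ} (hη : 0 < η) (hθ : 0 ≤ θ) {x : ℝ} (hx : - K.ω * η ≤ x) :
    0 ≤ K.H η x - 2 * K.H η ((x + θ : ℝ) : ℂ) + K.H η ((x + 2 * θ : ℝ) : ℂ) := by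
  have := K.lapH hη ![1, -2, 1] ![0, θ, 2 * θ] hx (by intro i; fin_cases i <;> simp [hθ]) (by
    intro u hu
    simp only [Fin.sum_univ_succ, Fin.sum_univ_zero, Matrix.cons_val_zero, Matrix.cons_val_succ]
    have : -(2 * θ) * u = -θ * u + -θ * u := by ring
    rw [this, Real.exp_add, neg_zero, zero_mul, Real.exp_zero]
    nlinarith [sq_nonneg (Real.exp (-θ * u) - 1)])
  simp only [Fin.sum_univ_succ, Fin.sum_univ_zero, Matrix.cons_val_zero, Matrix.cons_val_succ] at this
  rw [add_zero] at this
  linarith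

lemma D2_anti {η θ : ℝ} (hη : 0 < η) (hθ : 0 ≤ θ) {x y : ℝ} (hx : - K.ω * η ≤ x) (hxy : x ≤ y) :
    K.H η y - 2 * K.H η ((y + θ : ℝ) : ℂ) + K.H η ((y + 2 * θ : ℝ) : ℂ)
    ≤ K.H η x - 2 * K.H η ((x + θ : ℝ) : ℂ) + K.H η ((x + 2 * θ : ℝ) : ℂ) := by
  have := K.lapH hη ![1, -2, 1, -1, 2, -1] ![0, θ, 2 * θ, y - x, y - x + θ, y - x + 2 * θ] hx
    (by intro i; fin_cases i <;> simp [hθ, hxy] <;> linarith) (by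
    intro u hu
    simp only [Fin.sum_univ_succ, Fin.sum_univ_zero, Matrix.cons_val_zero, Matrix.cons_val_succ]
    have e1 : -(2 * θ) * u = -θ * u + -θ * u := by ring
    have e2 : -(y - x + θ) * u = -(y - x) * u + -θ * u := by ring
    have e3 : -(y - x + 2 * θ) * u = -(y - x) * u + (-θ * u + -θ * u) := by ring
    have hle : Real.exp (-(y - x) * u) ≤ 1 := Real.exp_le_one_iff.mpr (by nlinarith)
    rw [e1, e2, e3, Real.exp_add, Real.exp_add, Real.exp_add, Real.exp_add, neg_zero, zero_mul, Real.exp_zero]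
    have := mul_nonneg (sub_nonneg.mpr hle) (sq_nonneg (Real.exp (-θ * u) - 1))
    nlinarith)
  simp only [Fin.sum_univ_succ, Fin.sum_univ_zero, Matrix.cons_val_zero, Matrix.cons_val_succ] at this
  have e : x + (y - x) = y := by ring
  have e1 : x + (y - x + θ) = y + θ := by ring
  have e2 : x + (y - x + 2 * θ) = y + 2 * θ := by ring
  rw [e, e1, e2, add_zero] at this
  linarith

lemma T_H (η : ℝ) (N : ℕ) (θ : ℝ) (s : ℂ) :
    ∑ j, K.c j * T N θ ri (s + ((K.lam j * η : ℝ) : ℂ)) = T N θ (K.H η) s := by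
  unfold H
  rw [T_sum]
  apply Finset.sum_congr rfl
  intro j _
  rw [T_shift]

lemma TH_ge_half {η θ : ℝ} (N : ℕ) (hη : 0 < η) (hθ : 0 ≤ θ) {x : ℝ} (hx : - K.ω * η ≤ x) :
    1/2 * K.H η x ≤ T N θ (K.H η) x := by
  have := T_sub_half N θ (K.H η) x
  have h2 : 0 ≤ ∑ m ∈ Finset.range N, (K.H η (x + ((2*m*θ : ℝ) : ℂ))
    - 2 * K.H η (x + (((2*m+1)*θ : ℝ) : ℂ)) + K.H η (x + (((2*m+2)*θ : ℝ) : ℂ))) := by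
    apply Finset.sum_nonneg
    intro m _
    have h0 : 0 ≤ 2 * m * θ := by positivity
    have := K.D2_nonneg hη hθ (x := x + 2*m*θ) (by linarith)
    simp only [← ofReal_add]
    have e1 : ∀ v : ℝ, v + 2*m*θ + θ = v + (2*m+1)*θ := by intro v; ring
    have e2 : ∀ v : ℝ, v + 2*m*θ + 2*θ = v + (2*m+2)*θ := by intro v; ring
    rw [e1, e2] at this
    exact this
  linarith

lemma TH_anti {η θ : ℝ} (N : ℕ) (hη : 0 < η) (hθ : 0 ≤ θ) {x y : ℝ} (hx : - K.ω * η ≤ x) (hxy : x ≤ y) :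
    T N θ (K.H η) y ≤ T N θ (K.H η) x := by
  have h1 := K.H_anti hη hx hxy
  unfold T
  have h2 : ∑ m ∈ Finset.range N, (K.H η (y + ((2*m*θ : ℝ) : ℂ))
    - 2 * K.H η (y + (((2*m+1)*θ : ℝ) : ℂ)) + K.H η (y + (((2*m+2)*θ : ℝ) : ℂ))) ≤
    ∑ m ∈ Finset.range N, (K.H η (x + ((2*m*θ : ℝ) : ℂ))
    - 2 * K.H η (x + (((2*m+1)*θ : ℝ) : ℂ)) + K.H η (x + (((2*m+2)*θ : ℝ) : ℂ))) := by
    apply Finset.sum_le_sum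
    intro m _
    have h0 : 0 ≤ 2 * m * θ := by positivity
    have := K.D2_anti hη hθ (x := x + 2*m*θ) (y := y + 2*m*θ) (by linarith) (by linarith)
    simp only [← ofReal_add]
    have e1 : ∀ v : ℝ, v + 2*m*θ + θ = v + (2*m+1)*θ := by intro v; ring
    have e2 : ∀ v : ℝ, v + 2*m*θ + 2*θ = v + (2*m+2)*θ := by intro v; ring
    rw [e1, e2, e1, e2] at this
    exact this
  linarith

lemma TH_le {η θ : ℝ} (N : ℕ) (hη : 0 < η) (hθ : 0 ≤ θ) {x : ℝ} (hx : - K.ω * η ≤ x) :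
    T N θ (K.H η) x ≤ K.H η x - 1/2 * K.H η ((x + θ : ℝ) : ℂ) := by
  have h1 := T_add N θ (K.H η) x
  have h2 := K.TH_ge_half N hη hθ (x := x + θ) (by linarith)
  have h0 : 0 ≤ 2 * N * θ := by positivity
  have h3 := K.H_anti hη (x := x + 2*N*θ) (y := x + (2*N+1)*θ) (by linarith) (by linarith)
  push_cast at h1 h2 h3 ⊢
  linarith

lemma H_mu {η : ℝ} (hη : 0 < η) {x : ℝ} (hx : 0 ≤ x) : 1 / (x + 3 * η) ≤ K.H η x := by
  have := K.hμ (x / η) (by positivity)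
  rw [H_ofReal]
  have e : ∑ j, K.c j / (x + K.lam j * η) = (1/η) * ∑ j, K.c j / (x / η + K.lam j) := by
    rw [Finset.mul_sum]
    apply Finset.sum_congr rfl
    intro j _
    have := K.lam_pos j
    have : x / η + K.lam j ≠ 0 := by positivity
    have : x + K.lam j * η ≠ 0 := by positivity
    field_simp
  rw [e]
  calc 1 / (x + 3 * η) = (1/η) * (1 / (x / η + 3)) := by field_simp
    _ ≤ _ := by gcongr

end Ker
end ZFR

namespace ZFR
open Complex Set Filter Topology MeasureTheory

lemma TC_bound {N : ℕ} {θ : ℝ} (hθ : 0 ≤ θ) {f : ℂ → ℂ} {s : ℂ} {B : ℝ}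
    (h : ∀ x : ℝ, 0 ≤ x → ‖f (s + x)‖ ≤ B) : ‖TC N θ f s‖ ≤ (1 + 4 * N) * B := by
  have h0 := h 0 le_rfl
  have hB : 0 ≤ B := (norm_nonneg _).trans h0
  simp only [ofReal_zero, add_zero] at h0
  unfold TC
  refine (norm_add_le _ _).trans ?_
  rw [norm_mul, norm_mul]
  have hh : ‖(1/2 : ℂ)‖ = 1/2 := by norm_num
  rw [hh]
  have hs : ‖∑ m ∈ Finset.range N, (f (s + ((2*m*θ : ℝ) : ℂ))
    - 2 * f (s + (((2*m+1)*θ : ℝ) : ℂ)) + f (s + (((2*m+2)*θ : ℝ) : ℂ)))‖ ≤ ∑ m ∈ Finset.range N, 4 * B := by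
    refine norm_sum_le_of_le _ ?_
    intro m _
    refine (norm_add_le _ _).trans ?_
    have h1 := norm_sub_le (f (s + ((2*m*θ : ℝ) : ℂ))) (2 * f (s + (((2*m+1)*θ : ℝ) : ℂ)))
    rw [norm_mul] at h1
    have a1 := h (2*m*θ) (by positivity)
    have a2 := h ((2*m+1)*θ) (by positivity)
    have a3 := h ((2*m+2)*θ) (by positivity)
    simp only [norm_ofNat] at h1
    linarith
  rw [Finset.sum_const, Finset.card_range, nsmul_eq_mul] at hs
  nlinarith [mul_nonneg (Nat.cast_nonneg (α := ℝ) N) hB]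

lemma TC_differentiableAt {N : ℕ} {θ : ℝ} (hθ : 0 ≤ θ) {f : ℂ → ℂ} {s : ℂ}
    (h : ∀ x : ℝ, 0 ≤ x → DifferentiableAt ℂ f (s + x)) : DifferentiableAt ℂ (TC N θ f) s := by
  have h' : ∀ x : ℝ, 0 ≤ x → DifferentiableAt ℂ (fun z => f (z + x)) s := by
    intro x hx
    exact (h x hx).comp s (f := fun z : ℂ => z + (x:ℂ)) (by fun_prop)
  have h0 := h 0 le_rfl
  simp only [ofReal_zero, add_zero] at h0
  unfold TC
  refine (h0.const_mul _).add (DifferentiableAt.const_mul (DifferentiableAt.fun_sum ?_) _)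
  intro m _
  exact ((h' _ (by positivity)).sub ((h' _ (by positivity)).const_mul _)).add (h' _ (by positivity))

lemma T_ri_conj (N : ℕ) (θ : ℝ) (s : ℂ) : T N θ ri (starRingEnd ℂ s) = T N θ ri s := by
  have : ∀ x : ℝ, ri (starRingEnd ℂ s + x) = ri (s + x) := by
    intro x
    rw [← ri_conj (s + x), map_add, conj_ofReal]
  unfold T
  simp only [this, ri_conj]

namespace Ker
variable {n : ℕ} (K : Ker n)

lemma S_nonneg : 0 ≤ K.S := le_trans (Finset.sum_nonneg fun _ _ => abs_nonneg _) K.hS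

/-- the full functional -/
noncomputable def Phi (η θ : ℝ) (N : ℕ) (φ : ℂ → ℝ) (s : ℂ) : ℝ :=
  ∑ j, K.c j * T N θ φ (s + ((K.lam j * η : ℝ) : ℂ)) + K.S / (4 * N) * φ (s + ((2 * N * θ : ℝ) : ℂ))

noncomputable def PhiC (η θ : ℝ) (N : ℕ) (f : ℂ → ℂ) (s : ℂ) : ℂ :=
  ∑ j, (K.c j : ℂ) * TC N θ f (s + ((K.lam j * η : ℝ) : ℂ)) + ((K.S / (4 * N) : ℝ) : ℂ) * f (s + ((2 * N * θ : ℝ) : ℂ))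

lemma PhiC_re (η θ : ℝ) (N : ℕ) (f : ℂ → ℂ) (s : ℂ) :
    (K.PhiC η θ N f s).re = K.Phi η θ N (fun z => (f z).re) s := by
  unfold PhiC Phi
  rw [add_re, re_ofReal_mul, re_sum]
  congr 1
  apply Finset.sum_congr rfl
  intro j _
  rw [re_ofReal_mul, TC_re]

noncomputable def P (η θ : ℝ) (N : ℕ) (z : ℂ) : ℝ :=
  K.Phi η θ N ri z + K.Phi η θ N ri (θ - starRingEnd ℂ z)

lemma Phi_ri_conj (η θ : ℝ) (N : ℕ) (z : ℂ) : K.Phi η θ N ri (starRingEnd ℂ z) = K.Phi η θ N ri z := by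
  have : ∀ x : ℝ, starRingEnd ℂ z + x = starRingEnd ℂ (z + x) := by
    intro x
    rw [map_add, conj_ofReal]
  unfold Phi
  simp only [this, T_ri_conj, ri_conj]

lemma P_symm (η θ : ℝ) (N : ℕ) (z : ℂ) : K.P η θ N (θ - starRingEnd ℂ z) = K.P η θ N z := by
  unfold P
  rw [map_sub, conj_conj, conj_ofReal, add_comm]; congr 2; ring

lemma Phi_ri_H (η θ : ℝ) (N : ℕ) (z : ℂ) : K.Phi η θ N ri z =
    T N θ (K.H η) z + K.S / (4 * N) * ri (z + ((2 * N * θ : ℝ) : ℂ)) := by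
  unfold Phi; rw [T_H]

/-- P on the boundary of the strip -/
lemma P_boundary {η θ : ℝ} (hη : 0 < η) (hθ : 0 < θ) {N : ℕ} (hN : 1 ≤ N) (y : ℝ) :
    0 ≤ K.P η θ N (y * I) := by
  have hNp : (0:ℝ) < N := by exact_mod_cast hN
  have e : (θ:ℂ) - starRingEnd ℂ (y * I) = y * I + θ := by simp; ring
  have hT := T_add N θ (K.H η) (y * I)
  unfold P
  rw [Phi_ri_H, Phi_ri_H, e]
  have h0 : 0 ≤ K.H η (y * I) := by
    have := K.hb (y / η)
    have e2 : K.H η (y * I) = (1/η) * ∑ j, K.c j * (K.lam j / (K.lam j ^ 2 + (y/η)^2)) := by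
      unfold H
      rw [Finset.mul_sum]
      apply Finset.sum_congr rfl
      intro j _
      rw [ri_eq]
      have hj := K.lam_pos j
      simp only [add_re, mul_re, ofReal_re, I_re, mul_zero, ofReal_im, I_im, mul_one, sub_self, zero_add, add_im, mul_im, add_zero]
      have h1 : (K.lam j * η)^2 + y^2 ≠ 0 := by positivity
      have h2 : K.lam j ^ 2 + (y/η)^2 ≠ 0 := by positivity
      field_simp
    rw [e2]; positivity
  set X : ℝ := 2 * N * θ with hX
  have hXp : 0 < X := by positivity
  have hd : |K.H η (y * I + (X:ℂ)) - K.H η (y * I + (((2*N+1)*θ : ℝ):ℂ))| ≤ K.S * (θ / (X^2 + y^2)) := by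
    unfold H
    rw [← Finset.sum_sub_distrib]
    calc _ ≤ ∑ j, |K.c j| * (θ / (X^2 + y^2)) := by
          refine (Finset.abs_sum_le_sum_abs _ _).trans (Finset.sum_le_sum ?_)
          intro j _
          rw [← mul_sub, abs_mul]
          gcongr
          have hj := K.lam_pos j
          set w : ℂ := y * I + (X:ℂ) + ((K.lam j * η : ℝ):ℂ) with hw
          have e3 : y * I + (((2*N+1)*θ : ℝ):ℂ) + ((K.lam j * η : ℝ):ℂ) = w + θ := by
            rw [hw, hX]; push_cast; ring
          rw [e3]
          have wre : w.re = X + K.lam j * η := by simp [hw]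
          have wim : w.im = y := by simp [hw]
          have hwp : 0 < w.re := by rw [wre]; positivity
          have hw0 : w ≠ 0 := by intro h; rw [h] at hwp; simp at hwp
          have hw1 : w + θ ≠ 0 := by
            intro h
            have := congrArg re h
            simp at this; linarith
          have e4 : ri w - ri (w + θ) = (θ / (w * (w + θ))).re := by
            unfold ri
            rw [← sub_re]; congr 1; field_simp; ring
          rw [e4]
          refine (abs_re_le_norm _).trans ?_
          rw [norm_div, norm_mul, norm_real, Real.norm_eq_abs, abs_of_pos hθ]
          have n1 : X^2 + y^2 ≤ ‖w‖^2 := by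
            rw [← normSq_eq_norm_sq, normSq_apply, wre, wim]
            have : 0 ≤ K.lam j * η := by positivity
            nlinarith
          have n2 : ‖w‖ ≤ ‖w + θ‖ := by
            apply le_of_sq_le_sq _ (norm_nonneg _)
            rw [← normSq_eq_norm_sq, ← normSq_eq_norm_sq, normSq_apply, normSq_apply]
            simp only [add_re, add_im, ofReal_re, ofReal_im, add_zero]
            nlinarith
          have n3 : X^2 + y^2 ≤ ‖w‖ * ‖w + θ‖ := by nlinarith [norm_nonneg w]
          gcongr
      _ = (∑ j, |K.c j|) * (θ / (X^2 + y^2)) := by rw [Finset.sum_mul]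
      _ ≤ _ := by gcongr; exact K.hS
  have hD : K.S / (4 * N) * ri (y * I + (X:ℂ)) = 1/2 * (K.S * (θ / (X^2 + y^2))) := by
    rw [ri_eq]
    simp only [add_re, mul_re, ofReal_re, I_re, mul_zero, ofReal_im, I_im, mul_one, sub_self, zero_add, add_im, mul_im, add_zero]
    have : X^2 + y^2 ≠ 0 := by positivity
    field_simp
    rw [hX]; ring
  have hD2 : 0 ≤ K.S / (4 * N) * ri (y * I + θ + (X:ℂ)) := by
    have := K.S_nonneg
    have := ri_nonneg (z := y * I + θ + (X:ℂ)) (by simp; linarith)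
    positivity
  have := (abs_le.mp hd).2
  linarith

lemma strip_pos {η θ : ℝ} (hη : 0 < η) (hθ : 0 < θ) {N : ℕ} (hN : 1 ≤ N) {z : ℂ} (h0 : 0 ≤ z.re) (h1 : z.re ≤ θ) :
    0 ≤ K.P η θ N z := by
  have hNp : (0:ℝ) < N := by exact_mod_cast hN
  set Q : ℂ → ℂ := K.PhiC η θ N (fun z => 1 / z) with hQ
  have hQre : ∀ z, (Q z).re = K.Phi η θ N ri z := fun z => by rw [hQ, PhiC_re]; rfl
  set f : ℂ → ℂ := fun z => exp (-(Q z + Q (θ - z))) with hf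
  have hnf : ∀ z, ‖f z‖ = Real.exp (-K.P η θ N z) := by
    intro z
    rw [hf, norm_exp, neg_re, add_re, hQre, hQre, P, ← K.Phi_ri_conj η θ N (θ - z), map_sub, conj_ofReal]
  have hdiffinv : ∀ s : ℂ, 0 < s.re → ∀ x : ℝ, 0 ≤ x → DifferentiableAt ℂ (fun z : ℂ => 1 / z) (s + x) := by
    intro s hs x hx
    have : s + x ≠ 0 := by
      intro h
      have := congrArg re h
      simp at this; linarith
    fun_prop (disch := assumption)
  have hdQ : ∀ z : ℂ, 0 ≤ z.re → DifferentiableAt ℂ Q z := by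
    intro z hz
    rw [hQ]
    unfold PhiC
    refine (DifferentiableAt.fun_sum ?_).add (DifferentiableAt.const_mul ?_ _)
    · intro j _
      have hj := K.lam_pos j
      refine DifferentiableAt.const_mul ?_ _
      have := TC_differentiableAt (N := N) hθ.le (hdiffinv (z + ((K.lam j * η : ℝ):ℂ)) (by
        rw [add_re, ofReal_re]; positivity))
      exact this.comp z (f := fun z : ℂ => z + ((K.lam j * η : ℝ):ℂ)) (by fun_prop)
    · have := hdiffinv (z + ((2 * N * θ : ℝ):ℂ)) (by rw [add_re, ofReal_re]; positivity) 0 le_rfl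
      rw [ofReal_zero, add_zero] at this
      exact this.comp z (f := fun z : ℂ => z + ((2 * N * θ : ℝ):ℂ)) (by fun_prop)
  have hbinv : ∀ (s : ℂ) (B : ℝ), 0 < B → B ≤ s.re → ∀ x : ℝ, 0 ≤ x → ‖1 / (s + (x:ℂ))‖ ≤ 1 / B := by
    intro s B hB hs x hx
    rw [norm_div, norm_one]
    have h := (le_abs_self _).trans (abs_re_le_norm (s + x))
    rw [add_re, ofReal_re] at h
    gcongr; linarith
  obtain ⟨M, hM⟩ : ∃ M : ℝ, ∀ z : ℂ, 0 ≤ z.re → ‖Q z‖ ≤ M := by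
    refine ⟨∑ j, |K.c j| * ((1 + 4 * N) * (1 / (K.lam j * η))) + K.S / (4 * N) * (1 / (2 * N * θ)), ?_⟩
    intro z hz
    rw [hQ]
    unfold PhiC
    refine (norm_add_le _ _).trans (add_le_add (norm_sum_le_of_le _ ?_) ?_)
    · intro j _
      have hj := K.lam_pos j
      rw [norm_mul, norm_real, Real.norm_eq_abs]
      gcongr
      exact TC_bound hθ.le (hbinv _ _ (by positivity) (by rw [add_re, ofReal_re]; linarith))
    · have hS := K.S_nonneg
      rw [norm_mul, norm_real, Real.norm_eq_abs, abs_of_nonneg (by positivity)]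
      have := hbinv (z + ((2 * N * θ : ℝ):ℂ)) (2 * N * θ) (by positivity) (by rw [add_re, ofReal_re]; linarith) 0 le_rfl
      rw [ofReal_zero, add_zero] at this
      gcongr
  have hbd : ∀ y : ℝ, ‖f (y * I)‖ ≤ 1 := by
    intro y
    rw [hnf, Real.exp_le_one_iff]
    linarith [K.P_boundary hη hθ hN y]
  have key : ‖f z‖ ≤ 1 := by
    refine PhragmenLindelof.vertical_strip (a := 0) (b := θ) (f := f) (C := 1) ?_ ?_ ?_ ?_ h0 h1
    · apply DifferentiableOn.diffContOnCl
      intro w hw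
      have hw' : w ∈ re ⁻¹' Icc 0 θ := by
        have hcl : IsClosed (re ⁻¹' Icc 0 θ) := isClosed_Icc.preimage continuous_re
        exact closure_minimal (preimage_mono Ioo_subset_Icc_self) hcl hw
      have d1 := hdQ w hw'.1
      have d2 : DifferentiableAt ℂ (fun z => Q (θ - z)) w := by
        have := hdQ (θ - w) (by rw [sub_re, ofReal_re]; linarith [hw'.2])
        exact this.comp w (f := fun z : ℂ => θ - z) (by fun_prop)
      exact ((d1.add d2).neg.cexp).differentiableWithinAt
    · refine ⟨0, by positivity, 0, ?_⟩
      refine Asymptotics.IsBigO.of_bound (Real.exp (M + M)) ?_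
      rw [eventually_inf_principal]
      refine Eventually.of_forall ?_
      intro w hw
      simp only [zero_mul, Real.exp_zero, norm_one, mul_one]
      rw [hf, norm_exp]
      apply Real.exp_le_exp.mpr
      refine (re_le_norm _).trans ?_
      rw [norm_neg]
      have hw' : w.re ∈ Ioo 0 θ := hw
      exact (norm_add_le _ _).trans (add_le_add (hM _ hw'.1.le) (hM _ (by rw [sub_re, ofReal_re]; linarith [hw'.2])))
    · intro w hw
      have : w = (w.im : ℝ) * I := by apply Complex.ext <;> simp [hw]
      rw [this]; exact hbd _
    · intro w hw
      have e : (θ:ℂ) - starRingEnd ℂ ((w.im : ℝ) * I) = w := by apply Complex.ext <;> simp [hw]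
      rw [hnf, ← e, P_symm, ← hnf]
      exact hbd _
  rw [hnf, Real.exp_le_one_iff] at key
  linarith

end Ker
end ZFR

namespace ZFR
open Complex Set Filter Topology MeasureTheory

namespace Ker
variable {n : ℕ} (K : Ker n)

lemma Phi_hasSum {η θ : ℝ} (hθ : 0 ≤ θ) {N : ℕ} {ι : Type*} {F : ι → ℂ → ℝ} {φ : ℂ → ℝ} {s : ℂ}
    (hj : ∀ j, ∀ x : ℝ, 0 ≤ x → HasSum (fun i => F i (s + ((K.lam j * η : ℝ):ℂ) + x)) (φ (s + ((K.lam j * η : ℝ):ℂ) + x)))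
    (hX : HasSum (fun i => F i (s + ((2 * N * θ : ℝ):ℂ))) (φ (s + ((2 * N * θ : ℝ):ℂ)))) :
    HasSum (fun i => K.Phi η θ N (F i) s) (K.Phi η θ N φ s) := by
  unfold Phi
  refine HasSum.add (hasSum_sum ?_) (hX.mul_left _)
  intro j _
  exact (T_hasSum hθ (hj j)).mul_left _

lemma Phi_tendsto {η θ : ℝ} (hθ : 0 ≤ θ) {N : ℕ} {F : ℕ → ℂ → ℝ} {φ : ℂ → ℝ} {s : ℂ}
    (hj : ∀ j, ∀ x : ℝ, 0 ≤ x → Tendsto (fun i => F i (s + ((K.lam j * η : ℝ):ℂ) + x)) atTop (𝓝 (φ (s + ((K.lam j * η : ℝ):ℂ) + x))))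
    (hX : Tendsto (fun i => F i (s + ((2 * N * θ : ℝ):ℂ))) atTop (𝓝 (φ (s + ((2 * N * θ : ℝ):ℂ))))) :
    Tendsto (fun i => K.Phi η θ N (F i) s) atTop (𝓝 (K.Phi η θ N φ s)) := by
  unfold Phi
  refine Tendsto.add (tendsto_finsetSum _ ?_) (hX.const_mul _)
  intro j _
  exact (T_tendsto hθ (hj j)).const_mul _

lemma Phi_congr {η θ : ℝ} (hθ : 0 ≤ θ) {N : ℕ} {F : ℂ → ℝ} {φ : ℂ → ℝ} {s : ℂ}
    (hj : ∀ j, ∀ x : ℝ, 0 ≤ x → F (s + ((K.lam j * η : ℝ):ℂ) + x) = (φ (s + ((K.lam j * η : ℝ):ℂ) + x)))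
    (hX : F (s + ((2 * N * θ : ℝ):ℂ)) = (φ (s + ((2 * N * θ : ℝ):ℂ)))) :
    K.Phi η θ N F s = K.Phi η θ N φ s := by
  unfold Phi
  rw [hX]
  congr 1
  apply Finset.sum_congr rfl
  intro j _
  rw [T_congr hθ (hj j)]

lemma Phi_lin {η θ : ℝ} {N : ℕ} (φ ψ : ℂ → ℝ) (s : ℂ) (a b : ℝ) :
    K.Phi η θ N (fun z => a * φ z + b * ψ z) s = a * K.Phi η θ N φ s + b * K.Phi η θ N ψ s := by
  unfold Phi
  simp only [T_lin]
  have : ∀ j, K.c j * (a * T N θ φ (s + ((K.lam j * η : ℝ):ℂ)) + b * T N θ ψ (s + ((K.lam j * η : ℝ):ℂ))) =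
    a * (K.c j * T N θ φ (s + ((K.lam j * η : ℝ):ℂ))) + b * (K.c j * T N θ ψ (s + ((K.lam j * η : ℝ):ℂ))) := by
    intro j; ring
  simp only [this, Finset.sum_add_distrib, ← Finset.mul_sum]
  ring

lemma Phi_sum {ι : Type*} (A : Finset ι) {η θ : ℝ} {N : ℕ} (c : ι → ℝ) (φ : ι → ℂ → ℝ) (s : ℂ) :
    K.Phi η θ N (fun z => ∑ j ∈ A, c j * φ j z) s = ∑ j ∈ A, c j * K.Phi η θ N (φ j) s := by
  classical
  induction A using Finset.induction_on with
  | empty =>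
    unfold Phi
    simp [T_const]
  | insert a A ha ih =>
    simp only [Finset.sum_insert ha]
    rw [← ih]
    have := K.Phi_lin (N := N) (θ := θ) (η := η) (φ a) (fun z => ∑ j ∈ A, c j * φ j z) s (c a) 1
    simpa using this

end Ker

noncomputable def ZR (s : ℂ) : ℝ := (- deriv riemannZeta s / riemannZeta s).re
noncomputable def SR (s : ℂ) : ℝ := (logDeriv xi s).re
noncomputable def GR (s : ℂ) : ℝ := (G s).re

lemma ZR_decomp {s : ℂ} (hs : 1 < s.re) : ZR s = ri (s - 1) + GR s - SR s := by
  unfold ZR SR GR ri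
  rw [zeta_decomp hs, sub_re, add_re]

noncomputable def Zt (n : ℕ) (s : ℂ) : ℝ :=
  ArithmeticFunction.vonMangoldt n * (Real.exp (- s.re * Real.log n) * Real.cos (s.im * Real.log n))

lemma ZR_hasSum {s : ℂ} (hs : 1 < s.re) : HasSum (fun n => Zt n s) (ZR s) := by
  have h1 := (ArithmeticFunction.LSeriesSummable_vonMangoldt hs).hasSum
  have h2 := ArithmeticFunction.LSeries_vonMangoldt_eq_deriv_riemannZeta_div hs
  unfold LSeries at h2
  rw [h2] at h1
  have h3 := hasSum_re h1
  unfold ZR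
  convert h3 using 2 with n
  unfold Zt
  by_cases hn : n = 0
  · simp [hn]
  · have hnp : (0:ℝ) < n := by exact_mod_cast Nat.pos_of_ne_zero hn
    rw [LSeries.term_of_ne_zero hn, div_eq_mul_inv, ← cpow_neg, re_ofReal_mul,
      cpow_def_of_ne_zero (by exact_mod_cast hn), ← natCast_log, exp_re]
    simp only [mul_re, mul_im, ofReal_re, ofReal_im, neg_re, neg_im, zero_mul, sub_zero, add_zero]
    rw [← Real.cos_neg]
    congr 3 <;> ring

lemma Zt_shift (n : ℕ) (s : ℂ) (x : ℝ) : Zt n (s + x) = Real.exp (-x * Real.log n) * Zt n s := by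
  unfold Zt
  simp only [add_re, ofReal_re, add_im, ofReal_im, add_zero]
  have : -(s.re + x) * Real.log n = -x * Real.log n + -s.re * Real.log n := by ring
  rw [this, Real.exp_add]; ring

lemma T_Zt (N : ℕ) {θ : ℝ} (n : ℕ) : ∃ τ : ℝ, 0 ≤ τ ∧ ∀ s, T N θ (Zt n) s = τ * Zt n s := by
  refine ⟨1/2 + 1/2 * ∑ m ∈ Finset.range N, Real.exp (-(2*m*θ) * Real.log n) * (1 - Real.exp (-θ * Real.log n))^2, ?_, ?_⟩
  · positivity
  · intro s
    unfold T
    rw [add_mul, mul_assoc (1/2 : ℝ) _ (Zt n s), Finset.sum_mul]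
    congr 2
    apply Finset.sum_congr rfl
    intro m _
    rw [Zt_shift, Zt_shift, Zt_shift]
    have e1 : -((2*m+1)*θ) * Real.log n = -(2*m*θ) * Real.log n + -θ * Real.log n := by ring
    have e2 : -((2*m+2)*θ) * Real.log n = -(2*m*θ) * Real.log n + (-θ * Real.log n + -θ * Real.log n) := by ring
    rw [e1, e2, Real.exp_add, Real.exp_add, Real.exp_add]
    ring

namespace Ker
variable {n : ℕ} (K : Ker n)

lemma Phi_Zt {η θ : ℝ} (hη : 0 < η) (N : ℕ) (m : ℕ) : ∃ κ : ℝ, 0 ≤ κ ∧ ∀ s, K.Phi η θ N (Zt m) s = κ * Zt m s := by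
  obtain ⟨τ, hτ, h⟩ := T_Zt N (θ := θ) m
  have hS := K.S_nonneg
  have hl : 0 ≤ Real.log m := Real.log_natCast_nonneg m
  have hh := K.hh (η * Real.log m) (by positivity)
  refine ⟨(∑ j, K.c j * Real.exp (-K.lam j * (η * Real.log m))) * τ
    + K.S / (4 * N) * Real.exp (-(2 * N * θ) * Real.log m), by positivity, ?_⟩
  intro s
  unfold Phi
  rw [add_mul, Finset.sum_mul, Finset.sum_mul, Zt_shift]
  congr 1
  · apply Finset.sum_congr rfl
    intro j _
    rw [h, Zt_shift]
    have : -(K.lam j * η) * Real.log m = -K.lam j * (η * Real.log m) := by ring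
    rw [this]; ring
  · ring

/-- positivity of the trigonometric combination -/
lemma Z_pos {η θ : ℝ} (hη : 0 < η) (hθ : 0 ≤ θ) {N : ℕ} {σ : ℝ} (h1 : ∀ j, 1 < σ + K.lam j * η) (h2 : 1 < σ + 2 * N * θ)
    (a : Fin 5 → ℝ) (ha : ∀ φ : ℝ, 0 ≤ ∑ k : Fin 5, a k * Real.cos (k * φ)) (γ : ℝ) :
    0 ≤ ∑ k : Fin 5, a k * K.Phi η θ N ZR (σ + ((k * γ : ℝ):ℂ) * I) := by
  have hs : ∀ k : Fin 5, HasSum (fun m => K.Phi η θ N (Zt m) (σ + ((k * γ : ℝ):ℂ) * I)) (K.Phi η θ N ZR (σ + ((k * γ : ℝ):ℂ) * I)) := by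
    intro k
    apply K.Phi_hasSum hθ
    · intro j x hx
      apply ZR_hasSum
      have := h1 j
      simp only [add_re, ofReal_re, mul_re, I_re, mul_zero, ofReal_im, I_im, mul_one, sub_self, add_zero]
      linarith
    · apply ZR_hasSum
      simp only [add_re, ofReal_re, mul_re, I_re, mul_zero, ofReal_im, I_im, mul_one, sub_self, add_zero]
      linarith
  have hs2 := hasSum_sum (s := Finset.univ) (fun (k : Fin 5) _ => (hs k).mul_left (a k))
  refine hs2.nonneg ?_
  intro m
  obtain ⟨κ, hκ, h⟩ := K.Phi_Zt (θ := θ) hη N m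
  have hL := ArithmeticFunction.vonMangoldt_nonneg (n := m)
  have e : ∑ k : Fin 5, a k * K.Phi η θ N (Zt m) (σ + ((k * γ : ℝ):ℂ) * I) =
    κ * ArithmeticFunction.vonMangoldt m * Real.exp (-σ * Real.log m) * ∑ k : Fin 5, a k * Real.cos (k * (γ * Real.log m)) := by
    rw [Finset.mul_sum]
    apply Finset.sum_congr rfl
    intro k _
    rw [h]
    unfold Zt
    simp only [add_re, add_im, ofReal_re, mul_re, mul_im, I_re, mul_zero, ofReal_im, I_im, mul_one, sub_self, add_zero, zero_add]
    have : (k * γ : ℝ) * Real.log m = k * (γ * Real.log m) := by ring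
    rw [this]; ring
  rw [e]
  have := ha (γ * Real.log m)
  positivity

end Ker

lemma ZR_real_nonneg {x : ℝ} (hx : 1 < x) : 0 ≤ ZR x := by
  have := ZR_hasSum (s := (x:ℂ)) (by simpa using hx)
  refine this.nonneg ?_
  intro m
  have hL := ArithmeticFunction.vonMangoldt_nonneg (n := m)
  unfold Zt
  simp only [ofReal_im, zero_mul, Real.cos_zero]
  positivity

end ZFR

namespace ZFR
open Complex Set Filter Topology MeasureTheory

lemma abs_sum_c {n : ℕ} (K : Ker n) (q : Fin n → ℝ) (B : ℝ) (h : ∀ j, |q j| ≤ B) (hB : 0 ≤ B) :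
    |∑ j, K.c j * q j| ≤ K.S * B := by
  refine (Finset.abs_sum_le_sum_abs _ _).trans ?_
  calc ∑ j, |K.c j * q j| ≤ ∑ j, |K.c j| * B := by
        apply Finset.sum_le_sum
        intro j _
        rw [abs_mul]; gcongr; exact h j
    _ = (∑ j, |K.c j|) * B := by rw [Finset.sum_mul]
    _ ≤ _ := by gcongr; exact K.hS

lemma T_ri_abs (N : ℕ) {θ : ℝ} (hθ : 0 < θ) (hθ1 : θ ≤ 1) {v : ℂ} {t x : ℝ} (ht : 0 < t) (hx : 0 ≤ v.re) (hx' : v.re ≤ x)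
    (hi : t ≤ |v.im|) : |T N θ ri v| ≤ (1/2 * x + 0.708) / t^2 := by
  have h1 := T_ri_bound N hθ (v := v) (b := t) ht hx (by linarith)
  have hne : v.im ≠ 0 := by intro h; rw [h, abs_zero] at hi; linarith
  have hsq : t^2 ≤ v.im^2 := by rw [← sq_abs v.im]; gcongr
  have h2 : ri v ≤ x / t^2 := (ri_le hx hne).trans (by
    have : 0 ≤ x := hx.trans hx'
    have : 0 < t^2 := by positivity
    gcongr)
  have h3 := ri_nonneg hx
  have h4 : 0.708 * θ / t^2 ≤ 0.708 / t^2 := by gcongr; linarith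
  have e : (1/2 * x + 0.708) / t^2 = 1/2 * (x / t^2) + 0.708 / t^2 := by ring
  rw [e]
  rw [abs_le] at h1 ⊢
  constructor <;> linarith

lemma ri_le_inv {v : ℂ} (h : 0 < v.re) : ri v ≤ 1 / v.re := by
  rw [ri_eq, div_le_div_iff₀ (by positivity) h]
  nlinarith [sq_nonneg v.im]

lemma rinv_sqrt {N : ℕ} (hN : 1 ≤ N) : 1 / (N:ℝ) ≤ 1 / √N := by
  have h1 : (1:ℝ) ≤ N := by exact_mod_cast hN
  have : 0 < √(N:ℝ) := by positivity
  gcongr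
  rw [Real.sqrt_le_left (by positivity)]
  nlinarith

lemma T_add_const {N : ℕ} {θ : ℝ} (φ : ℂ → ℝ) (s : ℂ) (a : ℝ) :
    T N θ (fun z => φ z + a) s = T N θ φ s + 1/2 * a := by
  have := T_lin (N := N) (θ := θ) φ (fun _ => a) s 1 1
  simp only [one_mul, T_const] at this
  exact this

lemma GR_hasSum {s : ℂ} (hs : -1 < s.re) :
    HasSum (fun n : ℕ => 1 / (2 * ((n:ℝ) + 1)) - ri (s + ((2 * ((n:ℝ) + 1) : ℝ) : ℂ)))
      (GR s + (Real.eulerMascheroniConstant + Real.log Real.pi)/2) := by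
  have := hasSum_re (G_hasSum hs)
  convert this using 2 with n
  · rw [sub_re, ri]
    congr 1
    · have : (1 / (2 * ((n:ℂ) + 1))) = ((1 / (2 * ((n:ℝ) + 1)) : ℝ) : ℂ) := by push_cast; rfl
      rw [this, ofReal_re]
    · push_cast; rfl
  · rw [add_re, GR]
    congr 1
    have : ((Real.eulerMascheroniConstant + Real.log Real.pi : ℝ) : ℂ) / 2 = (((Real.eulerMascheroniConstant + Real.log Real.pi)/2 : ℝ) : ℂ) := by
      push_cast; rfl
    rw [this, ofReal_re]

namespace Ker
variable {n : ℕ} (K : Ker n)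

lemma Phi_shift (η θ : ℝ) (N : ℕ) (φ : ℂ → ℝ) (s d : ℂ) : K.Phi η θ N (fun z => φ (z + d)) s = K.Phi η θ N φ (s + d) := by
  have hsh : ∀ (x : ℂ), s + d + x = s + x + d := by
    intro x; ring
  unfold Phi
  simp only [← T_shift, hsh]

/-- pole term at the real point -/
lemma pole_zero {η : ℝ} (hη : 0 < η) (hωη : K.ω * η ≤ 1/10) {N : ℕ} (hN : 1 ≤ N) :
    K.Phi η (1 - 2 * K.ω * η) N (fun z => ri (z - 1)) ((1 - K.ω * η : ℝ):ℂ)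
      ≤ K.H η ((- K.ω * η : ℝ):ℂ) - 1/2 * (1 / (1 + 3 * η)) + K.S / √N := by
  have hNp : (1:ℝ) ≤ N := by exact_mod_cast hN
  have hS := K.S_nonneg
  have hω := K.hω
  have hwe : 0 ≤ K.ω * η := by positivity
  set θ := 1 - 2 * K.ω * η with hθ
  have hθp : 0 < θ := by rw [hθ]; linarith
  have e : (fun z : ℂ => ri (z - 1)) = fun z => ri (z + (-1 : ℂ)) := by
    funext z; rw [sub_eq_add_neg]
  rw [e, Phi_shift, Phi_ri_H]
  have e2 : ((1 - K.ω * η : ℝ):ℂ) + (-1) = ((-K.ω * η : ℝ) : ℂ) := by push_cast; ring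
  rw [e2]
  have h1 := K.TH_le (θ := θ) N hη hθp.le (x := -K.ω * η) le_rfl
  have h2 := K.H_mu hη (x := -K.ω * η + θ) (by rw [hθ]; linarith)
  have h3 : 1 / (1 + 3 * η) ≤ 1 / (-K.ω * η + θ + 3 * η) := by
    apply one_div_le_one_div_of_le
    · rw [hθ]; linarith
    · rw [hθ]; linarith
  have h4 : K.S / (4 * N) * ri (((-K.ω * η : ℝ) : ℂ) + ((2 * N * θ : ℝ):ℂ)) ≤ K.S / √N := by
    rw [← ofReal_add, ri_ofReal]
    have hX : 1 ≤ -K.ω * η + 2 * N * θ := by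
      have : 0.8 ≤ θ := by rw [hθ]; linarith
      nlinarith
    have : 1 / (-K.ω * η + 2 * N * θ) ≤ 1 := by rw [div_le_one (by linarith)]; exact hX
    calc K.S / (4 * N) * (1 / (-K.ω * η + 2 * N * θ)) ≤ K.S / (4 * N) * 1 := by gcongr
      _ = K.S / 4 * (1 / N) := by field_simp
      _ ≤ K.S / 1 * (1 / √N) := by
        have := rinv_sqrt hN
        gcongr; norm_num
      _ = _ := by ring
  linarith

lemma pole_k {η : ℝ} (hη : 0 < η) (hωη : K.ω * η ≤ 1/10) {N : ℕ} (hN : 1 ≤ N) {t : ℝ} (ht : 0 < t) :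
    K.Phi η (1 - 2 * K.ω * η) N (fun z => ri (z - 1)) (((1 - K.ω * η : ℝ):ℂ) + (t:ℂ) * I)
      ≤ K.S * ((1/2 * (19 * η) + 0.708) / t^2) + K.S / √N := by
  have hNp : (1:ℝ) ≤ N := by exact_mod_cast hN
  have hS := K.S_nonneg
  have hω := K.hω
  have hwe : 0 ≤ K.ω * η := by positivity
  set θ := 1 - 2 * K.ω * η with hθ
  have hθp : 0 < θ := by rw [hθ]; linarith
  have e : (fun z : ℂ => ri (z - 1)) = fun z => ri (z + (-1 : ℂ)) := by
    funext z; rw [sub_eq_add_neg]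
  rw [e, Phi_shift]
  set w : ℂ := ((1 - K.ω * η : ℝ):ℂ) + (t:ℂ) * I + -1 with hw
  have wre : w.re = -K.ω * η := by simp [hw]; ring
  have wim : w.im = t := by simp [hw]
  unfold Phi
  have h1 := abs_sum_c K (fun j => T N θ ri (w + ((K.lam j * η : ℝ):ℂ))) ((1/2 * (19 * η) + 0.708) / t^2) ?_ (by positivity)
  · have h4 : K.S / (4 * N) * ri (w + ((2 * N * θ : ℝ):ℂ)) ≤ K.S / √N := by
      have hX : 1 ≤ (w + ((2 * N * θ : ℝ):ℂ)).re := by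
        have : 0.8 ≤ θ := by rw [hθ]; linarith
        rw [add_re, wre, ofReal_re]
        nlinarith
      have h5 := ri_le_inv (v := w + ((2 * N * θ : ℝ):ℂ)) (by linarith)
      have : 1 / (w + ((2 * N * θ : ℝ):ℂ)).re ≤ 1 := by rw [div_le_one (by linarith)]; exact hX
      calc K.S / (4 * N) * ri (w + ((2 * N * θ : ℝ):ℂ)) ≤ K.S / (4 * N) * 1 := by gcongr; linarith
        _ = K.S / 4 * (1 / N) := by field_simp
        _ ≤ K.S / 1 * (1 / √N) := by
          have := rinv_sqrt hN
          gcongr; norm_num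
        _ = _ := by ring
    have := (abs_le.mp h1).2
    linarith
  · intro j
    have l1 := K.hlam j
    have l2 := K.hΛ j
    have l3 := K.lam_pos j
    refine T_ri_abs N hθp (by rw [hθ]; linarith) ht ?_ ?_ ?_
    · rw [add_re, wre, ofReal_re]; nlinarith
    · rw [add_re, wre, ofReal_re]; nlinarith
    · rw [add_im, wim, ofReal_im, add_zero]; exact le_abs_self t

lemma GR_D {σ θ t : ℝ} (hσ : 0 < σ) (hσ1 : σ ≤ 1) (hθ : 0 < θ) (hθ1 : θ ≤ 1) {N : ℕ} (hN : 1 ≤ N) (ht : 0 ≤ t) :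
    K.S / (4 * N) * GR (σ + (t:ℂ) * I + ((2 * N * θ : ℝ):ℂ)) ≤ K.S * √(t + 3) / √N := by
  have hNp : (1:ℝ) ≤ N := by exact_mod_cast hN
  have hS := K.S_nonneg
  set w : ℂ := σ + (t:ℂ) * I + ((2 * N * θ : ℝ):ℂ) with hw
  have wre : w.re = σ + 2 * N * θ := by simp [hw]
  have wim : w.im = t := by simp [hw]
  have hp : 0 ≤ 2 * N * θ := by positivity
  have h1 := G_re_le (s := w) (by rw [wre]; linarith)
  have hlogpi : 0 ≤ Real.log Real.pi := Real.log_nonneg (by linarith [Real.pi_gt_three])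
  have h2 : GR w ≤ √N * √(t + 3) := by
    rw [wre, wim] at h1
    have a1 : ((σ + 2 * N * θ + 1)/2)^2 + (t/2)^2 + 1/4 ≤ (N + 2 + t)^2 := by
      have : (σ + 2 * N * θ + 1)/2 ≤ N + 1 := by nlinarith
      have : ((σ + 2 * N * θ + 1)/2)^2 ≤ (N+1)^2 := by gcongr
      nlinarith
    have a2 := Real.log_le_log (by positivity) a1
    have a3 : Real.log ((N + 2 + t)^2) = 4 * Real.log (√(N + 2 + t)) := by
      rw [Real.log_sqrt (by positivity), Real.log_pow]; push_cast; ring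
    have a4 : Real.log (√(N + 2 + t)) ≤ √(N + 2 + t) := (Real.log_le_sub_one_of_pos (by positivity)).trans (by linarith)
    have a5 : √(N + 2 + t) ≤ √N * √(t + 3) := by
      rw [← Real.sqrt_mul (by positivity)]
      apply Real.sqrt_le_sqrt
      nlinarith
    unfold GR
    linarith
  calc K.S / (4 * N) * GR w ≤ K.S / (4 * N) * (√N * √(t + 3)) := by gcongr
    _ = K.S / 4 * (√N / N) * √(t + 3) := by field_simp
    _ = K.S / 4 * (1 / √N) * √(t + 3) := by rw [Real.sqrt_div_self', ]
    _ ≤ K.S / 1 * (1 / √N) * √(t + 3) := by gcongr; norm_num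
    _ = _ := by ring

/-- term-by-term transformation of the archimedean sum -/
lemma arch_hasSum {η θ : ℝ} (hη : 0 < η) (hθ : 0 ≤ θ) (N : ℕ) {s : ℂ} (hs : -1 < s.re) :
    HasSum (fun m : ℕ => 1/2 * (1 / (2 * ((m:ℝ) + 1))) - T N θ (K.H η) (s + ((2 * ((m:ℝ) + 1) : ℝ) : ℂ)))
      (∑ j, K.c j * T N θ GR (s + ((K.lam j * η : ℝ):ℂ)) + 1/2 * ((Real.eulerMascheroniConstant + Real.log Real.pi)/2)) := by
  have h1 : ∀ j, HasSum (fun m : ℕ => K.c j * T N θ (fun z => 1 / (2 * ((m:ℝ) + 1)) - ri (z + ((2 * ((m:ℝ) + 1) : ℝ) : ℂ))) (s + ((K.lam j * η : ℝ):ℂ)))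
      (K.c j * T N θ (fun z => GR z + (Real.eulerMascheroniConstant + Real.log Real.pi)/2) (s + ((K.lam j * η : ℝ):ℂ))) := by
    intro j
    refine HasSum.mul_left _ (T_hasSum hθ ?_)
    intro x hx
    apply GR_hasSum
    have := K.lam_pos j
    have : 0 < K.lam j * η := by positivity
    simp only [add_re, ofReal_re]
    linarith
  have h2 := hasSum_sum (s := Finset.univ) (fun j _ => h1 j)
  convert h2 using 1
  · funext m
    have e : (fun z : ℂ => 1 / (2 * ((m:ℝ) + 1)) - ri (z + ((2 * ((m:ℝ) + 1) : ℝ) : ℂ))) =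
      fun z => (-1) * ri (z + ((2 * ((m:ℝ) + 1) : ℝ) : ℂ)) + 1 * (1 / (2 * ((m:ℝ) + 1))) := by funext z; ring
    have e2 : ∀ j, T N θ (fun z => (-1) * ri (z + ((2 * ((m:ℝ) + 1) : ℝ) : ℂ)) + 1 * (1 / (2 * ((m:ℝ) + 1)))) (s + ((K.lam j * η : ℝ):ℂ))
      = - T N θ ri (s + ((2 * ((m:ℝ) + 1) : ℝ) : ℂ) + ((K.lam j * η : ℝ):ℂ)) + 1/2 * (1 / (2 * ((m:ℝ) + 1))) := by
      intro j
      rw [T_lin (φ := fun z => ri (z + ((2 * ((m:ℝ) + 1) : ℝ) : ℂ))) (ψ := fun _ => 1 / (2 * ((m:ℝ) + 1))), T_const, ← T_shift]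
      have : s + ((K.lam j * η : ℝ):ℂ) + ((2 * ((m:ℝ) + 1) : ℝ) : ℂ) = s + ((2 * ((m:ℝ) + 1) : ℝ) : ℂ) + ((K.lam j * η : ℝ):ℂ) := by ring
      rw [this]; ring
    have e3 : ∑ j, K.c j * T N θ (fun z => 1 / (2 * ((m:ℝ) + 1)) - ri (z + ((2 * ((m:ℝ) + 1) : ℝ) : ℂ))) (s + ((K.lam j * η : ℝ):ℂ))
      = ∑ j, (-(K.c j * T N θ ri (s + ((2 * ((m:ℝ) + 1) : ℝ) : ℂ) + ((K.lam j * η : ℝ):ℂ))) + K.c j * (1/2 * (1 / (2 * ((m:ℝ) + 1))))) := by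
      apply Finset.sum_congr rfl
      intro j _
      rw [e, e2 j]; ring
    rw [e3, Finset.sum_add_distrib, Finset.sum_neg_distrib, ← Finset.sum_mul, K.hc, T_H]
    ring
  · simp only [T_add_const, mul_add, Finset.sum_add_distrib, ← Finset.sum_mul, K.hc]
    ring

lemma arch_zero {η : ℝ} (hη : 0 < η) (hωη : K.ω * η ≤ 1/10) {N : ℕ} (hN : 1 ≤ N) :
    K.Phi η (1 - 2 * K.ω * η) N GR ((1 - K.ω * η : ℝ):ℂ)
      ≤ 1/2 * (1/4 * Real.log ((1 + 3/2*η)^2 + 1/4) - 1/2 * Real.log Real.pi) + K.S * √3 / √N := by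
  have hω := K.hω
  have hwe : 0 ≤ K.ω * η := by positivity
  set θ := 1 - 2 * K.ω * η with hθ
  have hθp : 0 < θ := by rw [hθ]; linarith
  set σ := 1 - K.ω * η with hσ
  have hD := K.GR_D (σ := σ) (θ := θ) (t := 0) (by rw [hσ]; linarith) (by rw [hσ]; linarith) hθp (by rw [hθ]; linarith) hN le_rfl
  simp only [ofReal_zero, zero_mul, add_zero, zero_add] at hD
  have h1 := K.arch_hasSum hη hθp.le N (s := (σ:ℂ)) (by rw [ofReal_re, hσ]; linarith)
  have h2 := (GR_hasSum (s := ((σ + 3 * η : ℝ):ℂ)) (by rw [ofReal_re, hσ]; linarith)).mul_left (1/2)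
  have h3 := hasSum_le (f := fun m : ℕ => 1/2 * (1 / (2 * ((m:ℝ) + 1))) - T N θ (K.H η) (σ + ((2 * ((m:ℝ) + 1) : ℝ) : ℂ))) ?_ h1 h2
  · have h4 := G_re_le (s := ((σ + 3 * η : ℝ):ℂ)) (by rw [ofReal_re, hσ]; linarith)
    rw [ofReal_re, ofReal_im] at h4
    have h5 : Real.log (((σ + 3 * η + 1)/2)^2 + (0/2)^2 + 1/4) ≤ Real.log ((1 + 3/2*η)^2 + 1/4) := by
      apply Real.log_le_log (by positivity)
      have : 0 ≤ (σ + 3 * η + 1)/2 := by rw [hσ]; linarith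
      have : (σ + 3 * η + 1)/2 ≤ 1 + 3/2*η := by rw [hσ]; linarith
      have : ((σ + 3 * η + 1)/2)^2 ≤ (1 + 3/2*η)^2 := by gcongr
      linarith
    unfold Phi
    unfold GR at h3 hD ⊢
    linarith
  · intro m
    have hm : (0:ℝ) ≤ m := m.cast_nonneg
    have b1 := K.TH_ge_half N hη hθp.le (x := σ + 2 * ((m:ℝ) + 1)) (by rw [hσ]; linarith)
    have b2 := K.H_mu hη (x := σ + 2 * ((m:ℝ) + 1)) (by rw [hσ]; linarith)
    rw [← ofReal_add, ← ofReal_add, ri_ofReal]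
    have e : σ + 3 * η + 2 * ((m:ℝ) + 1) = σ + 2 * ((m:ℝ) + 1) + 3 * η := by ring
    rw [e]
    linarith

end Ker
end ZFR

namespace ZFR
open Complex Set Filter Topology MeasureTheory

lemma ri_diff {w : ℂ} {d b : ℝ} (hd : 0 ≤ d) (hb : 0 < b) (hw : 0 ≤ w.re) (hbw : b ≤ w.re + |w.im|) :
    |ri (w + d) - ri w| ≤ 2.0002 * d / b^2 := by
  have l0 : 0.7071 * b ≤ ‖w‖ := by
    refine le_trans ?_ (norm_ge_l1 w)
    rw [abs_of_nonneg hw]; nlinarith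
  have l1 : 0.7071 * b ≤ ‖w+d‖ := by
    refine le_trans ?_ (norm_ge_l1 _)
    simp only [add_re, ofReal_re, add_im, ofReal_im, add_zero]
    rw [abs_of_nonneg (by linarith)]; nlinarith
  have p0 : 0 < ‖w‖ := lt_of_lt_of_le (by positivity) l0
  have p1 : 0 < ‖w+d‖ := lt_of_lt_of_le (by positivity) l1
  have n0 : w ≠ 0 := norm_pos_iff.mp p0
  have n1 : w+d ≠ 0 := norm_pos_iff.mp p1
  have e4 : ri (w + d) - ri w = (-d / (w * (w + d))).re := by
    unfold ri
    rw [← sub_re]; congr 1; field_simp; ring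
  rw [e4]
  refine (abs_re_le_norm _).trans ?_
  rw [norm_div, norm_mul, norm_neg, norm_real, Real.norm_eq_abs, abs_of_nonneg hd]
  calc d / (‖w‖ * ‖w + d‖) ≤ d / ((0.7071 * b) * (0.7071 * b)) := by gcongr
    _ ≤ _ := by
      rw [div_le_div_iff₀ (by positivity) (by positivity)]
      have : 0 ≤ d * b^2 := by positivity
      nlinarith

namespace Ker
variable {n : ℕ} (K : Ker n)

lemma arch_k {η : ℝ} (hη : 0 < η) (hωη : K.ω * η ≤ 1/10) {N : ℕ} (hN : 1 ≤ N) {t : ℝ} (ht : 0 < t) :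
    K.Phi η (1 - 2 * K.ω * η) N GR (((1 - K.ω * η : ℝ):ℂ) + (t:ℂ) * I)
      ≤ 1/2 * (1/4 * Real.log (t^2/4 + 5/4) - 1/2 * Real.log Real.pi)
        + K.S * ((0.354 + 9.501 * η) / (t + 1)) + K.S * √(t + 3) / √N := by
  have hω := K.hω
  have hS := K.S_nonneg
  have hwe : 0 ≤ K.ω * η := by positivity
  set θ := 1 - 2 * K.ω * η with hθ
  have hθp : 0 < θ := by rw [hθ]; linarith
  have hθ1 : θ ≤ 1 := by rw [hθ]; linarith
  set σ := 1 - K.ω * η with hσ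
  have hD := K.GR_D (σ := σ) (θ := θ) (t := t) (by rw [hσ]; linarith) (by rw [hσ]; linarith) hθp hθ1 hN ht.le
  set s : ℂ := (σ:ℂ) + (t:ℂ) * I with hs
  have sre : s.re = σ := by simp [hs]
  have sim : s.im = t := by simp [hs]
  have h1 := K.arch_hasSum hη hθp.le N (s := s) (by rw [sre, hσ]; linarith)
  have h2 := (GR_hasSum (s := s) (by rw [sre, hσ]; linarith)).mul_left (1/2)
  have h3 := h1.sub h2
  have hterm : ∀ m : ℕ, 1/2 * (1 / (2 * ((m:ℝ) + 1))) - T N θ (K.H η) (s + ((2 * ((m:ℝ) + 1) : ℝ) : ℂ)) -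
      1/2 * (1 / (2 * ((m:ℝ) + 1)) - ri (s + ((2 * ((m:ℝ) + 1) : ℝ) : ℂ))) ≤
      K.S * ((0.708 + 19.002 * η) / (t + 2 * m + 2)^2) := by
    intro m
    have hm : (0:ℝ) ≤ m := m.cast_nonneg
    set w := s + ((2 * ((m:ℝ) + 1) : ℝ) : ℂ) with hw
    have wre : w.re = σ + 2 * (m + 1) := by rw [hw, add_re, sre, ofReal_re]
    have wim : w.im = t := by rw [hw, add_im, sim, ofReal_im, add_zero]
    have hbp : 0 < t + 2 * m + 2 := by positivity
    have key := abs_sum_c K (fun j => T N θ ri (w + ((K.lam j * η : ℝ):ℂ)) - 1/2 * ri w)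
      ((0.708 + 19.002 * η) / (t + 2 * m + 2)^2) ?_ (by positivity)
    · have e : ∑ j, K.c j * (T N θ ri (w + ((K.lam j * η : ℝ):ℂ)) - 1/2 * ri w) = T N θ (K.H η) w - 1/2 * ri w := by
        rw [← T_H]
        simp only [mul_sub, Finset.sum_sub_distrib]
        rw [← Finset.sum_mul, K.hc]; ring
      rw [e] at key
      have := (abs_le.mp key).1
      linarith
    · intro j
      have l1 := K.hlam j
      have l2 := K.hΛ j
      have l3 := K.lam_pos j
      have l4 : 0 < K.lam j * η := by positivity
      have b1 := T_ri_bound N hθp (v := w + ((K.lam j * η : ℝ):ℂ)) (b := t + 2 * m + 2) hbp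
        (by rw [add_re, wre, ofReal_re, hσ]; linarith)
        (by rw [add_re, wre, ofReal_re, add_im, wim, ofReal_im, add_zero, abs_of_pos ht, hσ]; linarith)
      have b2 := ri_diff (w := w) (d := K.lam j * η) (b := t + 2 * m + 2) l4.le hbp (by rw [wre, hσ]; linarith)
        (by rw [wre, wim, abs_of_pos ht, hσ]; linarith)
      have b3 : 0.708 * θ / (t + 2 * m + 2)^2 ≤ 0.708 / (t + 2 * m + 2)^2 := by gcongr; linarith
      have b4 : 2.0002 * (K.lam j * η) / (t + 2 * m + 2)^2 ≤ 2 * (19.002 * η) / (t + 2 * m + 2)^2 := by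
        refine div_le_div_of_nonneg_right ?_ (by positivity)
        nlinarith [mul_le_mul_of_nonneg_right l2 hη.le]
      have e : (0.708 + 19.002 * η) / (t + 2 * m + 2)^2 = 0.708 / (t + 2 * m + 2)^2 + 1/2 * (2 * (19.002 * η) / (t + 2 * m + 2)^2) := by ring
      show |T N θ ri (w + ((K.lam j * η : ℝ):ℂ)) - 1/2 * ri w| ≤ _
      rw [e]
      rw [abs_le] at b1 b2 ⊢
      constructor <;> linarith
  have hpart : ∀ M : ℕ, ∑ m ∈ Finset.range M, (1/2 * (1 / (2 * ((m:ℝ) + 1))) - T N θ (K.H η) (s + ((2 * ((m:ℝ) + 1) : ℝ) : ℂ)) -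
      1/2 * (1 / (2 * ((m:ℝ) + 1)) - ri (s + ((2 * ((m:ℝ) + 1) : ℝ) : ℂ)))) ≤
      K.S * ((0.708 + 19.002 * η) * (1/2 * (1 / (t + 1) - 1 / (t + 2 * M + 1)))) := by
    intro M
    induction M with
    | zero => simp
    | succ M ih =>
      rw [Finset.sum_range_succ]
      have h := hterm M
      have hM : (0:ℝ) ≤ M := M.cast_nonneg
      have h' : 1 / (t + 2 * M + 2)^2 ≤ 1/2 * (1 / (t + 2 * M + 1) - 1 / (t + 2 * M + 3)) := by
        have : 1/2 * (1 / (t + 2 * M + 1) - 1 / (t + 2 * M + 3)) = 1 / ((t + 2 * M + 1) * (t + 2 * M + 3)) := by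
          field_simp; ring
        rw [this]
        apply one_div_le_one_div_of_le (by positivity)
        nlinarith
      have h'' : K.S * ((0.708 + 19.002 * η) / (t + 2 * M + 2)^2) ≤ K.S * ((0.708 + 19.002 * η) * (1/2 * (1 / (t + 2 * M + 1) - 1 / (t + 2 * M + 3)))) := by
        rw [div_eq_mul_one_div]
        gcongr
      have e : t + 2 * ((M + 1 : ℕ):ℝ) + 1 = t + 2 * M + 3 := by push_cast; ring
      rw [e]
      calc _ ≤ K.S * ((0.708 + 19.002 * η) * (1/2 * (1 / (t + 1) - 1 / (t + 2 * M + 1)))) + 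
            K.S * ((0.708 + 19.002 * η) * (1/2 * (1 / (t + 2 * M + 1) - 1 / (t + 2 * M + 3)))) := by
              exact add_le_add ih (h.trans h'')
        _ = _ := by ring
  have h4 := le_of_tendsto' (b := K.S * ((0.354 + 9.501 * η) / (t + 1))) h3.tendsto_sum_nat (by
    intro M
    refine (hpart M).trans ?_
    have hM : (0:ℝ) ≤ M := M.cast_nonneg
    have : 0 ≤ 1 / (t + 2 * M + 1) := by positivity
    have e : (0.354 + 9.501 * η) / (t + 1) = (0.708 + 19.002 * η) * (1/2 * (1 / (t + 1))) := by ring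
    rw [e]
    gcongr
    linarith)
  have h5 := G_re_le (s := s) (by rw [sre, hσ]; linarith)
  rw [sre, sim] at h5
  have h6 : Real.log (((σ + 1)/2)^2 + (t/2)^2 + 1/4) ≤ Real.log (t^2/4 + 5/4) := by
    apply Real.log_le_log (by positivity)
    have : 0 ≤ (σ + 1)/2 := by rw [hσ]; linarith
    have : (σ + 1)/2 ≤ 1 := by rw [hσ]; linarith
    nlinarith
  unfold Phi
  unfold GR at h4 hD ⊢
  linarith

/-- lower bound for the pair contribution of a far zero -/
lemma P_far {η θ : ℝ} (hη : 0 < η) (hωη : K.ω * η ≤ 1/10) (hη2 : 19 * η ≤ 1) (hθ : θ = 1 - 2 * K.ω * η) {N : ℕ}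
    {z : ℂ} {y : ℝ} (h0 : -K.ω * η ≤ z.re) (h1 : z.re ≤ θ + K.ω * η) (hN : 1 ≤ N) (hy : 0 < y) (hi : y ≤ |z.im|) :
    - (4 * K.S / y^2) ≤ K.P η θ N z := by
  have hω := K.hω
  have hS := K.S_nonneg
  have hwe : 0 ≤ K.ω * η := by positivity
  have hθp : 0.8 ≤ θ := by rw [hθ]; linarith
  have hθ1 : θ ≤ 1 := by rw [hθ]; linarith
  have hNp : (1:ℝ) ≤ N := by exact_mod_cast hN
  have main : ∀ w : ℂ, -K.ω * η ≤ w.re → w.re ≤ θ + K.ω * η → y ≤ |w.im| → - (2 * K.S / y^2) ≤ K.Phi η θ N ri w := by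
    intro w h0 h1 hi
    have key := abs_sum_c K (fun j => T N θ ri (w + ((K.lam j * η : ℝ):ℂ))) ((1/2 * 2.2 + 0.708) / y^2) ?_ (by positivity)
    · have h3 : 0 ≤ K.S / (4 * N) * ri (w + ((2 * N * θ : ℝ):ℂ)) := by
        have := ri_nonneg (z := w + ((2 * N * θ : ℝ):ℂ)) (by
          rw [add_re, ofReal_re]; nlinarith)
        positivity
      have h4 : K.S * ((1/2 * 2.2 + 0.708) / y^2) ≤ 2 * K.S / y^2 := by
        rw [← mul_div_assoc]
        refine div_le_div_of_nonneg_right ?_ (by positivity)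
        nlinarith [K.S_nonneg]
      have := (abs_le.mp key).1
      unfold Phi
      linarith
    · intro j
      have l1 := K.hlam j
      have l2 := K.hΛ j
      have l3 := K.lam_pos j
      refine T_ri_abs N (by linarith) hθ1 hy ?_ ?_ ?_
      · rw [add_re, ofReal_re]; nlinarith
      · rw [add_re, ofReal_re]; nlinarith
      · rw [add_im, ofReal_im, add_zero]; exact hi
  have a := main z h0 h1 hi
  have b := main (θ - starRingEnd ℂ z) (by simp; linarith) (by simp; linarith) (by simpa using hi)
  unfold P
  have e : 4 * K.S / y^2 = 2 * K.S / y^2 + 2 * K.S / y^2 := by ring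
  rw [e]
  linarith

/-- contribution of the zero itself -/
lemma P_real {η θ : ℝ} (hη : 0 < η) (hθ : 0.8 ≤ θ) {N : ℕ} (hN : 1 ≤ N) {x : ℝ} (hx0 : 0 ≤ x) (hx1 : x ≤ θ) :
    K.H η x - K.S / √N ≤ K.P η θ N x := by
  have hS := K.S_nonneg
  have hω := K.hω
  have hNp : (1:ℝ) ≤ N := by exact_mod_cast hN
  unfold P
  rw [conj_ofReal, ← ofReal_sub, Phi_ri_H, Phi_ri_H]
  have hwe : 0 ≤ K.ω * η := by positivity
  have h1 := T_add N θ (K.H η) x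
  have h2 := K.TH_anti N hη (θ := θ) (by linarith) (x := θ - x) (y := x + θ) (by linarith) (by linarith)
  have hd1 : 0 ≤ K.S / (4 * N) * ri (x + ((2 * N * θ : ℝ):ℂ)) := by
    have := ri_nonneg (z := x + ((2 * N * θ : ℝ):ℂ)) (by rw [← ofReal_add, ofReal_re]; positivity)
    positivity
  have hd2 : 0 ≤ K.S / (4 * N) * ri (((θ - x : ℝ):ℂ) + ((2 * N * θ : ℝ):ℂ)) := by
    have := ri_nonneg (z := ((θ - x : ℝ):ℂ) + ((2 * N * θ : ℝ):ℂ)) (by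
      rw [← ofReal_add, ofReal_re]
      have : 0 ≤ θ - x := by linarith
      positivity)
    positivity
  have hX : 0 ≤ K.H η (x + (((2 * N + 1) * θ : ℝ):ℂ)) := by
    rw [← ofReal_add]
    apply K.H_nonneg hη
    have : 0 ≤ (2 * N + 1) * θ := by positivity
    linarith
  have hX2 : K.H η (x + ((2 * N * θ : ℝ):ℂ)) ≤ K.S * (1 / N) := by
    have := abs_sum_c K (fun j => ri (x + ((2 * N * θ : ℝ):ℂ) + ((K.lam j * η : ℝ):ℂ))) (1 / N) ?_ (by positivity)
    · exact (abs_le.mp this).2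
    · intro j
      have := K.lam_pos j
      rw [← ofReal_add, ← ofReal_add, ri_ofReal, abs_of_nonneg (by positivity)]
      apply one_div_le_one_div_of_le (by positivity)
      have : 0 ≤ K.lam j * η := by positivity
      nlinarith
  have hX3 : K.S * (1 / N) ≤ K.S / √N := by
    rw [div_eq_mul_one_div K.S]
    have := rinv_sqrt hN
    gcongr
  have hX4 : 0 ≤ K.S / √N := by positivity
  push_cast at h2
  push_cast at *
  linarith

end Ker
end ZFR

namespace ZFR
open Complex Set Filter Topology MeasureTheory

lemma xi_ne_zero' {s : ℂ} (h : 1 < s.re) : xi s ≠ 0 := xi_ne_zero h.le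

/-- The sequence of finite sets of zeros -/
noncomputable def Zs : ℕ → Finset ℂ := xi_sum.choose

lemma Zs_zero {n : ℕ} {ρ : ℂ} (h : ρ ∈ Zs n) : xi ρ = 0 := xi_sum.choose_spec.1 n ρ h
lemma Zs_rfl {n : ℕ} {ρ : ℂ} (h : ρ ∈ Zs n) : rfl' ρ ∈ Zs n := xi_sum.choose_spec.2.1 n ρ h
lemma Zs_ev {ρ : ℂ} (h : xi ρ = 0) : ∀ᶠ n in atTop, ρ ∈ Zs n := xi_sum.choose_spec.2.2.1 ρ h
lemma Zs_tendsto {s : ℂ} (h : xi s ≠ 0) :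
    Tendsto (fun n => ∑ ρ ∈ Zs n, (mult ρ : ℝ) * ri (s - ρ)) atTop (𝓝 (SR s)) := xi_sum.choose_spec.2.2.2 s h

lemma Zs_symm (n : ℕ) (f : ℂ → ℝ) : ∑ ρ ∈ Zs n, f (rfl' ρ) = ∑ ρ ∈ Zs n, f ρ := by
  refine Finset.sum_bij' (fun ρ _ => rfl' ρ) (fun ρ _ => rfl' ρ) ?_ ?_ ?_ ?_ ?_
  · intro ρ h; exact Zs_rfl h
  · intro ρ h; exact Zs_rfl h
  · intro ρ _; exact rfl'_rfl' ρ
  · intro ρ _; exact rfl'_rfl' ρ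
  · intro ρ _; rfl

namespace Ker
variable {n : ℕ} (K : Ker n)

lemma Phi_SR_tendsto {η : ℝ} (hη : 0 < η) (hωη : K.ω * η ≤ 1/10) {N : ℕ} (hN : 1 ≤ N) (t : ℝ) :
    Tendsto (fun n => ∑ ρ ∈ Zs n, (mult ρ : ℝ) * (1/2 * K.P η (1 - 2 * K.ω * η) N (((1 - K.ω * η : ℝ):ℂ) + (t:ℂ) * I - ρ)))
      atTop (𝓝 (K.Phi η (1 - 2 * K.ω * η) N SR (((1 - K.ω * η : ℝ):ℂ) + (t:ℂ) * I))) := by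
  have hω := K.hω
  have hwe : 0 ≤ K.ω * η := by positivity
  have hNp : (1:ℝ) ≤ N := by exact_mod_cast hN
  set θ := 1 - 2 * K.ω * η with hθ
  have hθp : 0.8 ≤ θ := by rw [hθ]; linarith
  set s : ℂ := ((1 - K.ω * η : ℝ):ℂ) + (t:ℂ) * I with hs
  have hsre : s.re = 1 - K.ω * η := by simp [hs]
  have h1 := K.Phi_tendsto (η := η) (θ := θ) (by linarith) (N := N)
    (F := fun n z => ∑ ρ ∈ Zs n, (mult ρ : ℝ) * ri (z - ρ)) (φ := SR) (s := s) (by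
      intro j x hx
      apply Zs_tendsto
      apply xi_ne_zero'
      have := mul_lt_mul_of_pos_right (K.hlam j) hη
      rw [add_re, add_re, hsre, ofReal_re, ofReal_re]
      linarith) (by
      apply Zs_tendsto
      apply xi_ne_zero'
      rw [add_re, hsre, ofReal_re]
      nlinarith)
  refine h1.congr ?_
  intro n
  have e1 : K.Phi η θ N (fun z => ∑ ρ ∈ Zs n, (mult ρ : ℝ) * ri (z - ρ)) s =
      ∑ ρ ∈ Zs n, (mult ρ : ℝ) * K.Phi η θ N ri (s - ρ) := by
    rw [K.Phi_sum (Zs n) (fun ρ => (mult ρ : ℝ)) (fun ρ z => ri (z - ρ)) s]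
    apply Finset.sum_congr rfl
    intro ρ _
    have h := K.Phi_shift η θ N ri s (-ρ)
    rw [← sub_eq_add_neg] at h
    rw [← h]
    simp only [sub_eq_add_neg]
  have e2 : ∑ ρ ∈ Zs n, (mult ρ : ℝ) * K.Phi η θ N ri (s - ρ) =
      ∑ ρ ∈ Zs n, (mult ρ : ℝ) * K.Phi η θ N ri (θ - starRingEnd ℂ (s - ρ)) := by
    rw [← Zs_symm n]
    apply Finset.sum_congr rfl
    intro ρ _
    rw [mult_rfl']
    congr 2
    rw [hs, hθ]
    apply Complex.ext <;> simp [rfl'] <;> ring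
  rw [e1]
  have e3 : ∀ ρ, (mult ρ : ℝ) * (1/2 * K.P η θ N (s - ρ)) =
     1/2 * ((mult ρ : ℝ) * K.Phi η θ N ri (s - ρ)) + 1/2 * ((mult ρ : ℝ) * K.Phi η θ N ri (θ - starRingEnd ℂ (s - ρ))) := by
    intro ρ; unfold P; ring
  simp only [e3]
  rw [Finset.sum_add_distrib, ← Finset.mul_sum, ← Finset.mul_sum, ← e2]
  ring

lemma SR_ge {η : ℝ} (hη : 0 < η) (hωη : K.ω * η ≤ 1/10) {N : ℕ} (hN : 1 ≤ N) {t g B : ℝ} (hg : 0 < g)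
    (hP : ∀ ρ, xi ρ = 0 → -(B * ri (((1 + g : ℝ):ℂ) - ρ)) ≤ K.P η (1 - 2 * K.ω * η) N (((1 - K.ω * η : ℝ):ℂ) + (t:ℂ) * I - ρ)) :
    -(1/2 * B * SR ((1 + g : ℝ):ℂ)) ≤ K.Phi η (1 - 2 * K.ω * η) N SR (((1 - K.ω * η : ℝ):ℂ) + (t:ℂ) * I) := by
  have h1 := K.Phi_SR_tendsto hη hωη hN t
  have h2 := Zs_tendsto (s := ((1 + g : ℝ):ℂ)) (xi_ne_zero' (by rw [ofReal_re]; linarith))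
  have h3 := (h2.const_mul (1/2*B)).neg
  refine le_of_tendsto_of_tendsto' h3 h1 ?_
  intro n
  rw [Finset.mul_sum, ← Finset.sum_neg_distrib]
  apply Finset.sum_le_sum
  intro ρ hρ
  have := hP ρ (Zs_zero hρ)
  have hm : (0:ℝ) ≤ mult ρ := Nat.cast_nonneg _
  nlinarith [mul_le_mul_of_nonneg_left this hm]

lemma SR_ge_one {η : ℝ} (hη : 0 < η) (hωη : K.ω * η ≤ 1/10) {N : ℕ} (hN : 1 ≤ N) {t g B : ℝ} (hg : 0 < g) (hB : 0 ≤ B)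
    (hP : ∀ ρ, xi ρ = 0 → -(B * ri (((1 + g : ℝ):ℂ) - ρ)) ≤ K.P η (1 - 2 * K.ω * η) N (((1 - K.ω * η : ℝ):ℂ) + (t:ℂ) * I - ρ))
    {β : ℝ} (hβ : 1/2 < β) (h0 : xi ((β:ℂ) + (t:ℂ) * I) = 0) (hz : β ≤ 1 - K.ω * η) (hz2 : K.ω * η ≤ β) :
    K.H η ((1 - K.ω * η - β : ℝ):ℂ) - K.S / √N - (1/2 * B * SR ((1 + g : ℝ):ℂ))
      ≤ K.Phi η (1 - 2 * K.ω * η) N SR (((1 - K.ω * η : ℝ):ℂ) + (t:ℂ) * I) := by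
  have hω := K.hω
  have hwe : 0 ≤ K.ω * η := by positivity
  set θ := 1 - 2 * K.ω * η with hθ
  have hθp : 0.8 ≤ θ := by rw [hθ]; linarith
  set s : ℂ := ((1 - K.ω * η : ℝ):ℂ) + (t:ℂ) * I with hs
  set ρ0 : ℂ := (β:ℂ) + (t:ℂ) * I with hρ0
  have h1 := K.Phi_SR_tendsto hη hωη hN t
  have h2 := Zs_tendsto (s := ((1 + g : ℝ):ℂ)) (xi_ne_zero' (by rw [ofReal_re]; linarith))
  have h3 := h1.add (h2.const_mul (1/2*B))
  suffices hh : K.H η ((1 - K.ω * η - β : ℝ):ℂ) - K.S / √N ≤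
      K.Phi η θ N SR s + 1/2 * B * SR ((1 + g : ℝ):ℂ) by linarith
  refine ge_of_tendsto h3 ?_
  filter_upwards [Zs_ev h0] with n hn
  have hn' := Zs_rfl hn
  rw [Finset.mul_sum, ← Finset.sum_add_distrib]
  have hterm : ∀ ρ ∈ Zs n, 0 ≤ (mult ρ : ℝ) * (1/2 * K.P η θ N (s - ρ)) + 1/2 * B * ((mult ρ : ℝ) * ri (((1 + g : ℝ):ℂ) - ρ)) := by
    intro ρ hρ
    have := hP ρ (Zs_zero hρ)
    have hm : (0:ℝ) ≤ mult ρ := Nat.cast_nonneg _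
    nlinarith [mul_le_mul_of_nonneg_left this hm]
  have hne : ρ0 ≠ rfl' ρ0 := by
    intro h
    have := congrArg re h
    simp [rfl', hρ0] at this
    linarith
  have hsub : ({ρ0, rfl' ρ0} : Finset ℂ) ⊆ Zs n := by
    intro x hx
    simp only [Finset.mem_insert, Finset.mem_singleton] at hx
    rcases hx with rfl | rfl
    · exact hn
    · exact hn'
  refine le_trans ?_ (Finset.sum_le_sum_of_subset_of_nonneg hsub (fun ρ h _ => hterm ρ h))
  rw [Finset.sum_pair hne]
  have hz0 : s - ρ0 = ((1 - K.ω * η - β : ℝ):ℂ) := by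
    rw [hs, hρ0]; push_cast; ring
  have hz1 : s - rfl' ρ0 = (θ:ℂ) - starRingEnd ℂ (s - ρ0) := by
    rw [hs, hθ, hρ0]
    apply Complex.ext <;> simp [rfl'] <;> ring
  have hP1 := K.P_real hη hθp hN (x := 1 - K.ω * η - β) (by linarith) (by rw [hθ]; linarith)
  have hPn := K.strip_pos hη (by linarith : 0 < θ) hN (z := ((1 - K.ω * η - β : ℝ):ℂ)) (by rw [ofReal_re]; linarith) (by rw [ofReal_re, hθ]; linarith)
  rw [hz1, K.P_symm, hz0, mult_rfl']
  have hm : (1:ℝ) ≤ mult ρ0 := by exact_mod_cast mult_pos h0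
  have hr : ∀ ρ, xi ρ = 0 → 0 ≤ ri (((1 + g : ℝ):ℂ) - ρ) := by
    intro ρ hρ
    apply ri_nonneg
    have := (xi_zero_lt hρ).2
    rw [sub_re, ofReal_re]; linarith
  have hr0 := hr _ h0
  have hr1 := hr _ (Zs_zero hn')
  have hx0 : 0 ≤ 1/2 * B * ((mult ρ0 : ℝ) * ri (((1 + g : ℝ):ℂ) - ρ0)) := by positivity
  have hx1 : 0 ≤ 1/2 * B * ((mult ρ0 : ℝ) * ri (((1 + g : ℝ):ℂ) - rfl' ρ0)) := by positivity
  have hx2 := mul_le_mul_of_nonneg_right hm hPn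
  linarith

/-- the error function -/
noncomputable def E (η t : ℝ) : ℝ :=
  1/2 * (1/4 * Real.log (t^2/4 + 5/4) - 1/2 * Real.log Real.pi)
    + K.S * ((0.354 + 9.501 * η) / (t + 1)) + K.S * ((1/2 * (19 * η) + 0.708) / t^2)

noncomputable def E0 (η : ℝ) : ℝ :=
  1/2 * (1/4 * Real.log ((1 + 3/2*η)^2 + 1/4) - 1/2 * Real.log Real.pi) - 1/2 * (1 / (1 + 3 * η))

lemma Phi_decomp {η : ℝ} (hη : 0 < η) (hωη : K.ω * η ≤ 1/10) {N : ℕ} (hN : 1 ≤ N) (t : ℝ) :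
    K.Phi η (1 - 2 * K.ω * η) N ZR (((1 - K.ω * η : ℝ):ℂ) + (t:ℂ) * I) =
    K.Phi η (1 - 2 * K.ω * η) N (fun z => ri (z - 1)) (((1 - K.ω * η : ℝ):ℂ) + (t:ℂ) * I)
    + K.Phi η (1 - 2 * K.ω * η) N GR (((1 - K.ω * η : ℝ):ℂ) + (t:ℂ) * I)
    - K.Phi η (1 - 2 * K.ω * η) N SR (((1 - K.ω * η : ℝ):ℂ) + (t:ℂ) * I) := by
  have hω := K.hω
  have hwe : 0 ≤ K.ω * η := by positivity
  have hNp : (1:ℝ) ≤ N := by exact_mod_cast hN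
  set θ := 1 - 2 * K.ω * η with hθ
  have hθp : 0.8 ≤ θ := by rw [hθ]; linarith
  set s : ℂ := ((1 - K.ω * η : ℝ):ℂ) + (t:ℂ) * I with hs
  have hsre : s.re = 1 - K.ω * η := by simp [hs]
  have h1 := K.Phi_lin (η := η) (θ := θ) (N := N) (fun z => ri (z - 1)) GR s 1 1
  have h2 := K.Phi_lin (η := η) (θ := θ) (N := N) (fun z => 1 * ri (z - 1) + 1 * GR z) SR s 1 (-1)
  have h3 : K.Phi η θ N ZR s = K.Phi η θ N (fun z => 1 * (1 * ri (z - 1) + 1 * GR z) + (-1) * SR z) s := by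
    apply K.Phi_congr (by linarith)
    · intro j x hx
      rw [ZR_decomp]
      · ring
      · have := mul_lt_mul_of_pos_right (K.hlam j) hη
        rw [add_re, add_re, hsre, ofReal_re, ofReal_re]
        linarith
    · rw [ZR_decomp]
      · ring
      · rw [add_re, hsre, ofReal_re]
        nlinarith
  rw [h3, h2, h1]; ring

lemma master {η γ B β : ℝ} (hη : 0 < η) (hωη : K.ω * η ≤ 1/10) (hγ : 0 < γ) (hB : 0 ≤ B)
    (hP : ∀ N : ℕ, 1 ≤ N → ∀ k : Fin 5, ∀ ρ, xi ρ = 0 → -(B * ri (((1 + γ : ℝ):ℂ) - ρ)) ≤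
      K.P η (1 - 2 * K.ω * η) N (((1 - K.ω * η : ℝ):ℂ) + ((k * γ : ℝ):ℂ) * I - ρ))
    (a : Fin 5 → ℝ) (ha0 : ∀ k, 0 ≤ a k) (ha : ∀ φ : ℝ, 0 ≤ ∑ k : Fin 5, a k * Real.cos (k * φ))
    (hβ : 1/2 < β) (h0 : xi ((β:ℂ) + (γ:ℂ) * I) = 0) (hz : β ≤ 1 - K.ω * η) :
    a 1 * K.H η ((1 - K.ω * η - β : ℝ):ℂ) ≤ a 0 * (K.H η ((- K.ω * η : ℝ):ℂ) + E0 η)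
      + (a 1 * K.E η γ + a 2 * K.E η (2 * γ) + a 3 * K.E η (3 * γ) + a 4 * K.E η (4 * γ))
      + (a 0 + a 1 + a 2 + a 3 + a 4) * (1/2 * B * (1 / γ + GR ((1 + γ : ℝ):ℂ))) := by
  have hω := K.hω
  have hS := K.S_nonneg
  have hwe : 0 ≤ K.ω * η := by positivity
  set C := a 0 * (K.S + K.S * √3) + a 1 * (K.S + K.S * √(1 * γ + 3) + K.S) + a 2 * (K.S + K.S * √(2 * γ + 3))
    + a 3 * (K.S + K.S * √(3 * γ + 3)) + a 4 * (K.S + K.S * √(4 * γ + 3)) with hC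
  have hSR : SR ((1 + γ : ℝ):ℂ) ≤ 1 / γ + GR ((1 + γ : ℝ):ℂ) := by
    have h1 := ZR_real_nonneg (x := 1 + γ) (by linarith)
    rw [ZR_decomp (by rw [ofReal_re]; linarith), ← ofReal_one, ← ofReal_sub, ri_ofReal] at h1
    have : 1 + γ - 1 = γ := by ring
    rw [this] at h1
    linarith
  have hBS := mul_le_mul_of_nonneg_left hSR (by positivity : 0 ≤ 1/2 * B)
  set D := 1/2 * B * (1 / γ + GR ((1 + γ : ℝ):ℂ)) with hD
  have key : ∀ N : ℕ, 1 ≤ N → a 1 * K.H η ((1 - K.ω * η - β : ℝ):ℂ) ≤ a 0 * (K.H η ((- K.ω * η : ℝ):ℂ) + E0 η)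
      + (a 1 * K.E η γ + a 2 * K.E η (2 * γ) + a 3 * K.E η (3 * γ) + a 4 * K.E η (4 * γ))
      + (a 0 + a 1 + a 2 + a 3 + a 4) * D + C / √N := by
    intro N hN
    have hNp : (1:ℝ) ≤ N := by exact_mod_cast hN
    have hZ := K.Z_pos (N := N) (θ := 1 - 2 * K.ω * η) (σ := 1 - K.ω * η) hη (by linarith)
      (fun j => by have := mul_lt_mul_of_pos_right (K.hlam j) hη; linarith) (by nlinarith) a ha γ
    simp only [K.Phi_decomp hη hωη hN] at hZ
    rw [Fin.sum_univ_five] at hZ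
    have c0 : (((0 : Fin 5) : ℕ) : ℝ) = 0 := by simp
    have c1 : (((1 : Fin 5) : ℕ) : ℝ) = 1 := by simp
    have c2 : (((2 : Fin 5) : ℕ) : ℝ) = 2 := by simp
    have c3 : (((3 : Fin 5) : ℕ) : ℝ) = 3 := by simp
    have c4 : (((4 : Fin 5) : ℕ) : ℝ) = 4 := by simp
    have S0 := K.SR_ge hη hωη hN hγ (hP N hN 0)
    have S1 := K.SR_ge_one hη hωη hN hγ hB (hP N hN 1) hβ (by rw [c1, one_mul]; exact h0) hz (by linarith)
    have S2 := K.SR_ge hη hωη hN hγ (hP N hN 2)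
    have S3 := K.SR_ge hη hωη hN hγ (hP N hN 3)
    have S4 := K.SR_ge hη hωη hN hγ (hP N hN 4)
    rw [c0] at S0; rw [c1] at S1; rw [c2] at S2; rw [c3] at S3; rw [c4] at S4
    rw [c0, c1, c2, c3, c4] at hZ
    have p0 := K.pole_zero hη hωη hN
    have g0 := K.arch_zero hη hωη hN
    have p1 := K.pole_k hη hωη hN (t := 1 * γ) (by positivity)
    have g1 := K.arch_k hη hωη hN (t := 1 * γ) (by positivity)
    have p2 := K.pole_k hη hωη hN (t := 2 * γ) (by positivity)
    have g2 := K.arch_k hη hωη hN (t := 2 * γ) (by positivity)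
    have p3 := K.pole_k hη hωη hN (t := 3 * γ) (by positivity)
    have g3 := K.arch_k hη hωη hN (t := 3 * γ) (by positivity)
    have p4 := K.pole_k hη hωη hN (t := 4 * γ) (by positivity)
    have g4 := K.arch_k hη hωη hN (t := 4 * γ) (by positivity)
    have ez : ((1 - K.ω * η : ℝ):ℂ) + ((0 * γ : ℝ):ℂ) * I = ((1 - K.ω * η : ℝ):ℂ) := by simp
    rw [ez] at hZ S0
    set q0 := K.Phi η (1 - 2 * K.ω * η) N (fun z => ri (z - 1)) ((1 - K.ω * η : ℝ):ℂ)
    set q1 := K.Phi η (1 - 2 * K.ω * η) N (fun z => ri (z - 1)) (((1 - K.ω * η : ℝ):ℂ) + ((1 * γ : ℝ):ℂ) * I)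
    set q2 := K.Phi η (1 - 2 * K.ω * η) N (fun z => ri (z - 1)) (((1 - K.ω * η : ℝ):ℂ) + ((2 * γ : ℝ):ℂ) * I)
    set q3 := K.Phi η (1 - 2 * K.ω * η) N (fun z => ri (z - 1)) (((1 - K.ω * η : ℝ):ℂ) + ((3 * γ : ℝ):ℂ) * I)
    set q4 := K.Phi η (1 - 2 * K.ω * η) N (fun z => ri (z - 1)) (((1 - K.ω * η : ℝ):ℂ) + ((4 * γ : ℝ):ℂ) * I)
    set r0 := K.Phi η (1 - 2 * K.ω * η) N GR ((1 - K.ω * η : ℝ):ℂ)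
    set r1 := K.Phi η (1 - 2 * K.ω * η) N GR (((1 - K.ω * η : ℝ):ℂ) + ((1 * γ : ℝ):ℂ) * I)
    set r2 := K.Phi η (1 - 2 * K.ω * η) N GR (((1 - K.ω * η : ℝ):ℂ) + ((2 * γ : ℝ):ℂ) * I)
    set r3 := K.Phi η (1 - 2 * K.ω * η) N GR (((1 - K.ω * η : ℝ):ℂ) + ((3 * γ : ℝ):ℂ) * I)
    set r4 := K.Phi η (1 - 2 * K.ω * η) N GR (((1 - K.ω * η : ℝ):ℂ) + ((4 * γ : ℝ):ℂ) * I)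
    set s0 := K.Phi η (1 - 2 * K.ω * η) N SR ((1 - K.ω * η : ℝ):ℂ)
    set s1 := K.Phi η (1 - 2 * K.ω * η) N SR (((1 - K.ω * η : ℝ):ℂ) + ((1 * γ : ℝ):ℂ) * I)
    set s2 := K.Phi η (1 - 2 * K.ω * η) N SR (((1 - K.ω * η : ℝ):ℂ) + ((2 * γ : ℝ):ℂ) * I)
    set s3 := K.Phi η (1 - 2 * K.ω * η) N SR (((1 - K.ω * η : ℝ):ℂ) + ((3 * γ : ℝ):ℂ) * I)
    set s4 := K.Phi η (1 - 2 * K.ω * η) N SR (((1 - K.ω * η : ℝ):ℂ) + ((4 * γ : ℝ):ℂ) * I)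
    have t0 := mul_le_mul_of_nonneg_left (show q0 + r0 - s0 ≤ K.H η ((- K.ω * η : ℝ):ℂ) + E0 η + D + (K.S + K.S * √3) / √N by
      rw [add_div]; unfold E0; linarith) (ha0 0)
    have t1 := mul_le_mul_of_nonneg_left (show q1 + r1 - s1 ≤ K.E η (1 * γ) + D - K.H η ((1 - K.ω * η - β : ℝ):ℂ) + (K.S + K.S * √(1 * γ + 3) + K.S) / √N by
      rw [add_div, add_div]; unfold E; linarith) (ha0 1)
    have t2 := mul_le_mul_of_nonneg_left (show q2 + r2 - s2 ≤ K.E η (2 * γ) + D + (K.S + K.S * √(2 * γ + 3)) / √N by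
      rw [add_div]; unfold E; linarith) (ha0 2)
    have t3 := mul_le_mul_of_nonneg_left (show q3 + r3 - s3 ≤ K.E η (3 * γ) + D + (K.S + K.S * √(3 * γ + 3)) / √N by
      rw [add_div]; unfold E; linarith) (ha0 3)
    have t4 := mul_le_mul_of_nonneg_left (show q4 + r4 - s4 ≤ K.E η (4 * γ) + D + (K.S + K.S * √(4 * γ + 3)) / √N by
      rw [add_div]; unfold E; linarith) (ha0 4)
    have hCe : C / √N = a 0 * ((K.S + K.S * √3) / √N) + a 1 * ((K.S + K.S * √(1 * γ + 3) + K.S) / √N)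
      + a 2 * ((K.S + K.S * √(2 * γ + 3)) / √N)
      + a 3 * ((K.S + K.S * √(3 * γ + 3)) / √N) + a 4 * ((K.S + K.S * √(4 * γ + 3)) / √N) := by rw [hC]; ring
    have e1 : K.E η (1 * γ) = K.E η γ := by rw [one_mul]
    rw [e1] at t1
    rw [hCe]
    linarith
  have ht : Tendsto (fun N : ℕ => C / √(N:ℝ)) atTop (𝓝 0) :=
    Tendsto.div_atTop tendsto_const_nhds (Real.tendsto_sqrt_atTop.comp tendsto_natCast_atTop_atTop)
  have ht2 := ht.const_add (a 0 * (K.H η ((- K.ω * η : ℝ):ℂ) + E0 η)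
      + (a 1 * K.E η γ + a 2 * K.E η (2 * γ) + a 3 * K.E η (3 * γ) + a 4 * K.E η (4 * γ))
      + (a 0 + a 1 + a 2 + a 3 + a 4) * D)
  rw [add_zero] at ht2
  refine ge_of_tendsto ht2 ?_
  filter_upwards [eventually_ge_atTop 1] with N hN
  exact key N hN

end Ker
end ZFR

namespace ZFR
open Complex Set Filter Topology MeasureTheory

/-- the one-term kernel -/
noncomputable def KA : Ker 1 where
  c := ![1]
  lam := ![3]
  ω := 0
  S := 1
  hω := le_rfl
  hlam := by intro j; fin_cases j; simp
  hΛ := by intro j; fin_cases j; norm_num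
  hS := by simp
  hc := by simp
  hh := by intro u _; simp; positivity
  hb := by intro y; simp; positivity
  hμ := by intro x _; simp

/-- the five-term kernel -/
noncomputable def KB (ω : ℝ) (h0 : 0 ≤ ω) (h1 : ω ≤ 1) : Ker 5 where
  c := ![21, -67.9, 94.8, -63.7, 16.8]
  lam := ![7, 10, 13, 16, 19]
  ω := ω
  S := 264.2
  hω := h0
  hlam := by
    intro j
    fin_cases j <;> simp <;> linarith
  hΛ := by
    intro j
    fin_cases j <;> simp <;> norm_num
  hS := by
    rw [Fin.sum_univ_five]
    simp
    norm_num [abs_of_nonneg]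
  hc := by
    rw [Fin.sum_univ_five]
    simp
    norm_num
  hh := by
    intro u hu
    rw [Fin.sum_univ_five]
    simp only [Matrix.cons_val]
    set r := Real.exp (-3 * u) with hr
    have e7 : Real.exp (-7 * u) = Real.exp (-7 * u) := rfl
    have e10 : Real.exp (-10 * u) = Real.exp (-7 * u) * r := by
      rw [hr, ← Real.exp_add]; congr 1; ring
    have e13 : Real.exp (-13 * u) = Real.exp (-7 * u) * r^2 := by
      rw [hr, ← Real.exp_nat_mul, ← Real.exp_add]; congr 1; push_cast; ring
    have e16 : Real.exp (-16 * u) = Real.exp (-7 * u) * r^3 := by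
      rw [hr, ← Real.exp_nat_mul, ← Real.exp_add]; congr 1; push_cast; ring
    have e19 : Real.exp (-19 * u) = Real.exp (-7 * u) * r^4 := by
      rw [hr, ← Real.exp_nat_mul, ← Real.exp_add]; congr 1; push_cast; ring
    rw [e10, e13, e16, e19]
    have hp : 0 ≤ 21 - 67.9 * r + 94.8 * r^2 - 63.7 * r^3 + 16.8 * r^4 := by
      nlinarith [sq_nonneg (r^2 - 63.7/33.6*r + 0.8), sq_nonneg (r - 1.1237)]
    have := mul_nonneg (Real.exp_pos (-7 * u)).le hp
    linarith
  hb := by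
    intro y
    rw [Fin.sum_univ_five]
    simp only [Matrix.cons_val]
    set Y := y^2 with hY
    have hYn : 0 ≤ Y := sq_nonneg y
    have hp : 0 ≤ 0.4*Y^4 - 1520.6*Y^3 + 1921725.6*Y^2 - 454939441.4*Y + 31015050976 := by
      nlinarith [sq_nonneg (Y^2 - 1900.75*Y + 240000), sq_nonneg (Y - 158.1)]
    have e : 21 * (7 / (7^2 + Y)) + -67.9 * (10 / (10^2 + Y)) + 94.8 * (13 / (13^2 + Y)) + -63.7 * (16 / (16^2 + Y))
        + 16.8 * (19 / (19^2 + Y)) = (0.4*Y^4 - 1520.6*Y^3 + 1921725.6*Y^2 - 454939441.4*Y + 31015050976) /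
        ((7^2 + Y) * (10^2 + Y) * (13^2 + Y) * (16^2 + Y) * (19^2 + Y)) := by
      field_simp
      ring
    rw [e]
    positivity
  hμ := by
    intro x hx
    rw [Fin.sum_univ_five]
    simp only [Matrix.cons_val]
    have e : 21 / (x + 7) + -67.9 / (x + 10) + 94.8 / (x + 13) + -63.7 / (x + 16) + 16.8 / (x + 19) - 1 / (x + 3) =
      (2.6 * x^4 + 185.6 * x^3 + 3514.8 * x^2 + 48257.6 * x + 59700.2) /
        ((x + 3) * (x + 7) * (x + 10) * (x + 13) * (x + 16) * (x + 19)) := by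
      field_simp
      ring
    have : 0 ≤ (2.6 * x^4 + 185.6 * x^3 + 3514.8 * x^2 + 48257.6 * x + 59700.2) /
        ((x + 3) * (x + 7) * (x + 10) * (x + 13) * (x + 16) * (x + 19)) := by positivity
    linarith

/-- coefficients of the trigonometric polynomial -/
noncomputable def av : Fin 5 → ℝ := ![1.4379, 2.448, 1.49, 0.6, 0.125]

lemma av_nonneg : ∀ k, 0 ≤ av k := by
  intro k
  fin_cases k <;> simp [av] <;> norm_num

lemma av_pos (φ : ℝ) : 0 ≤ ∑ k : Fin 5, av k * Real.cos (k * φ) := by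
  rw [Fin.sum_univ_five]
  have c2 : Real.cos (2 * φ) = 2 * Real.cos φ ^ 2 - 1 := Real.cos_two_mul φ
  have c3 : Real.cos (3 * φ) = 4 * Real.cos φ ^ 3 - 3 * Real.cos φ := Real.cos_three_mul φ
  have c4 : Real.cos (4 * φ) = 2 * (2 * Real.cos φ ^ 2 - 1) ^ 2 - 1 := by
    rw [← c2, ← Real.cos_two_mul]; congr 1; ring
  have e0 : (((0 : Fin 5) : ℕ) : ℝ) = 0 := by simp
  have e1 : (((1 : Fin 5) : ℕ) : ℝ) = 1 := by simp
  have e2 : (((2 : Fin 5) : ℕ) : ℝ) = 2 := by simp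
  have e3 : (((3 : Fin 5) : ℕ) : ℝ) = 3 := by simp
  have e4 : (((4 : Fin 5) : ℕ) : ℝ) = 4 := by simp
  rw [e0, e1, e2, e3, e4, zero_mul, one_mul, Real.cos_zero, c2, c3, c4]
  simp only [av, Matrix.cons_val]
  have := sq_nonneg (Real.cos φ ^ 2 + 1.2 * Real.cos φ + 0.27)
  nlinarith

lemma log_pi_gt : 1.14 ≤ Real.log Real.pi := by
  rw [Real.le_log_iff_exp_le Real.pi_pos]
  have h1 : Real.exp 1.14 = Real.exp 1 * Real.exp 0.0175 ^ 8 := by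
    rw [← Real.exp_nat_mul, ← Real.exp_add]; norm_num
  have h2 : Real.exp 0.0175 ≤ 1 / (1 - 0.0175) := Real.exp_bound_div_one_sub_of_interval (by norm_num) (by norm_num)
  have h3 : Real.exp 0.0175 ^ 8 ≤ (1 / (1 - 0.0175))^8 := pow_le_pow_left₀ (Real.exp_pos _).le h2 8
  have h4 := Real.exp_one_lt_d9
  have h5 := Real.pi_gt_d4
  rw [h1]
  calc Real.exp 1 * Real.exp 0.0175 ^ 8 ≤ 2.7182818286 * (1 / (1 - 0.0175))^8 := by
        apply mul_le_mul h4.le h3 (by positivity) (by norm_num)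
    _ ≤ Real.pi := by
        refine le_trans ?_ h5.le
        norm_num

lemma log_quad_le {γ k : ℝ} (hγ : 0 < γ) (hk : 0 < k) :
    Real.log ((k * γ)^2/4 + 5/4) ≤ 2 * Real.log γ + 2 * Real.log (k / 2) + 5 / (k * γ)^2 := by
  have e : (k * γ)^2/4 + 5/4 = γ^2 * (k/2)^2 * (1 + 5 / (k * γ)^2) := by
    field_simp
    ring
  rw [e, Real.log_mul (by positivity) (by positivity), Real.log_mul (by positivity) (by positivity), Real.log_pow, Real.log_pow]
  have := Real.log_le_sub_one_of_pos (x := 1 + 5 / (k * γ)^2) (by positivity)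
  push_cast
  linarith

/-- explicit rational majorant of the error terms -/
noncomputable def eb (S η g k l : ℝ) : ℝ :=
  l / 4 + 5/8 / (k * g)^2 - 1.14 / 4 + S * ((0.354 + 9.501 * η) / (k * g + 1)) + S * ((9.5 * η + 0.708) / (k * g)^2)

lemma E_le {n : ℕ} (K : Ker n) {η η1 γ g k l : ℝ} (hη : 0 < η) (h1 : η ≤ η1) (hg : 0 < g) (h2 : g ≤ γ) (hk : 0 < k)
    (hl : Real.log (k / 2) ≤ l) : K.E η (k * γ) ≤ Real.log γ / 4 + eb K.S η1 g k l := by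
  have hS := K.S_nonneg
  have hγ : 0 < γ := by linarith
  have h3 := log_quad_le hγ hk
  have h4 := log_pi_gt
  have h5 : k * g ≤ k * γ := by gcongr
  have hη1 : 0 < η1 := by linarith
  have h50 : 0 < k * g := by positivity
  have h6 : 5/8 / (k * γ)^2 ≤ 5/8 / (k * g)^2 := by gcongr
  have h7 : (0.354 + 9.501 * η) / (k * γ + 1) ≤ (0.354 + 9.501 * η1) / (k * g + 1) := by gcongr
  have h8 : (1/2 * (19 * η) + 0.708) / (k * γ)^2 ≤ (9.5 * η1 + 0.708) / (k * g)^2 := by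
    apply div_le_div₀ (by positivity) (by linarith) (by positivity)
    gcongr
  have h7' := mul_le_mul_of_nonneg_left h7 hS
  have h8' := mul_le_mul_of_nonneg_left h8 hS
  have e : 5 / (k * γ)^2 = 8 * (5/8 / (k * γ)^2) := by ring
  unfold Ker.E eb
  linarith

lemma E0_le {η η1 : ℝ} (hη : 0 < η) (h1 : η ≤ η1) :
    Ker.E0 η ≤ 1/8 * (1/4 + 3 * η1 + 2.25 * η1^2) - 1.14 / 4 - 1/2 / (1 + 3 * η1) := by
  have h4 := log_pi_gt
  have h2 := Real.log_le_sub_one_of_pos (x := (1 + 3/2*η)^2 + 1/4) (by positivity)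
  have h3 : 1/2 / (1 + 3 * η1) ≤ 1/2 / (1 + 3 * η) := by gcongr
  have e : 1/2 * (1 / (1 + 3 * η)) = 1/2 / (1 + 3 * η) := by ring
  unfold Ker.E0
  rw [e]
  nlinarith

noncomputable def cb (S η1 g : ℝ) : ℝ :=
  1.4379 * (1/8 * (1/4 + 3 * η1 + 2.25 * η1^2) - 1.14 / 4 - 1/2 / (1 + 3 * η1)) +
  (2.448 * eb S η1 g 1 (-0.6931) + 1.49 * eb S η1 g 2 0 + 0.6 * eb S η1 g 3 0.41 + 0.125 * eb S η1 g 4 0.6932)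

lemma log_two_le : Real.log 2 ≤ 0.6932 := by have := Real.log_two_lt_d9; linarith
lemma log_two_ge : 0.6931 ≤ Real.log 2 := by have := Real.log_two_gt_d9; linarith

lemma tot_le {n : ℕ} (K : Ker n) {η η1 γ g : ℝ} (hη : 0 < η) (h1 : η ≤ η1) (hg : 0 < g) (h2 : g ≤ γ) :
    av 0 * Ker.E0 η + (av 1 * K.E η γ + av 2 * K.E η (2 * γ) + av 3 * K.E η (3 * γ) + av 4 * K.E η (4 * γ)) ≤
    1.16575 * Real.log γ + cb K.S η1 g := by
  have t0 := E0_le hη h1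
  have t1 := E_le K hη h1 hg h2 (k := 1) (l := -0.6931) (by norm_num) (by
    rw [Real.log_div (by norm_num) (by norm_num), Real.log_one]; have := log_two_ge; linarith)
  have t2 := E_le K hη h1 hg h2 (k := 2) (l := 0) (by norm_num) (by norm_num)
  have t3 := E_le K hη h1 hg h2 (k := 3) (l := 0.41) (by norm_num) (by
    have e : Real.log ((3/2)^2) = 2 * Real.log (3/2) := by rw [Real.log_pow]; norm_num
    have e2 : ((3:ℝ)/2)^2 = 2 * (9/8) := by norm_num
    rw [e2, Real.log_mul (by norm_num) (by norm_num)] at e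
    have := Real.log_le_sub_one_of_pos (x := 9/8) (by norm_num)
    have := log_two_le
    linarith)
  have t4 := E_le K hη h1 hg h2 (k := 4) (l := 0.6932) (by norm_num) (by
    have := log_two_le
    norm_num at this ⊢; exact this)
  rw [one_mul] at t1
  simp only [av, Matrix.cons_val]
  unfold cb
  linarith

end ZFR

namespace ZFR
open Complex Set Filter Topology MeasureTheory

namespace Ker
variable {n : ℕ} (K : Ker n)

noncomputable def V1 : ℝ := ∑ j, K.c j / (1 - K.ω + K.lam j)
noncomputable def V0 : ℝ := ∑ j, K.c j / (K.lam j - K.ω)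

lemma H_V1 (η : ℝ) : K.H η (((1 - K.ω) * η : ℝ):ℂ) = K.V1 * (1 / η) := by
  rw [H_ofReal, V1, Finset.sum_mul]
  apply Finset.sum_congr rfl
  intro j _
  rw [← add_mul, div_mul_eq_div_div, mul_one_div]

lemma H_V0 (η : ℝ) : K.H η ((-K.ω * η : ℝ):ℂ) = K.V0 * (1 / η) := by
  rw [H_ofReal, V0, Finset.sum_mul]
  apply Finset.sum_congr rfl
  intro j _
  have : -K.ω * η + K.lam j * η = (K.lam j - K.ω) * η := by ring
  rw [this, div_mul_eq_div_div, mul_one_div]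

lemma core {η η1 γ g B β : ℝ} (hη : 0 < η) (hωη : K.ω * η ≤ 1/10) (hg : 0 < g) (hgγ : g ≤ γ) (hη1 : η ≤ η1) (hB : 0 ≤ B)
    (hP : ∀ N : ℕ, 1 ≤ N → ∀ k : Fin 5, ∀ ρ, xi ρ = 0 → -(B * ri (((1 + γ : ℝ):ℂ) - ρ)) ≤
      K.P η (1 - 2 * K.ω * η) N (((1 - K.ω * η : ℝ):ℂ) + ((k * γ : ℝ):ℂ) * I - ρ))
    (hβ : 1/2 < β) (h0 : xi ((β:ℂ) + (γ:ℂ) * I) = 0) (hz : β ≤ 1 - K.ω * η) (hβη : 1 - η ≤ β) :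
    (2.448 * K.V1 - 1.4379 * K.V0) * (1 / η) ≤ 1.16575 * Real.log γ + cb K.S η1 g
      + 6.1009 * (1/2 * B * (1 / γ + GR ((1 + γ : ℝ):ℂ))) := by
  have hγ : 0 < γ := by linarith
  have h1 := K.master hη hωη hγ hB hP av av_nonneg av_pos hβ h0 hz
  have h2 := tot_le K hη hη1 hg hgγ
  have h3 := K.H_anti hη (x := 1 - K.ω * η - β) (y := (1 - K.ω) * η) (by
    have : 0 ≤ K.ω * η := mul_nonneg K.hω hη.le
    linarith) (by linarith)
  rw [H_V1] at h3
  rw [H_V0] at h1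
  have a0 : av 0 = 1.4379 := by simp [av]
  have a1 : av 1 = 2.448 := by simp [av]
  have a2 : av 2 = 1.49 := by simp [av]
  have a3 : av 3 = 0.6 := by simp [av]
  have a4 : av 4 = 0.125 := by simp [av]
  rw [a0, a1, a2, a3, a4] at h1 h2
  have h4 := mul_le_mul_of_nonneg_left h3 (by norm_num : (0:ℝ) ≤ 2.448)
  have e : (1.4379:ℝ) + 2.448 + 1.49 + 0.6 + 0.125 = 6.1009 := by norm_num
  rw [e] at h1
  linarith

lemma step (hω : K.ω = 0) {γ β r L1 g v : ℝ} (hr : 0 < r) (hL1 : 0 < L1) (hg : 0 < g) (hgγ : g ≤ γ) (hL : L1 ≤ Real.log γ)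
    (hv : v ≤ 2.448 * K.V1 - 1.4379 * K.V0) (hh : 1 / (r * L1) < 1/2)
    (h0 : xi ((β:ℂ) + (γ:ℂ) * I) = 0) (hβ : 1 - 1 / (r * Real.log γ) ≤ β)
    (hnum : 1.16575 * Real.log γ + cb K.S (1 / (r * L1)) g < v * (r * Real.log γ)) : False := by
  have hLp : 0 < Real.log γ := by linarith
  have hη : 0 < 1 / (r * Real.log γ) := by positivity
  have hη1 : 1 / (r * Real.log γ) ≤ 1 / (r * L1) := by gcongr
  have hlt := xi_zero_lt h0
  have hre : ((β:ℂ) + (γ:ℂ) * I).re = β := by simp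
  rw [hre] at hlt
  have h1 := K.core (B := 0) (η := 1 / (r * Real.log γ)) hη (by rw [hω]; norm_num) hg hgγ hη1 le_rfl (by
    intro N hN k ρ hρ
    rw [zero_mul, neg_zero]
    have := xi_zero_lt hρ
    apply K.strip_pos hη (by rw [hω]; norm_num) hN
    · rw [hω]; simp; linarith
    · rw [hω]; simp; linarith) (by linarith) h0 (by rw [hω]; linarith) hβ
  rw [one_div_one_div] at h1
  have h2 := mul_le_mul_of_nonneg_right hv (by positivity : 0 ≤ r * Real.log γ)
  linarith

end Ker

lemma KA_V : (0.1327:ℝ) ≤ 2.448 * KA.V1 - 1.4379 * KA.V0 := by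
  simp [Ker.V1, Ker.V0, KA]
  norm_num

noncomputable def KB0 : Ker 5 := KB 0 le_rfl zero_le_one
noncomputable def KB1 : Ker 5 := KB 0.85 (by norm_num) (by norm_num)

lemma KB0_V : (0.1924056:ℝ) ≤ 2.448 * KB0.V1 - 1.4379 * KB0.V0 := by
  simp only [Ker.V1, Ker.V0, KB0, KB, Fin.sum_univ_five, Matrix.cons_val]
  norm_num

lemma KB1_V : (0.2097:ℝ) ≤ 2.448 * KB1.V1 - 1.4379 * KB1.V0 := by
  simp only [Ker.V1, Ker.V0, KB1, KB, Fin.sum_univ_five, Matrix.cons_val]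
  norm_num

lemma exp_lb (n : ℕ) {L γ : ℝ} (hγ : 0 < γ) (hL : (n:ℝ) ≤ L) (h : L = Real.log γ) : (2.718281828:ℝ)^n ≤ γ := by
  have h1 := Real.exp_one_gt_d9
  have h2 : (2.718281828:ℝ)^n ≤ Real.exp 1 ^ n := pow_le_pow_left₀ (by norm_num) (by linarith) n
  rw [← Real.exp_nat_mul, mul_one] at h2
  have h3 : Real.exp n ≤ γ := by
    rw [← Real.exp_log hγ, ← h]
    exact Real.exp_le_exp.mpr hL
  linarith

lemma zI {β γ : ℝ} (hγ : 4.5 ≤ γ) (hL : Real.log γ ≤ 6) (h0 : xi ((β:ℂ) + (γ:ℂ) * I) = 0)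
    (hβ : 1 - 1 / (5.573412 * Real.log γ) ≤ β) : False := by
  have hγ0 : 0 < γ := by linarith
  have hl : 1.5 ≤ Real.log γ := by
    have h1 := Real.exp_one_lt_d9
    have h2 : Real.exp 1.5 ≤ 4.5 := by
      have h3 : Real.exp 1.5 ^ 2 = Real.exp 1 ^ 3 := by
        rw [← Real.exp_nat_mul, ← Real.exp_nat_mul]; norm_num
      have h4 : Real.exp 1 ^ 3 ≤ 2.7182818286 ^ 3 := pow_le_pow_left₀ (Real.exp_pos _).le h1.le 3
      refine le_of_sq_le_sq ?_ (by norm_num)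
      rw [h3]
      refine h4.trans ?_
      norm_num
    rw [Real.le_log_iff_exp_le hγ0]
    linarith
  rcases le_total (Real.log γ) 2.5 with h | h
  · refine KA.step rfl (r := 5.573412) (L1 := 1.5) (g := 4.5) (by norm_num) (by norm_num) (by norm_num) hγ hl KA_V (by norm_num) h0 hβ ?_
    have : cb KA.S (1 / (5.573412 * 1.5)) 4.5 ≤ -1.1 := by
      simp only [KA, cb, eb]; norm_num
    linarith
  have hg : 12 ≤ γ := by
    have h1 := Real.exp_one_gt_d9
    have h3 : Real.exp 2.5 ^ 2 = Real.exp 1 ^ 5 := by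
      rw [← Real.exp_nat_mul, ← Real.exp_nat_mul]; norm_num
    have h4 : (2.7182818283:ℝ) ^ 5 ≤ Real.exp 1 ^ 5 := pow_le_pow_left₀ (by norm_num) h1.le 5
    have h5 : 12 ≤ Real.exp 2.5 := by
      refine le_of_sq_le_sq ?_ (Real.exp_pos _).le
      rw [h3]
      refine le_trans ?_ h4
      norm_num
    rw [Real.le_log_iff_exp_le hγ0] at h
    linarith
  rcases le_total (Real.log γ) 5 with h' | h'
  · refine KA.step rfl (r := 5.573412) (L1 := 2.5) (g := 12) (by norm_num) (by norm_num) (by norm_num) hg h KA_V (by norm_num) h0 hβ ?_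
    have : cb KA.S (1 / (5.573412 * 2.5)) 12 ≤ -2.2 := by
      simp only [KA, cb, eb]; norm_num
    linarith
  have hg : 148 ≤ γ := by
    have := exp_lb 5 hγ0 (by exact_mod_cast h') rfl
    norm_num at this ⊢
    linarith
  · refine KA.step rfl (r := 5.573412) (L1 := 5) (g := 148) (by norm_num) (by norm_num) (by norm_num) hg h' KA_V (by norm_num) h0 hβ ?_
    have : cb KA.S (1 / (5.573412 * 5)) 148 ≤ -2.6 := by
      simp only [KA, cb, eb]; norm_num
    linarith

lemma zII {β γ : ℝ} (hγ : 0 < γ) (hL6 : 6 ≤ Real.log γ) (hL : Real.log γ ≤ 24) (h0 : xi ((β:ℂ) + (γ:ℂ) * I) = 0)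
    (hβ : 1 - 1 / (5.573412 * Real.log γ) ≤ β) : False := by
  rcases le_total (Real.log γ) 12 with h | h
  · have hg : 403 ≤ γ := by
      have := exp_lb 6 hγ (by exact_mod_cast hL6) rfl
      norm_num at this ⊢
      linarith
    refine KB0.step rfl (r := 5.573412) (L1 := 6) (g := 403) (by norm_num) (by norm_num) (by norm_num) hg hL6 KB0_V (by norm_num) h0 hβ ?_
    have : cb KB0.S (1 / (5.573412 * 6)) 403 ≤ -1.2 := by
      simp only [KB0, KB, cb, eb]; norm_num
    linarith
  · have hg : 160000 ≤ γ := by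
      have := exp_lb 12 hγ (by exact_mod_cast h) rfl
      norm_num at this ⊢
      linarith
    refine KB0.step rfl (r := 5.573412) (L1 := 12) (g := 160000) (by norm_num) (by norm_num) (by norm_num) hg h KB0_V (by norm_num) h0 hβ ?_
    have : cb KB0.S (1 / (5.573412 * 12)) 160000 ≤ -2.6 := by
      simp only [KB0, KB, cb, eb]; norm_num
    linarith

lemma zC {β γ : ℝ} (hγ : 0 < γ) (hL6 : 6 ≤ Real.log γ) (h0 : xi ((β:ℂ) + (γ:ℂ) * I) = 0)
    (hβ : 1 - 1 / (6.06 * Real.log γ) ≤ β) : False := by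
  have hg : 403 ≤ γ := by
    have := exp_lb 6 hγ (by exact_mod_cast hL6) rfl
    norm_num at this ⊢
    linarith
  refine KB0.step rfl (r := 6.06) (L1 := 6) (g := 403) (by norm_num) (by norm_num) (by norm_num) hg hL6 KB0_V (by norm_num) h0 hβ ?_
  have : cb KB0.S (1 / (6.06 * 6)) 403 ≤ -1.2 := by
    simp only [KB0, KB, cb, eb]; norm_num
  linarith

end ZFR

namespace ZFR
open Complex Set Filter Topology MeasureTheory

lemma SR3_le : SR ((3:ℝ):ℂ) ≤ 0.2923 := by
  have h1 := ZR_real_nonneg (x := 3) (by norm_num)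
  rw [ZR_decomp (by rw [ofReal_re]; norm_num), ← ofReal_one, ← ofReal_sub, ri_ofReal] at h1
  have h2 := G_re_le (s := ((3:ℝ):ℂ)) (by rw [ofReal_re]; norm_num)
  rw [ofReal_re, ofReal_im] at h2
  have h3 : Real.log (((3 + 1) / 2)^2 + (0/2)^2 + 1/4) ≤ 1.4489 := by
    have e : (((3 + 1) / 2)^2 + (0/2)^2 + 1/4 : ℝ) = 2 * 2 * 1.0625 := by norm_num
    rw [e, Real.log_mul (by norm_num) (by norm_num), Real.log_mul (by norm_num) (by norm_num)]
    have := Real.log_le_sub_one_of_pos (x := 1.0625) (by norm_num)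
    have := log_two_le
    linarith
  have h4 := log_pi_gt
  unfold GR at h1
  have e2 : (1:ℝ) / (3 - 1) = 1/2 := by norm_num
  rw [e2] at h1
  linarith

lemma SR3_ge (A : Finset ℂ) (hA : ∀ ρ ∈ A, xi ρ = 0) : ∑ ρ ∈ A, ri (((3:ℝ):ℂ) - ρ) ≤ SR ((3:ℝ):ℂ) := by
  have h2 := Zs_tendsto (s := ((3:ℝ):ℂ)) (xi_ne_zero' (by rw [ofReal_re]; norm_num))
  refine ge_of_tendsto h2 ?_
  have hev : ∀ᶠ n in atTop, ∀ ρ ∈ A, ρ ∈ Zs n := by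
    rw [Filter.eventually_all_finset]
    intro ρ hρ
    exact Zs_ev (hA ρ hρ)
  filter_upwards [hev] with n hn
  have hr : ∀ ρ, xi ρ = 0 → 0 ≤ ri (((3:ℝ):ℂ) - ρ) := by
    intro ρ hρ
    apply ri_nonneg
    have := (xi_zero_lt hρ).2
    rw [sub_re, ofReal_re]; linarith
  calc ∑ ρ ∈ A, ri (((3:ℝ):ℂ) - ρ) ≤ ∑ ρ ∈ A, (mult ρ : ℝ) * ri (((3:ℝ):ℂ) - ρ) := by
        apply Finset.sum_le_sum
        intro ρ hρ
        have hm : (1:ℝ) ≤ mult ρ := by exact_mod_cast mult_pos (hA ρ hρ)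
        nlinarith [hr ρ (hA ρ hρ)]
    _ ≤ _ := by
        apply Finset.sum_le_sum_of_subset_of_nonneg hn
        intro ρ hρ _
        exact mul_nonneg (Nat.cast_nonneg _) (hr ρ (Zs_zero hρ))

lemma frac_ge {x c y b : ℝ} (hc : 0 < c) (hcx : c ≤ x) (hxb : x * c ≤ b) (hy : y^2 ≤ b) :
    c / (c^2 + b) ≤ x / (x^2 + y^2) := by
  have hx : 0 < x := by linarith
  have hb : 0 < b := lt_of_lt_of_le (by positivity) hxb
  rw [div_le_div_iff₀ (by positivity) (by positivity)]
  nlinarith [mul_nonneg (sub_nonneg.mpr hcx) (sub_nonneg.mpr hxb), mul_le_mul_of_nonneg_left hy hc.le]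

lemma pair_ge {β γ b : ℝ} (h1 : 1/2 < β) (h2 : β < 1) (hb : 7.5 ≤ b) (hγ : γ^2 ≤ b) :
    2 / (2^2 + b) + 2.5 / (2.5^2 + b) ≤ ri (((3:ℝ):ℂ) - ((β:ℂ) + (γ:ℂ) * I)) + ri (((3:ℝ):ℂ) - rfl' ((β:ℂ) + (γ:ℂ) * I)) := by
  rw [ri_eq, ri_eq]
  have e1 : (((3:ℝ):ℂ) - ((β:ℂ) + (γ:ℂ) * I)).re = 3 - β := by simp
  have e2 : (((3:ℝ):ℂ) - ((β:ℂ) + (γ:ℂ) * I)).im = -γ := by simp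
  have e3 : (((3:ℝ):ℂ) - rfl' ((β:ℂ) + (γ:ℂ) * I)).re = 2 + β := by simp [rfl']; ring
  have e4 : (((3:ℝ):ℂ) - rfl' ((β:ℂ) + (γ:ℂ) * I)).im = -γ := by simp [rfl']
  rw [e1, e2, e3, e4]
  have f1 := frac_ge (x := 3 - β) (c := 2) (y := -γ) (b := b) (by norm_num) (by linarith) (by linarith) (by rw [neg_sq]; exact hγ)
  have f2 := frac_ge (x := 2 + β) (c := 2.5) (y := -γ) (b := b) (by norm_num) (by linarith) (by linarith) (by rw [neg_sq]; exact hγ)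
  linarith

lemma zS {β γ : ℝ} (hγ0 : 0 ≤ γ) (hγ : γ ≤ 4.5) (hβ : 1/2 < β) (h0 : xi ((β:ℂ) + (γ:ℂ) * I) = 0) : False := by
  have hlt := xi_zero_lt h0
  have hre : ((β:ℂ) + (γ:ℂ) * I).re = β := by simp
  rw [hre] at hlt
  have hU := SR3_le
  have hne : ∀ y : ℝ, ((β:ℂ) + (y:ℂ) * I) ≠ rfl' ((β:ℂ) + (y:ℂ) * I) := by
    intro y h
    have := congrArg re h
    simp [rfl'] at this
    linarith
  have h0r : xi (rfl' ((β:ℂ) + (γ:ℂ) * I)) = 0 := by rw [xi_rfl', h0]; simp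
  rcases le_or_gt γ 3 with h3 | h3
  · have hA := SR3_ge {(β:ℂ) + (γ:ℂ) * I, rfl' ((β:ℂ) + (γ:ℂ) * I)} (by
      intro ρ hρ
      simp only [Finset.mem_insert, Finset.mem_singleton] at hρ
      rcases hρ with rfl | rfl
      · exact h0
      · exact h0r)
    rw [Finset.sum_pair (hne γ)] at hA
    have := pair_ge hβ hlt.2 (b := 9) (γ := γ) (by norm_num) (by nlinarith)
    norm_num at this hA hU
    linarith
  · have hcz : ((β:ℂ) + ((-γ : ℝ):ℂ) * I) = starRingEnd ℂ ((β:ℂ) + (γ:ℂ) * I) := by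
      apply Complex.ext <;> simp
    have h0c : xi ((β:ℂ) + ((-γ : ℝ):ℂ) * I) = 0 := by rw [hcz, xi_conj, h0]; simp
    have h0cr : xi (rfl' ((β:ℂ) + ((-γ : ℝ):ℂ) * I)) = 0 := by rw [xi_rfl', h0c]; simp
    have hA := SR3_ge ({(β:ℂ) + (γ:ℂ) * I, rfl' ((β:ℂ) + (γ:ℂ) * I)} ∪
      {(β:ℂ) + ((-γ : ℝ):ℂ) * I, rfl' ((β:ℂ) + ((-γ : ℝ):ℂ) * I)}) (by
      intro ρ hρ
      simp only [Finset.mem_union, Finset.mem_insert, Finset.mem_singleton] at hρ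
      rcases hρ with (rfl | rfl) | (rfl | rfl)
      · exact h0
      · exact h0r
      · exact h0c
      · exact h0cr)
    rw [Finset.sum_union, Finset.sum_pair (hne γ), Finset.sum_pair (hne (-γ))] at hA
    · have p1 := pair_ge hβ hlt.2 (b := 20.25) (γ := γ) (by norm_num) (by nlinarith)
      have p2 := pair_ge hβ hlt.2 (b := 20.25) (γ := -γ) (by norm_num) (by nlinarith)
      have p3 : (0.17:ℝ) ≤ 2 / (2^2 + 20.25) + 2.5 / (2.5^2 + 20.25) := by norm_num
      linarith
    · rw [Finset.disjoint_left]
      intro x hx hx'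
      have i1 : x.im = γ := by
        simp only [Finset.mem_insert, Finset.mem_singleton] at hx
        rcases hx with rfl | rfl <;> simp [rfl']
      have i2 : x.im = -γ := by
        simp only [Finset.mem_insert, Finset.mem_singleton] at hx'
        rcases hx' with rfl | rfl <;> simp [rfl']
      linarith

lemma region_right {γ : ℝ} (hγ : 0 < γ) (hL : 24 ≤ Real.log γ) {β y : ℝ} (hy0 : 0 ≤ y) (hy : y ≤ 6 * γ)
    (h0 : xi ((β:ℂ) + (y:ℂ) * I) = 0) : β ≤ 1 - 0.85 * (1 / (5.573412 * Real.log γ)) := by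
  by_contra hcon
  push Not at hcon
  have hsm : 0.85 * (1 / (5.573412 * Real.log γ)) ≤ 0.85 * (1 / (5.573412 * 24)) := by gcongr
  have hβ : 1/2 < β := by
    have : 0.85 * (1 / (5.573412 * 24)) ≤ (0.01:ℝ) := by norm_num
    linarith
  rcases le_or_gt y 4.5 with h | h
  · exact zS hy0 h hβ h0
  have hyp : 0 < y := by linarith
  have hlp : 0 < Real.log y := Real.log_pos (by linarith)
  rcases le_or_gt (Real.log y) 6 with h' | h'
  · refine zI h.le h' h0 ?_
    have : 1 / (5.573412 * 6) ≤ 1 / (5.573412 * Real.log y) := by gcongr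
    norm_num at this hsm hcon ⊢
    linarith
  · refine zC hyp h'.le h0 ?_
    have hl6 : Real.log y ≤ Real.log γ + 1.8 := by
      have h1 : Real.log y ≤ Real.log (6 * γ) := Real.log_le_log hyp hy
      have e : (6 * γ) = 2 * 2 * (3/2) * γ := by ring
      have e9 : Real.log ((3/2)^2) = 2 * Real.log (3/2) := by rw [Real.log_pow]; norm_num
      have e2 : ((3:ℝ)/2)^2 = 2 * (9/8) := by norm_num
      rw [e2, Real.log_mul (by norm_num) (by norm_num)] at e9
      have := Real.log_le_sub_one_of_pos (x := 9/8) (by norm_num)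
      have := log_two_le
      rw [e, Real.log_mul (by norm_num) (by positivity), Real.log_mul (by norm_num) (by norm_num), Real.log_mul (by norm_num) (by norm_num)] at h1
      linarith
    have : 0.85 * (1 / (5.573412 * Real.log γ)) ≤ 1 / (6.06 * Real.log y) := by
      rw [mul_one_div, div_le_div_iff₀ (by positivity) (by positivity)]
      linarith
    linarith

lemma region {γ : ℝ} (hγ : 0 < γ) (hL : 24 ≤ Real.log γ) {ρ : ℂ} (h0 : xi ρ = 0) (hy : |ρ.im| ≤ 6 * γ) :
    0.85 * (1 / (5.573412 * Real.log γ)) ≤ ρ.re ∧ ρ.re ≤ 1 - 0.85 * (1 / (5.573412 * Real.log γ)) := by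
  have main : ∀ ρ : ℂ, xi ρ = 0 → |ρ.im| ≤ 6 * γ → ρ.re ≤ 1 - 0.85 * (1 / (5.573412 * Real.log γ)) := by
    intro ρ h0 hy
    rcases le_total 0 ρ.im with h | h
    · rw [abs_of_nonneg h] at hy
      apply region_right hγ hL h hy
      rw [re_add_im]; exact h0
    · rw [abs_of_nonpos h] at hy
      apply region_right hγ hL (y := -ρ.im) (by linarith) hy
      have : ((ρ.re:ℂ) + ((-ρ.im : ℝ):ℂ) * I) = starRingEnd ℂ ρ := by
        apply Complex.ext <;> simp
      rw [this, xi_conj, h0]; simp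
  refine ⟨?_, main ρ h0 hy⟩
  have h1 := main (rfl' ρ) (by rw [xi_rfl', h0]; simp) (by
    have : (rfl' ρ).im = ρ.im := by simp [rfl']
    rw [this]; exact hy)
  have : (rfl' ρ).re = 1 - ρ.re := by simp [rfl']
  rw [this] at h1
  linarith

lemma zIII {β γ : ℝ} (hγ : 0 < γ) (hL : 24 ≤ Real.log γ) (h0 : xi ((β:ℂ) + (γ:ℂ) * I) = 0)
    (hβ : 1 - 1 / (5.573412 * Real.log γ) ≤ β) : False := by
  have hLp : 0 < Real.log γ := by linarith
  set η := 1 / (5.573412 * Real.log γ) with hη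
  have hηp : 0 < η := by positivity
  have hη1 : η ≤ 1 / (5.573412 * 24) := by rw [hη]; gcongr
  have hη2 : η ≤ 0.0075 := hη1.trans (by norm_num)
  have hg : 10^10 ≤ γ := by
    have := exp_lb 24 hγ (by exact_mod_cast hL) rfl
    norm_num at this ⊢
    linarith
  have hω : KB1.ω = 0.85 := rfl
  have hS : KB1.S = 264.2 := rfl
  have hz := (region hγ hL h0 (by
    have : ((β:ℂ) + (γ:ℂ) * I).im = γ := by simp
    rw [this, abs_of_pos hγ]; linarith)).2
  have hre : ((β:ℂ) + (γ:ℂ) * I).re = β := by simp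
  rw [hre, ← hη] at hz
  have h1 := KB1.core (B := 40 * 264.2 / γ) (η := η) (g := 10^10) hηp (by rw [hω]; linarith) (by norm_num) hg hη1 (by positivity) (by
    intro N hN k ρ hρ
    have hρl := xi_zero_lt hρ
    have hri : 0 ≤ ri (((1 + γ : ℝ):ℂ) - ρ) := by
      apply ri_nonneg
      rw [sub_re, ofReal_re]; linarith
    have zre : (((1 - KB1.ω * η : ℝ):ℂ) + ((k * γ : ℝ):ℂ) * I - ρ).re = 1 - KB1.ω * η - ρ.re := by simp
    have zim : (((1 - KB1.ω * η : ℝ):ℂ) + ((k * γ : ℝ):ℂ) * I - ρ).im = k * γ - ρ.im := by simp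
    rcases le_or_gt (|ρ.im|) (6 * γ) with h | h
    · have hr := region hγ hL hρ h
      rw [← hη] at hr
      have hp := KB1.strip_pos hηp (θ := 1 - 2 * KB1.ω * η) (by rw [hω]; linarith) hN
        (z := ((1 - KB1.ω * η : ℝ):ℂ) + ((k * γ : ℝ):ℂ) * I - ρ) (by rw [zre, hω]; linarith) (by rw [zre, hω]; linarith)
      have : 0 ≤ 40 * 264.2 / γ * ri (((1 + γ : ℝ):ℂ) - ρ) := by positivity
      linarith
    · have hk : (k : ℝ) ≤ 4 := by
        have : (k : ℕ) ≤ 4 := by omega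
        exact_mod_cast this
      have hk0 : (0:ℝ) ≤ (k : ℕ) := Nat.cast_nonneg _
      have him : |ρ.im| / 3 ≤ |(k:ℝ) * γ - ρ.im| := by
        have t1 : |ρ.im| - |(k:ℝ) * γ| ≤ |(k:ℝ) * γ - ρ.im| := by
          rw [abs_sub_comm]; exact abs_sub_abs_le_abs_sub _ _
        rw [abs_of_nonneg (by positivity : 0 ≤ (k:ℝ) * γ)] at t1
        nlinarith
      have hmp : 0 < |ρ.im| := by linarith
      have hf := KB1.P_far hηp (θ := 1 - 2 * KB1.ω * η) (N := N) (y := |ρ.im| / 3)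
        (z := ((1 - KB1.ω * η : ℝ):ℂ) + ((k * γ : ℝ):ℂ) * I - ρ) (by rw [hω]; linarith) (by linarith) rfl
        (by rw [zre, hω]; linarith) (by rw [zre, hω]; linarith) hN (by positivity) (by rw [zim]; exact him)
      refine le_trans (neg_le_neg ?_) hf
      rw [ri_eq, hS]
      have xre : (((1 + γ : ℝ):ℂ) - ρ).re = 1 + γ - ρ.re := by simp
      have xim : (((1 + γ : ℝ):ℂ) - ρ).im = -ρ.im := by simp
      rw [xre, xim, neg_sq, ← sq_abs ρ.im]
      set m := |ρ.im| with hm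
      set x := 1 + γ - ρ.re with hx
      have hx1 : γ ≤ x := by rw [hx]; linarith
      have hx3 : 3 * x ≤ m := by rw [hx]; linarith
      have hx0 : 0 < x := by linarith
      rw [div_mul_div_comm, div_le_div_iff₀ (by positivity) (by positivity)]
      have q1 : (3 * x)^2 ≤ m^2 := by gcongr
      have q2 : γ * (x^2 + m^2) ≤ x * (x^2 + m^2) := by gcongr
      have q3 : x * (9 * x^2) ≤ x * m^2 := by gcongr; linarith
      nlinarith) (by linarith) h0 (by rw [hω]; exact hz) hβ
  have hV := mul_le_mul_of_nonneg_right KB1_V (by positivity : 0 ≤ 1 / η)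
  have e : 1 / η = 5.573412 * Real.log γ := by rw [hη, one_div_one_div]
  have hcb : cb KB1.S (1 / (5.573412 * 24)) (10^10) ≤ -2.5 := by
    simp only [KB1, KB, cb, eb]; norm_num
  have hw : √γ * √γ = γ := Real.mul_self_sqrt hγ.le
  have hwl : (10:ℝ)^5 ≤ √γ := by
    apply Real.le_sqrt_of_sq_le
    norm_num at hg ⊢
    exact hg
  have hGR : GR ((1 + γ : ℝ):ℂ) ≤ √γ - 1 := by
    have h2 := G_re_le (s := ((1 + γ : ℝ):ℂ)) (by rw [ofReal_re]; linarith)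
    rw [ofReal_re, ofReal_im] at h2
    have h3 : Real.log (((1 + γ + 1) / 2)^2 + (0/2)^2 + 1/4) ≤ Real.log (γ^2) := by
      apply Real.log_le_log (by positivity)
      nlinarith
    have h4 : Real.log γ = 2 * Real.log √γ := by
      conv_lhs => rw [← hw]
      rw [Real.log_mul (by positivity) (by positivity)]; ring
    have h5 := Real.log_le_sub_one_of_pos (x := √γ) (by positivity)
    rw [Real.log_pow] at h3
    push_cast at h3
    have := log_pi_gt
    unfold GR
    linarith
  have hfar : 1/2 * (40 * 264.2 / γ) * (1 / γ + GR ((1 + γ : ℝ):ℂ)) ≤ 0.06 := by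
    have q1 : 1 / γ ≤ 1 := by rw [div_le_one hγ]; linarith
    have q2 : 1/2 * (40 * 264.2 / γ) * (1 / γ + GR ((1 + γ : ℝ):ℂ)) ≤ 1/2 * (40 * 264.2 / γ) * √γ := by
      apply mul_le_mul_of_nonneg_left (by linarith) (by positivity)
    have q3 : 1/2 * (40 * 264.2 / γ) * √γ = 5284 / √γ := by
      rw [← hw]
      have : √γ ≠ 0 := by positivity
      field_simp
      norm_num
      ring
    rw [q3] at q2
    refine q2.trans ?_
    rw [div_le_iff₀ (by positivity)]
    norm_num at hwl ⊢
    linarith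
  rw [e] at hV h1
  linarith

end ZFR

theorem zeta_zero_free_region (R : ℝ) (hR : R = 5.573412) :
    ∀ σ t : ℝ, t ≥ 3 → σ ≥ 1 - 1 / (R * Real.log t) →
      riemannZeta (σ + t * Complex.I) ≠ 0 := by
  intro σ t ht hσ hz
  subst hR
  have hre : ((σ:ℂ) + t * Complex.I).re = σ := by simp
  rcases le_or_gt 1 σ with h | h
  · exact riemannZeta_ne_zero_of_one_le_re (by rw [hre]; exact h) hz
  have htp : 0 < t := by linarith
  have hl1 : 1 ≤ Real.log t := by
    rw [Real.le_log_iff_exp_le htp]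
    have := Real.exp_one_lt_d9
    linarith
  have hsm : 1 / (5.573412 * Real.log t) ≤ 1 / (5.573412 * 1) := by gcongr
  have hσ2 : 1/2 < σ := by norm_num at hsm hσ ⊢; linarith
  have h0 : ZFR.xi ((σ:ℂ) + (t:ℂ) * Complex.I) = 0 := by
    rw [ZFR.xi_eq_zeta (by rw [hre]; linarith) (by
      intro h'
      rw [h'] at hre
      simp at hre
      linarith), hz]
    ring
  rcases le_or_gt t 4.5 with h1 | h1
  · exact ZFR.zS htp.le h1 hσ2 h0
  rcases le_or_gt (Real.log t) 6 with h2 | h2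
  · exact ZFR.zI h1.le h2 h0 hσ
  rcases le_or_gt (Real.log t) 24 with h3 | h3
  · exact ZFR.zII htp h2.le h3 h0 hσ
  · exact ZFR.zIII htp h3.le h0 hσ
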